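/- There exist a finite set S and a family (R_I)_{I ∈ 𝓘} of classical C'(1/6) relator sets over S, indexed by a set 𝓘 of cardinality 2^{ℵ0}, such that each group G_I = ⟨S | R_I⟩ is torsion-free, every nontrivial cyclic subgroup of G_I is strongly contracting in Cay(G_I, S), and for any two distinct I, J ∈ 𝓘 the groups G_I and G_J are not quasi-isometric. -/

import Mathlib

/- Common definitions: words, classical C'(1/6) presentations, word metrics,
   contraction, Morse property, etc. -/

namespace GSC

open Filter

/-- A word over the alphabet `S`: a list of letters with an exponent `±1`
(`true` = the letter, `false` = its formal inverse). -/
abbrev Word (S : Type) := List (S × Bool)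

/-- The formal inverse of a word. -/
def wordInv {S : Type} (w : Word S) : Word S := (w.map fun l => (l.1, !l.2)).reverse

/-- A word is (freely) reduced if no letter is followed by its formal inverse. -/
def Reduced {S : Type} (w : Word S) : Prop :=
  List.Chain' (fun a b => a.1 ≠ b.1 ∨ a.2 = b.2) w

/-- A word is cyclically reduced if its square is reduced. -/
def CyclicallyReduced {S : Type} (w : Word S) : Prop := Reduced (w ++ w)

/-- A piece with respect to a set of relators `R`: a word occurring as a prefix of
two distinct elements of `R`. -/
def IsPiece {S : Type} (R : Set (Word S)) (p : Word S) : Prop :=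
  ∃ r₁ ∈ R, ∃ r₂ ∈ R, r₁ ≠ r₂ ∧ p <+: r₁ ∧ p <+: r₂

/-- Closure of a set of words under inversion and cyclic permutation. -/
def symmClosure {S : Type} (R : Set (Word S)) : Set (Word S) :=
  {w | ∃ r ∈ R, ∃ n : ℕ, w = r.rotate n ∨ w = wordInv (r.rotate n)}

/-- A classical `C'(1/den)` collection of cyclically reduced words: after closing under
inversion and cyclic permutation, every piece `p` contained in a relator `r` satisfies
`den * |p| < |r|`. -/
def CprimeCollection {S : Type} (den : ℕ) (R : Set (Word S)) : Prop :=
  (∀ r ∈ R, CyclicallyReduced r) ∧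
  ∀ r ∈ symmClosure R, ∀ p : Word S, p <+: r → IsPiece (symmClosure R) p →
    den * p.length < r.length

/-- A classical `C'(1/6)` presentation: a set of cyclically reduced relators, closed under
inversion and cyclic permutation, in which every piece contained in a relator `r` has
length `< |r|/6`. -/
structure C6Presentation (S : Type) where
  rels : Set (Word S)
  cyclically_reduced : ∀ r ∈ rels, CyclicallyReduced r
  inv_mem : ∀ r ∈ rels, wordInv r ∈ rels
  rotate_mem : ∀ r ∈ rels, ∀ n : ℕ, r.rotate n ∈ rels
  small_cancellation : ∀ r ∈ rels, ∀ p : Word S, p <+: r → IsPiece rels p →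
    6 * p.length < r.length

/-- The element of the free group represented by a word. -/
def wordVal {S : Type} (w : Word S) : FreeGroup S :=
  (w.map fun l => (FreeGroup.of l.1) ^ (if l.2 then (1 : ℤ) else -1)).prod

/-- The group defined by a `C'(1/6)` presentation. -/
abbrev C6Presentation.Grp {S : Type} (P : C6Presentation S) : Type :=
  PresentedGroup (wordVal '' P.rels)

/-- The generating set of the presented group (the images of the letters of `S`). -/
def C6Presentation.gens {S : Type} (P : C6Presentation S) : Set P.Grp :=
  Set.range fun a : S => (PresentedGroup.of a : P.Grp)

/-- The element of the presented group represented by a word. -/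
def C6Presentation.elt {S : Type} (P : C6Presentation S) (w : Word S) : P.Grp :=
  (w.map fun l => (PresentedGroup.of l.1 : P.Grp) ^ (if l.2 then (1 : ℤ) else -1)).prod

/-- The word length of `g` with respect to a generating set `S ⊆ G`: the least `n`
such that `g` is a product of `n` elements of `S ∪ S⁻¹`. -/
noncomputable def wordLength {G : Type*} [Group G] (S : Set G) (g : G) : ℕ :=
  sInf {n : ℕ | ∃ l : List G, l.length = n ∧ (∀ x ∈ l, x ∈ S ∨ x⁻¹ ∈ S) ∧ l.prod = g}

/-- The word metric on `G` with respect to `S`, as a real-valued function. -/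
noncomputable def wdist {G : Type*} [Group G] (S : Set G) (g h : G) : ℝ :=
  (wordLength S (g⁻¹ * h) : ℝ)

/-- Distance from a point to a subset, in the word metric. -/
noncomputable def setDist {G : Type*} [Group G] (S : Set G) (x : G) (Y : Set G) : ℝ :=
  sInf (wdist S x '' Y)

/-- Closest point projection to a subset `Y`, in the word metric. -/
def proj {G : Type*} [Group G] (S : Set G) (Y : Set G) (x : G) : Set G :=
  {y ∈ Y | wdist S x y = setDist S x Y}

/-- Diameter of a subset, in the word metric. -/
noncomputable def setDiam {G : Type*} [Group G] (S : Set G) (A : Set G) : ℝ :=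
  sSup {d : ℝ | ∃ x ∈ A, ∃ y ∈ A, d = wdist S x y}

/-- Admissibility of a pair of contraction gauges `(ρ₁, ρ₂)`: both non-decreasing and
eventually non-negative, `ρ₁ r ≤ r`, `ρ₁` unbounded, and `ρ₂/ρ₁ → 0` at infinity. -/
def Admissible (ρ₁ ρ₂ : ℝ → ℝ) : Prop :=
  Monotone ρ₁ ∧ Monotone ρ₂ ∧
  (∀ᶠ r in atTop, 0 ≤ ρ₁ r) ∧ (∀ᶠ r in atTop, 0 ≤ ρ₂ r) ∧
  (∀ r : ℝ, ρ₁ r ≤ r) ∧ (∀ M : ℝ, ∃ r : ℝ, M ≤ ρ₁ r) ∧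
  Tendsto (fun r => ρ₂ r / ρ₁ r) atTop (nhds 0)

/-- `Y` is `(ρ₁,ρ₂)`-contracting inside the subspace `X` (with the metric induced by the
word metric of `S`): whenever `x, x' ∈ X` satisfy `d(x,x') ≤ ρ₁(d(x,Y))`, the projections
`π(x) ∪ π(x')` have diameter at most `ρ₂(d(x,Y))`. -/
def ContractingIn {G : Type*} [Group G] (S : Set G) (X Y : Set G) (ρ₁ ρ₂ : ℝ → ℝ) : Prop :=
  Admissible ρ₁ ρ₂ ∧
  ∀ x ∈ X, ∀ x' ∈ X, wdist S x x' ≤ ρ₁ (setDist S x Y) →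
    ∀ y ∈ proj S Y x ∪ proj S Y x', ∀ y' ∈ proj S Y x ∪ proj S Y x',
      wdist S y y' ≤ ρ₂ (setDist S x Y)

/-- `Y` is `(ρ₁,ρ₂)`-contracting in `Cay(G,S)`. -/
def ContractingWith {G : Type*} [Group G] (S : Set G) (ρ₁ ρ₂ : ℝ → ℝ) (Y : Set G) : Prop :=
  ContractingIn S Set.univ Y ρ₁ ρ₂

/-- `Y` is strongly contracting: `(r, C)`-contracting for some constant `C`. -/
def StronglyContracting {G : Type*} [Group G] (S : Set G) (Y : Set G) : Prop :=
  ∃ C : ℝ, ContractingWith S (fun r => r) (fun _ => C) Y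

/-- A sublinear function: non-decreasing, eventually non-negative, `f(r)/r → 0`. -/
def Sublinear (f : ℝ → ℝ) : Prop :=
  Monotone f ∧ (∀ᶠ r in atTop, 0 ≤ f r) ∧ Tendsto (fun r => f r / r) atTop (nhds 0)

/-- `f ⪯ g`: there are constants `C₁, C₂ > 0` and `C₃, C₄ ≥ 0` with
`f(x) ≤ C₁ g(C₂ x + C₃) + C₄` for all `x`. -/
def Preceq (f g : ℝ → ℝ) : Prop :=
  ∃ C₁ C₂ C₃ C₄ : ℝ, 0 < C₁ ∧ 0 < C₂ ∧ 0 ≤ C₃ ∧ 0 ≤ C₄ ∧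
    ∀ x : ℝ, f x ≤ C₁ * g (C₂ * x + C₃) + C₄

/-- `f ≍ g`: `f ⪯ g` and `g ⪯ f`. -/
def Asymp (f g : ℝ → ℝ) : Prop := Preceq f g ∧ Preceq g f

/-- `α ⊆ G` is a geodesic of `Cay(G,S)`: the image of an isometric embedding of a
subinterval of `ℤ` into `(G, d_S)`. -/
def IsGeodesic {G : Type*} [Group G] (S : Set G) (α : Set G) : Prop :=
  ∃ (I : Set ℤ) (γ : ℤ → G), I.OrdConnected ∧
    (∀ m ∈ I, ∀ n ∈ I, wdist S (γ m) (γ n) = |(m : ℝ) - (n : ℝ)|) ∧ α = γ '' I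

/-- `α ⊆ G` is a bi-infinite geodesic of `Cay(G,S)`. -/
def IsBiInfGeodesic {G : Type*} [Group G] (S : Set G) (α : Set G) : Prop :=
  ∃ γ : ℤ → G, (∀ m n : ℤ, wdist S (γ m) (γ n) = |(m : ℝ) - (n : ℝ)|) ∧ α = Set.range γ

/-- `Y` is Morse: there is `μ` such that every `(L,A)`-quasi-geodesic with endpoints on
`Y` stays in the `μ(L,A)`-neighborhood of `Y`. -/
def IsMorse {G : Type*} [Group G] (S : Set G) (Y : Set G) : Prop :=
  ∃ μ : ℝ → ℝ → ℝ, ∀ L A : ℝ, 1 ≤ L → 0 ≤ A →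
    ∀ (q : ℤ → G) (m n : ℤ), m ≤ n → q m ∈ Y → q n ∈ Y →
    (∀ i j : ℤ, m ≤ i → i ≤ n → m ≤ j → j ≤ n →
      L⁻¹ * |(i : ℝ) - (j : ℝ)| - A ≤ wdist S (q i) (q j) ∧
      wdist S (q i) (q j) ≤ L * |(i : ℝ) - (j : ℝ)| + A) →
    ∀ i : ℤ, m ≤ i → i ≤ n → setDist S (q i) Y ≤ μ L A

/-- Two subsets are at finite Hausdorff distance in the word metric. -/
def FinHausdorffDist {G : Type*} [Group G] (S : Set G) (A B : Set G) : Prop :=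
  ∃ ε : ℝ, (∀ a ∈ A, ∃ b ∈ B, wdist S a b ≤ ε) ∧ ∀ b ∈ B, ∃ a ∈ A, wdist S a b ≤ ε

/-- The embedded relator cycle determined by `g ∈ G(Γ)` and a relator `r`:
the set `{g ⋅ p̄ : p a prefix of r}`. -/
def relatorCycle {S : Type} (P : C6Presentation S) (g : P.Grp) (r : Word S) :
    Set P.Grp :=
  {x | ∃ p : Word S, p <+: r ∧ x = g * P.elt p}

/-- A geodesic `α` is locally `(ρ₁,ρ₂)`-contracting: for every embedded relator cycle
`Γ₀` meeting `α`, the set `Γ₀ ∩ α` is `(ρ₁,ρ₂)`-contracting as a subspace of `Γ₀`. -/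
def LocallyContracting {S : Type} (P : C6Presentation S) (α : Set P.Grp)
    (ρ₁ ρ₂ : ℝ → ℝ) : Prop :=
  ∀ (g : P.Grp) (r : Word S), r ∈ P.rels → (relatorCycle P g r ∩ α).Nonempty →
    ContractingIn P.gens (relatorCycle P g r) (relatorCycle P g r ∩ α) ρ₁ ρ₂

/-- The generating set `S ∪ W` of the coned-off space: `W` is the set of elements
represented by subwords of cyclic permutations of relators (equivalently, by prefixes
of relators, since the relator set is closed under cyclic permutation). -/
def conedGens {S : Type} (P : C6Presentation S) : Set P.Grp :=
  P.gens ∪ {x | ∃ r ∈ P.rels, ∃ p : Word S, p <+: r ∧ x = P.elt p}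

/-- The exponential growth rate of `(G,S)`. -/
noncomputable def growthRate {G : Type*} [Group G] (S : Set G) : ℝ :=
  limsup (fun n : ℕ => Real.log (Nat.card {g : G // wordLength S g ≤ n}) / (n : ℝ)) atTop

/-- Quasi-isometry of marked groups `(G,S)` and `(H,T)` via word metrics. -/
def QIsom {G H : Type*} [Group G] [Group H] (S : Set G) (T : Set H) : Prop :=
  ∃ (f : G → H) (L A : ℝ), 1 ≤ L ∧ 0 ≤ A ∧
    (∀ x y : G, L⁻¹ * wdist S x y - A ≤ wdist T (f x) (f y) ∧
      wdist T (f x) (f y) ≤ L * wdist S x y + A) ∧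
    ∀ h : H, ∃ x : G, wdist T (f x) h ≤ A

/-- A subgroup is virtually cyclic if it contains a cyclic subgroup of finite index. -/
def VirtuallyCyclic {G : Type*} [Group G] (E : Subgroup G) : Prop :=
  ∃ g : G, Subgroup.zpowers g ≤ E ∧ ((Subgroup.zpowers g).subgroupOf E).index ≠ 0

end GSC

namespace GSC

/-- The scale of the `n`-th word. -/
@[irreducible] def scale (n : ℕ) : ℕ := 2 ^ (n ^ 2 + 13)

/-- Parity of the `2`-adic valuation. -/
def par (i : ℕ) : Bool := decide (Even (padicValNat 2 i))

open Classical in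
/-- The marked positions of the `n`-th word. -/
noncomputable def mark (n i : ℕ) : Bool := decide (∃ j, 1 ≤ j ∧ j ≤ 63 ∧ i = j * scale n + j ^ 2)

/-- The length of the `n`-th word. -/
def wlen (n : ℕ) : ℕ := 64 * scale n - 1

/-- The letters of the `n`-th word (`e = true`) and of its inverse (`e = false`). -/
noncomputable def ltr (n : ℕ) (e : Bool) (i : ℕ) : (Bool × Bool) × Bool :=
  ((par (i + 1), mark n (if e then i + 1 else 64 * scale n - (i + 1))), e)

/-- The `n`-th word (`e = true`) and its inverse (`e = false`). -/
noncomputable def wd (n : ℕ) (e : Bool) : List ((Bool × Bool) × Bool) :=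
  (List.range (wlen n)).map (ltr n e)

lemma scale_ge (n : ℕ) : 8192 ≤ scale n := by
  unfold scale
  calc 8192 = 2 ^ 13 := by norm_num
    _ ≤ _ := Nat.pow_le_pow_right (by norm_num) (by omega)

lemma scale_dvd (n : ℕ) : 8192 ∣ scale n := by
  unfold scale
  exact ⟨2 ^ (n ^ 2), by rw [pow_add]; ring⟩

lemma scale_inj {n m : ℕ} (h : scale n = scale m) : n = m := by
  unfold scale at h
  have h1 := Nat.pow_right_injective le_rfl h
  have h2 : n ^ 2 = m ^ 2 := by simpa using h1
  exact Nat.pow_left_injective (by norm_num) h2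

lemma scale_lt_scale {n m : ℕ} (h : n < m) : scale n < scale m := by
  unfold scale
  exact Nat.pow_lt_pow_right (by norm_num) (by gcongr)

lemma scale_mono {n m : ℕ} (h : n ≤ m) : scale n ≤ scale m := by
  rcases h.eq_or_lt with rfl | h
  · rfl
  · exact (scale_lt_scale h).le

lemma scale_succ (n : ℕ) : scale (n + 1) = 2 ^ (2 * n + 1) * scale n := by
  unfold scale
  rw [← pow_add]; congr 1; ring

lemma padicValNat_two_pow_mul {a b : ℕ} (hb : Odd b) : padicValNat 2 (2 ^ a * b) = a := by
  have hb0 : b ≠ 0 := by rintro rfl; simp at hb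
  rw [padicValNat.mul (by positivity) hb0, padicValNat.prime_pow,
    padicValNat.eq_zero_of_not_dvd (by rwa [← even_iff_two_dvd, Nat.not_even_iff_odd]), add_zero]

lemma par_not_periodic {p l : ℕ} (hp : 1 ≤ p) (hl : 1 ≤ l)
    (h : ∀ t < 4 * l, par (p + t) = par (p + l + t)) : False := by
  obtain ⟨a, b, hb, rfl⟩ := Nat.exists_eq_two_pow_mul_odd (n := l) (by omega)
  have hb1 : 1 ≤ b := hb.pos
  set P := 2 ^ a with hP
  have hPpos : 0 < P := by positivity
  obtain ⟨r, hr⟩ : ∃ r, r = (2 * P + 4 * P * p - p) % (4 * P) := ⟨_, rfl⟩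
  have hrlt : r < 4 * P := hr ▸ Nat.mod_lt _ (by positivity)
  have hle : p ≤ 4 * P * p := by nlinarith
  obtain ⟨k, hk⟩ : ∃ k, p + r = 2 * P + 4 * P * k := by
    have h1 := Nat.div_add_mod (2 * P + 4 * P * p - p) (4 * P)
    rw [← hr] at h1
    generalize (2 * P + 4 * P * p - p) / (4 * P) = D at h1
    have h2 : 4 * P * D + (p + r) = 2 * P + 4 * P * p := by omega
    have h3 : D ≤ p := by
      by_contra hc
      have : 4 * P * (p + 1) ≤ 4 * P * D := Nat.mul_le_mul_left _ (by omega)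
      rw [mul_add] at this
      omega
    obtain ⟨k, rfl⟩ := Nat.exists_eq_add_of_le h3
    exact ⟨k, by rw [mul_add] at h2; omega⟩
  have h1 := h r (by nlinarith)
  have e1 : p + r = 2 ^ (a + 1) * (2 * k + 1) := by rw [hk, pow_succ, ← hP]; ring
  have e2 : p + P * b + r = 2 ^ a * (2 * (2 * k + 1) + b) := by
    rw [show p + P * b + r = p + r + P * b by ring, hk, ← hP]; ring
  rw [e1, e2] at h1
  unfold par at h1
  rw [padicValNat_two_pow_mul (by simp),
    padicValNat_two_pow_mul (Even.add_odd (even_two_mul _) hb)] at h1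
  have := decide_eq_decide.mp h1
  rw [Nat.even_add_one] at this
  tauto

lemma mark_iff {n i : ℕ} : mark n i = true ↔ ∃ j, 1 ≤ j ∧ j ≤ 63 ∧ i = j * scale n + j ^ 2 := by
  simp [mark]

lemma mark_small {n i : ℕ} (h : i ≤ scale n) : mark n i = false := by
  rw [Bool.eq_false_iff, Ne, mark_iff]
  rintro ⟨j, h1, -, rfl⟩
  nlinarith [scale_ge n]

lemma mark_large {n i : ℕ} (h : 63 * scale n + 3969 < i) : mark n i = false := by
  rw [Bool.eq_false_iff, Ne, mark_iff]
  rintro ⟨j, h1, h2, rfl⟩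
  nlinarith [scale_ge n]

lemma mark_window_aux {n m i i' : ℕ} (hi : i + 3 * scale n ≤ wlen n)
    (h : ∀ t < 3 * scale n, mark n (i + 1 + t) = mark m (i' + 1 + t)) : n = m ∧ i = i' := by
  have hq := scale_ge n
  have hqm := scale_ge m
  unfold wlen at hi
  set q := scale n with hqdef
  obtain ⟨a, b, hb, rfl⟩ : ∃ a b, b < q ∧ i = a * q + b :=
    ⟨i / q, i % q, Nat.mod_lt _ (by omega), (Nat.div_add_mod' i q).symm⟩
  have ha : a ≤ 60 := by
    by_contra hc
    have : 61 * q ≤ a * q := Nat.mul_le_mul_right _ (by omega)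
    omega
  have hm1 : mark n ((a + 1) * q + (a + 1) ^ 2) = true :=
      mark_iff.2 ⟨a + 1, by omega, by omega, rfl⟩
  have hm2 : mark n ((a + 2) * q + (a + 2) ^ 2) = true :=
      mark_iff.2 ⟨a + 2, by omega, by omega, rfl⟩
  have hsq : (a + 1) ^ 2 ≤ 61 ^ 2 := by gcongr; omega
  have hsq2 : (a + 2) ^ 2 = (a + 1) ^ 2 + (2 * a + 3) := by ring
  have hsq1 : 1 ≤ (a + 1) ^ 2 := Nat.one_le_pow _ _ (by omega)
  set A := (a + 1) ^ 2 with hA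
  obtain ⟨t1, ht1⟩ : ∃ t, (a + 1) * q + A = a * q + b + 1 + t :=
    ⟨q + A - b - 1, by rw [add_mul]; omega⟩
  have ht1' : t1 + b + 1 = q + A := by rw [add_mul] at ht1; omega
  have ht2 : (a + 2) * q + (a + 2) ^ 2 = a * q + b + 1 + (t1 + (q + 2 * a + 3)) := by
    rw [hsq2, add_mul] ; omega
  rw [ht1, h t1 (by omega), mark_iff] at hm1
  rw [ht2, h _ (by omega), mark_iff] at hm2
  obtain ⟨j, j1, j2, hj⟩ := hm1
  obtain ⟨k, k1, k2, hk⟩ := hm2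
  have hjk : j < k := by
    by_contra hc
    have : k * scale m + k ^ 2 ≤ j * scale m + j ^ 2 := by gcongr <;> omega
    omega
  have hkj : k = j + 1 := by
    by_contra hc
    have h3 : mark m ((j + 1) * scale m + (j + 1) ^ 2) = true :=
      mark_iff.2 ⟨j + 1, by omega, by omega, rfl⟩
    have h4 : (j + 1) * scale m + (j + 1) ^ 2 < k * scale m + k ^ 2 := by
      have : j + 1 < k := by omega
      have h5 : (j + 1) * scale m ≤ k * scale m := by gcongr
      have h6 : (j + 1) ^ 2 < k ^ 2 := by gcongr
      omega
    have h4' : j * scale m + j ^ 2 < (j + 1) * scale m + (j + 1) ^ 2 := by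
      have h6 : j ^ 2 < (j + 1) ^ 2 := by gcongr; omega
      rw [add_mul]; omega
    obtain ⟨s, hs⟩ : ∃ s, (j + 1) * scale m + (j + 1) ^ 2 = i' + 1 + s :=
      ⟨(j + 1) * scale m + (j + 1) ^ 2 - (i' + 1), by omega⟩
    rw [hs, ← h s (by omega), mark_iff] at h3
    obtain ⟨l, l1, l2, hl⟩ := h3
    have hl1 : a + 1 < l := by
      by_contra hc
      have h7 : l * scale n + l ^ 2 ≤ (a + 1) * scale n + (a + 1) ^ 2 := by gcongr <;> omega
      rw [← hqdef, ← hA] at h7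
      rw [← hqdef] at hl
      omega
    have h7 : (a + 2) * scale n + (a + 2) ^ 2 ≤ l * scale n + l ^ 2 := by gcongr <;> omega
    rw [← hqdef] at h7 hl
    omega
  subst hkj
  have hgap : q + 2 * a + 3 = scale m + 2 * j + 1 := by
    have : (j + 1) * scale m + (j + 1) ^ 2 = j * scale m + j ^ 2 + (scale m + 2 * j + 1) := by ring
    omega
  obtain ⟨x, hx⟩ := scale_dvd n
  obtain ⟨y, hy⟩ := scale_dvd m
  have hxy : scale n = scale m := by omega
  have hnm : n = m := scale_inj hxy
  refine ⟨hnm, ?_⟩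
  have hja : j = a + 1 := by omega
  subst hja
  rw [← hA, ← hxy, ← hqdef] at hj
  omega

lemma wlen_add (n : ℕ) : wlen n + 1 = 64 * scale n := by
  have := scale_ge n
  unfold wlen; omega

/-- A window of length `3 * scale n` determines the word and the position in it. -/
lemma window_unique {n m i i' : ℕ} {e e' : Bool} (hi : i + 3 * scale n ≤ wlen n)
    (hi' : i' + 3 * scale n ≤ wlen m)
    (h : ∀ t < 3 * scale n, ltr n e (i + t) = ltr m e' (i' + t)) : n = m ∧ e = e' ∧ i = i' := by
  have hq := scale_ge n
  have he : e = e' := by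
    have := h 0 (by omega)
    simp only [ltr, Prod.mk.injEq] at this
    exact this.2
  subst he
  have hn := wlen_add n
  have hm := wlen_add m
  cases e
  · have := mark_window_aux (n := n) (m := m) (i := wlen n - i - 3 * scale n)
      (i' := wlen m - i' - 3 * scale n) (by omega) (fun t ht => by
        have := h (3 * scale n - 1 - t) (by omega)
        simp only [ltr, Prod.mk.injEq, Bool.false_eq_true, if_false] at this
        convert this.1.2 using 2 <;> omega)
    obtain ⟨rfl, h2⟩ := this
    exact ⟨rfl, rfl, by omega⟩
  · have := mark_window_aux (n := n) (m := m) (i := i) (i' := i') hi (fun t ht => by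
        have := h t ht
        simp only [ltr, Prod.mk.injEq, if_true] at this
        convert this.1.2 using 2 <;> omega)
    exact ⟨this.1, rfl, this.2⟩

lemma par_reflect {n i : ℕ} (h : i + 1 < 64 * scale n) :
    par (64 * scale n - (i + 1)) = par (i + 1) := by
  have h64 : 64 * scale n = 2 ^ (n ^ 2 + 19) := by
    unfold scale; rw [show n ^ 2 + 19 = 6 + (n ^ 2 + 13) by ring, pow_add 2 6]; norm_num
  rw [h64] at h ⊢
  set N := n ^ 2 + 19
  obtain ⟨a, b, hb, hab⟩ := Nat.exists_eq_two_pow_mul_odd (n := i + 1) (by omega)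
  have hb1 : 1 ≤ b := hb.pos
  have haN : a < N := by
    by_contra hc
    have h1 : 2 ^ N ≤ 2 ^ a := Nat.pow_le_pow_right (by norm_num) (by omega)
    have h2 : 2 ^ a ≤ 2 ^ a * b := Nat.le_mul_of_pos_right _ hb1
    omega
  obtain ⟨k, hk⟩ := Nat.exists_eq_add_of_lt haN
  have e1 : 2 ^ N - (i + 1) = 2 ^ a * (2 * 2 ^ k - b) := by
    rw [Nat.mul_sub, ← hab, hk]
    congr 1
    rw [pow_add, pow_add]; ring
  have hlt : b < 2 * 2 ^ k := by
    by_contra hc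
    have h1 : 2 ^ a * (2 * 2 ^ k) ≤ 2 ^ a * b := Nat.mul_le_mul_left _ (by omega)
    have h2 : 2 ^ a * (2 * 2 ^ k) = 2 ^ N := by rw [hk, pow_add, pow_add]; ring
    omega
  rw [e1, hab]
  unfold par
  rw [padicValNat_two_pow_mul hb, padicValNat_two_pow_mul]
  exact Nat.Even.sub_odd hlt.le (even_two_mul _) hb

@[simp] lemma wd_length (n : ℕ) (e : Bool) : (wd n e).length = wlen n := by simp [wd]

lemma wd_getElem? {n i : ℕ} {e : Bool} (h : i < wlen n) : (wd n e)[i]? = some (ltr n e i) := by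
  simp [wd, h]

lemma wd_getElem {n i : ℕ} {e : Bool} (h : i < (wd n e).length) : (wd n e)[i] = ltr n e i := by
  simp [wd]

lemma ltr_not {n i : ℕ} {e : Bool} (h : i < wlen n) :
    ltr n (!e) (wlen n - 1 - i) = ((ltr n e i).1, !(ltr n e i).2) := by
  have h1 := wlen_add n
  have h2 := par_reflect (n := n) (i := i) (by omega)
  have h3 : 64 * scale n - (wlen n - 1 - i + 1) = i + 1 := by omega
  have h4 : wlen n - 1 - i + 1 = 64 * scale n - (i + 1) := by omega
  unfold ltr
  rw [h3, h4, h2]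
  cases e <;> simp

lemma invRev_wd (n : ℕ) (e : Bool) : FreeGroup.invRev (wd n e) = wd n (!e) := by
  apply List.ext_getElem
  · simp
  · intro i h1 h2
    have hi : i < wlen n := by simpa using h2
    have := ltr_not (n := n) (e := e) (i := wlen n - 1 - i) (by omega)
    rw [show wlen n - 1 - (wlen n - 1 - i) = i by omega] at this
    simp [FreeGroup.invRev, wd, this]

/-- Short prefixes of the words do not depend on the index. -/
lemma ltr_small {n m i : ℕ} {e : Bool} (hn : i < scale n / 2) (hm : i < scale m / 2) :
    ltr n e i = ltr m e i := by
  have h1 := scale_ge n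
  have h2 := scale_ge m
  unfold ltr
  cases e
  · simp only [Bool.false_eq_true, if_false]
    rw [mark_large (by omega), mark_large (by omega)]
  · simp only [if_true]
    rw [mark_small (by omega), mark_small (by omega)]

end GSC

namespace GSC

/-- The letters of the relators, read cyclically. -/
noncomputable def cyc (n : ℕ) (d : Bool) (k : ℕ) : ((Bool × Bool) × Bool) × Bool :=
  if k % (2 * wlen n) < wlen n then (((ltr n true (k % (2 * wlen n))).1, d), true)
  else (((ltr n false (k % (2 * wlen n) - wlen n)).1, !d), false)

/-- The relators: cyclic permutations of the `n`-th relator (`d = true`) and its inverse. -/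
noncomputable def relator (n : ℕ) (d : Bool) (s : ℕ) : Word ((Bool × Bool) × Bool) :=
  (List.range (2 * wlen n)).map fun k => cyc n d (s + k)

lemma wlen_pos (n : ℕ) : 0 < wlen n := by
  have := wlen_add n; have := scale_ge n; omega

lemma cyc_mod (n : ℕ) (d : Bool) (k : ℕ) : cyc n d (k % (2 * wlen n)) = cyc n d k := by
  simp [cyc]

lemma cyc_congr {n : ℕ} {d : Bool} {k l : ℕ} (h : k ≡ l [MOD 2 * wlen n]) :
    cyc n d k = cyc n d l := by
  rw [← cyc_mod n d k, ← cyc_mod n d l, h]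

lemma cyc_sign (n : ℕ) (d : Bool) (k : ℕ) : (cyc n d k).2 = (d == (cyc n d k).1.2) := by
  unfold cyc
  split_ifs <;> cases d <;> rfl

lemma cyc_snd (n : ℕ) (d : Bool) (k : ℕ) :
    (cyc n d k).2 = decide (k % (2 * wlen n) < wlen n) := by
  unfold cyc
  split_ifs with h <;> simp [h]

@[simp] lemma relator_length (n : ℕ) (d : Bool) (s : ℕ) : (relator n d s).length = 2 * wlen n := by
  simp [relator]

lemma relator_getElem {n : ℕ} {d : Bool} {s k : ℕ} (h : k < (relator n d s).length) :
    (relator n d s)[k] = cyc n d (s + k) := by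
  simp [relator]

lemma relator_congr {n : ℕ} {d : Bool} {s t : ℕ} (h : s ≡ t [MOD 2 * wlen n]) :
    relator n d s = relator n d t := by
  unfold relator
  exact List.map_congr_left fun k _ => cyc_congr (h.add_right k)

lemma relator_rotate (n : ℕ) (d : Bool) (s m : ℕ) :
    (relator n d s).rotate m = relator n d (s + m) := by
  apply List.ext_getElem
  · simp
  · intro k h1 h2
    rw [List.getElem_rotate, relator_getElem, relator_getElem]
    apply cyc_congr
    rw [relator_length]
    have := (Nat.mod_modEq (k + m) (2 * wlen n)).add_left s
    rwa [show s + m + k = s + (k + m) by ring]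

lemma cyc_inv {n : ℕ} {d : Bool} {k : ℕ} (hk : k < 2 * wlen n) :
    cyc n (!d) (2 * wlen n - 1 - k) = ((cyc n d k).1, !(cyc n d k).2) := by
  have h0 := wlen_pos n
  unfold cyc
  rw [Nat.mod_eq_of_lt hk, Nat.mod_eq_of_lt (by omega)]
  by_cases h : k < wlen n
  · rw [if_pos h, if_neg (by omega)]
    have := ltr_not (n := n) (e := true) h
    rw [show 2 * wlen n - 1 - k - wlen n = wlen n - 1 - k by omega]
    rw [Bool.not_true] at this
    simp [this]
  · rw [if_neg h, if_pos (by omega)]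
    have := ltr_not (n := n) (e := false) (i := k - wlen n) (by omega)
    rw [show wlen n - 1 - (k - wlen n) = 2 * wlen n - 1 - k by omega] at this
    rw [Bool.not_false] at this
    simp [this]

lemma wordInv_relator {n s : ℕ} (d : Bool) (hs : s < 2 * wlen n) :
    wordInv (relator n d s) = relator n (!d) (2 * wlen n - s) := by
  have h0 := wlen_pos n
  apply List.ext_getElem
  · simp [wordInv]
  · intro k h1 h2
    rw [relator_getElem]
    have hk : k < 2 * wlen n := by simpa using h2
    simp only [wordInv, List.getElem_reverse, List.getElem_map, List.length_map, relator_length,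
      relator_getElem]
    rw [← cyc_mod n d, ← cyc_inv (Nat.mod_lt _ (by omega))]
    apply cyc_congr
    generalize 2 * wlen n = W at *
    rcases lt_or_ge (s + (W - 1 - k)) W with h | h
    · rw [Nat.mod_eq_of_lt h]
      have : W - s + k = (W - 1 - (s + (W - 1 - k))) + W := by omega
      rw [this]; exact (Nat.add_modEq_right).symm
    · rw [Nat.mod_eq_sub_mod h, Nat.mod_eq_of_lt (by omega)]
      have : W - s + k = (W - 1 - (s + (W - 1 - k) - W)) := by omega
      rw [this]

lemma reduced_of_sign {S : Type} (f : S → Bool) (w : Word S) (h : ∀ a ∈ w, a.2 = f a.1) :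
    Reduced w := by
  change List.IsChain _ _
  rw [List.isChain_iff_getElem]
  intro i hi
  by_cases hab : (w[i]).1 = (w[i + 1]).1
  · right
    rw [h _ (List.getElem_mem _), h _ (List.getElem_mem _), hab]
  · exact Or.inl hab

lemma cyc_window {n x L : ℕ} {d b : Bool} (hL : 0 < L) (h : ∀ t < L, (cyc n d (x + t)).2 = b) :
    (b = true ∧ x % (2 * wlen n) + L ≤ wlen n) ∨
      (b = false ∧ wlen n ≤ x % (2 * wlen n) ∧ x % (2 * wlen n) + L ≤ 2 * wlen n) := by
  have h0 := wlen_pos n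
  have hx := Nat.mod_lt x (show 0 < 2 * wlen n by omega)
  have key : ∀ t, x % (2 * wlen n) + t < 2 * wlen n →
      (x + t) % (2 * wlen n) = x % (2 * wlen n) + t := by
    intro t ht
    rw [Nat.add_mod, Nat.mod_eq_of_lt (a := t) (by omega), Nat.mod_eq_of_lt ht]
  have h1 := h 0 hL
  rw [cyc_snd, add_zero] at h1
  cases b
  · right
    simp only [decide_eq_false_iff_not, not_lt] at h1
    refine ⟨rfl, h1, ?_⟩
    by_contra hc
    have h2 := h (2 * wlen n - x % (2 * wlen n)) (by omega)
    rw [cyc_snd] at h2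
    have h3 : (x + (2 * wlen n - x % (2 * wlen n))) % (2 * wlen n) = 0 := by
      have h4 := Nat.div_add_mod x (2 * wlen n)
      have : x + (2 * wlen n - x % (2 * wlen n)) =
          2 * wlen n * (x / (2 * wlen n)) + 2 * wlen n := by omega
      rw [this]; simp
    rw [h3] at h2
    simp [h0] at h2
  · left
    simp only [decide_eq_true_eq] at h1
    refine ⟨rfl, ?_⟩
    by_contra hc
    have h2 := h (wlen n - x % (2 * wlen n)) (by omega)
    rw [cyc_snd, key _ (by omega)] at h2
    simp only [decide_eq_true_eq] at h2
    omega

lemma relator_unique {n m s s' L : ℕ} {d d' : Bool} (hs : s < 2 * wlen n) (hs' : s' < 2 * wlen m)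
    (hL : 2 * wlen n ≤ 6 * L) (h : ∀ k < L, cyc n d (s + k) = cyc m d' (s' + k)) :
    n = m ∧ d = d' ∧ s = s' := by
  have hq := scale_ge n
  have hw := wlen_add n
  have h0 := wlen_pos m
  have hd : d = d' := by
    have h1 := h 0 (by omega)
    have h2 := cyc_sign n d (s + 0)
    have h3 := cyc_sign m d' (s' + 0)
    rw [← h1] at h3
    rw [h2] at h3
    revert h3
    cases d <;> cases d' <;> cases (cyc n _ (s + 0)).1.2 <;> simp
  subst hd
  obtain ⟨a, b, ha, hab⟩ : ∃ a b, a ≤ 3 * scale n ∧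
      ∀ t < 3 * scale n, (cyc n d (s + a + t)).2 = b := by
    have : ∀ c, c < 2 * wlen n → c % (2 * wlen n) = c := fun c hc => Nat.mod_eq_of_lt hc
    by_cases h1 : s + 3 * scale n ≤ wlen n
    · refine ⟨0, true, by omega, fun t ht => ?_⟩
      rw [cyc_snd, this _ (by omega)]; simp; omega
    by_cases h2 : s < wlen n
    · refine ⟨wlen n - s, false, by omega, fun t ht => ?_⟩
      rw [cyc_snd, this _ (by omega)]; simp; omega
    by_cases h3 : s + 3 * scale n ≤ 2 * wlen n
    · refine ⟨0, false, by omega, fun t ht => ?_⟩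
      rw [cyc_snd, this _ (by omega)]; simp; omega
    · refine ⟨2 * wlen n - s, true, by omega, fun t ht => ?_⟩
      rw [cyc_snd, show s + (2 * wlen n - s) + t = t + 2 * wlen n by omega,
        Nat.add_mod_right, this _ (by omega)]
      simp; omega
  have hab' : ∀ t < 3 * scale n, (cyc m d (s' + a + t)).2 = b := by
    intro t ht
    rw [add_assoc, ← h _ (by omega), ← add_assoc, hab t ht]
  have e : ∀ {k x t}, x % (2 * wlen k) + t < 2 * wlen k →
      (x + t) % (2 * wlen k) = x % (2 * wlen k) + t := by
    intro k x t ht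
    rw [Nat.add_mod, Nat.mod_eq_of_lt (a := t) (by omega), Nat.mod_eq_of_lt ht]
  have key : n = m ∧ (s + a) % (2 * wlen n) = (s' + a) % (2 * wlen m) := by
    rcases cyc_window (by omega) hab with ⟨rfl, h1⟩ | ⟨rfl, h1, h2⟩
    · rcases cyc_window (by omega) hab' with ⟨-, h1'⟩ | ⟨h', -⟩
      swap
      · simp at h'
      have := window_unique (n := n) (m := m) (e := true) (e' := true) h1 h1' (fun t ht => by
        have h3 := h (a + t) (by omega)
        rw [← add_assoc, ← add_assoc] at h3
        unfold cyc at h3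
        rw [e (k := n) (x := s + a) (by omega), e (k := m) (x := s' + a) (by omega),
          if_pos (by omega), if_pos (by omega)] at h3
        simp only [Prod.mk.injEq] at h3
        exact Prod.ext h3.1.1 rfl)
      exact ⟨this.1, this.2.2⟩
    · rcases cyc_window (by omega) hab' with ⟨h', -⟩ | ⟨-, h1', h2'⟩
      · simp at h'
      have := window_unique (n := n) (m := m) (e := false) (e' := false)
        (i := (s + a) % (2 * wlen n) - wlen n) (i' := (s' + a) % (2 * wlen m) - wlen m)
        (by omega) (by omega) (fun t ht => by
        have h3 := h (a + t) (by omega)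
        rw [← add_assoc, ← add_assoc] at h3
        unfold cyc at h3
        rw [e (k := n) (x := s + a) (by omega), e (k := m) (x := s' + a) (by omega),
          if_neg (by omega), if_neg (by omega)] at h3
        simp only [Prod.mk.injEq] at h3
        rw [Nat.sub_add_comm h1, Nat.sub_add_comm h1'] at h3
        exact Prod.ext h3.1.1 rfl)
      obtain ⟨rfl, -, h5⟩ := this
      exact ⟨rfl, by omega⟩
  obtain ⟨rfl, h5⟩ := key
  refine ⟨rfl, rfl, ?_⟩
  have h6 : s ≡ s' [MOD 2 * wlen n] := Nat.ModEq.add_right_cancel' a h5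
  exact h6.eq_of_lt_of_lt hs hs'

/-- The `C'(1/6)` presentation attached to a set of indices. -/
noncomputable def pres (I : Set ℕ) : C6Presentation ((Bool × Bool) × Bool) where
  rels := {r | ∃ n ∈ I, ∃ d, ∃ s < 2 * wlen n, r = relator n d s}
  cyclically_reduced := by
    rintro _ ⟨n, -, d, s, -, rfl⟩
    apply reduced_of_sign (fun a => d == a.2)
    intro a ha
    rw [List.mem_append, or_self, relator, List.mem_map] at ha
    obtain ⟨k, -, rfl⟩ := ha
    exact cyc_sign _ _ _
  inv_mem := by
    rintro _ ⟨n, hn, d, s, hs, rfl⟩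
    refine ⟨n, hn, !d, (2 * wlen n - s) % (2 * wlen n), Nat.mod_lt _ (by omega), ?_⟩
    rw [wordInv_relator d hs]
    exact relator_congr (Nat.mod_modEq _ _).symm
  rotate_mem := by
    rintro _ ⟨n, hn, d, s, hs, rfl⟩ m
    refine ⟨n, hn, d, (s + m) % (2 * wlen n), Nat.mod_lt _ (by omega), ?_⟩
    rw [relator_rotate]
    exact relator_congr (Nat.mod_modEq _ _).symm
  small_cancellation := by
    rintro r hr p hp ⟨r₁, h₁, r₂, h₂, hne, hp₁, hp₂⟩
    have key : ∀ r' ∈ {r | ∃ n ∈ I, ∃ d, ∃ s < 2 * wlen n, r = relator n d s}, p <+: r' →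
        r.length ≤ 6 * p.length → r = r' := by
      rintro _ ⟨m, -, d', s', hs', rfl⟩ hp' hle
      obtain ⟨n, -, d, s, hs, rfl⟩ := hr
      rw [relator_length] at hle
      have h := relator_unique (d := d) (d' := d') hs hs' hle (fun k hk => by
        have e1 := hp.getElem hk
        have e2 := hp'.getElem hk
        rw [relator_getElem] at e1 e2
        rw [← e1, ← e2])
      obtain ⟨rfl, rfl, rfl⟩ := h
      rfl
    by_contra hc
    exact hne ((key r₁ h₁ hp₁ (by omega)).symm.trans (key r₂ h₂ hp₂ (by omega)))

end GSC

namespace GSC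
open FreeGroup

section FreeGroupWords

variable {α : Type}

lemma mk_append (L₁ L₂ : List (α × Bool)) :
    FreeGroup.mk (L₁ ++ L₂) = FreeGroup.mk L₁ * FreeGroup.mk L₂ := FreeGroup.mul_mk.symm

lemma invRev_drop (L : List (α × Bool)) (k : ℕ) :
    invRev (L.drop k) = (invRev L).take (L.length - k) := by
  simp [invRev, List.map_drop, List.reverse_drop]

lemma mk_take_add (L : List (α × Bool)) (k s : ℕ) :
    FreeGroup.mk (L.take (k + s)) = FreeGroup.mk (L.take k) * FreeGroup.mk ((L.drop k).take s) := by
  rw [← mk_append, List.take_add]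

variable [DecidableEq α]

lemma exists_common_start {α : Type} [DecidableEq α] (l₁ l₂ : List α) :
    ∃ p a b, l₁ = p ++ a ∧ l₂ = p ++ b ∧
    ∀ x ∈ a.head?, ∀ y ∈ b.head?, x ≠ y := by
  induction l₁ generalizing l₂ with
  | nil => exact ⟨[], [], l₂, rfl, rfl, by simp⟩
  | cons x l₁ ih =>
    rcases l₂ with _ | ⟨y, l₂⟩
    · exact ⟨[], _, [], rfl, rfl, by simp⟩
    by_cases h : x = y
    · subst h
      obtain ⟨p, a, b, rfl, rfl, h⟩ := ih l₂
      exact ⟨x :: p, a, b, rfl, rfl, h⟩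
    · exact ⟨[], x :: l₁, y :: l₂, rfl, rfl, by simpa using h⟩

lemma isReduced_invRev {L : List (α × Bool)} (h : IsReduced L) : IsReduced (invRev L) := by
  rw [isReduced_iff_reduce_eq, reduce_invRev, h.reduce_eq]

lemma toWord_mk_of_isReduced {L : List (α × Bool)} (h : IsReduced L) :
    (FreeGroup.mk L).toWord = L := by rw [toWord_mk, h.reduce_eq]

lemma toWord_inv_mul (x y : FreeGroup α) : ∃ k ≤ x.norm, k ≤ y.norm ∧
    x.toWord.take k = y.toWord.take k ∧
    (x⁻¹ * y).toWord = invRev (x.toWord.drop k) ++ y.toWord.drop k := by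
  obtain ⟨p, a, b, hx, hy, hab⟩ := exists_common_start x.toWord y.toWord
  refine ⟨p.length, by simp [FreeGroup.norm, hx], by simp [FreeGroup.norm, hy],
    by simp [hx, hy], ?_⟩
  have ha : IsReduced a := by
    have h := isReduced_toWord (x := x)
    rw [hx] at h
    exact (List.isChain_append.1 h).2.1
  have hb : IsReduced b := by
    have h := isReduced_toWord (x := y)
    rw [hy] at h
    exact (List.isChain_append.1 h).2.1
  have h1 : x⁻¹ * y = FreeGroup.mk (invRev a ++ b) := by
    rw [← mk_toWord (x := x), ← mk_toWord (x := y), hx, hy, mk_append, mk_append, mk_append,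
      ← inv_mk]
    group
  rw [h1, hx, hy]
  simp only [List.drop_left]
  apply toWord_mk_of_isReduced
  refine List.isChain_append.2 ⟨isReduced_invRev ha, hb, ?_⟩
  intro u hu v hv huv
  rcases a with _ | ⟨c, a⟩
  · simp at hu
  · have h2 : (c.1, !c.2) = u := by simpa [invRev] using hu
    subst h2
    have h3 := hab c (by simp) v hv
    by_contra hne
    apply h3
    refine Prod.ext (show c.1 = v.1 from huv) ?_
    revert hne; cases c.2 <;> cases v.2 <;> simp

lemma norm_eq_length (x : FreeGroup α) : x.norm = x.toWord.length := rfl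

lemma norm_mk_take_le (L : List (α × Bool)) (k : ℕ) : (FreeGroup.mk (L.take k)).norm ≤ k :=
  norm_mk_le.trans (by simp)

end FreeGroupWords

/-- The `n`-th element and its inverse. -/
noncomputable def uel (n : ℕ) (e : Bool) : FreeGroup (Bool × Bool) := FreeGroup.mk (wd n e)

/-- The subgroup generated by the elements with index in `I`. -/
def sub (I : Set ℕ) : Subgroup (FreeGroup (Bool × Bool)) :=
  Subgroup.closure {x | ∃ n ∈ I, x = uel n true}

lemma uel_inv (n : ℕ) (e : Bool) : (uel n e)⁻¹ = uel n (!e) := by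
  rw [uel, inv_mk, invRev_wd, uel]

lemma uel_mem {I : Set ℕ} {n : ℕ} (hn : n ∈ I) (e : Bool) : uel n e ∈ sub I := by
  have h : uel n true ∈ sub I := Subgroup.subset_closure ⟨n, hn, rfl⟩
  cases e
  · rw [← Bool.not_true, ← uel_inv]; exact inv_mem h
  · exact h

lemma sub_mono {I J : Set ℕ} (h : I ⊆ J) : sub I ≤ sub J :=
  Subgroup.closure_mono fun _ ⟨n, hn, hx⟩ => ⟨n, h hn, hx⟩

lemma toWord_uel (n : ℕ) (e : Bool) : (uel n e).toWord = wd n e := by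
  apply toWord_mk_of_isReduced
  unfold FreeGroup.IsReduced
  rw [List.isChain_iff_getElem]
  intro i hi _
  rw [wd_getElem, wd_getElem]
  rfl

lemma norm_uel (n : ℕ) (e : Bool) : (uel n e).norm = wlen n := by
  rw [norm_eq_length, toWord_uel, wd_length]

/-- Nontrivial elements of `sub I` as reduced products of generators, with the first factor. -/
inductive NormalForm (I : Set ℕ) : ℕ → Bool → FreeGroup (Bool × Bool) → Prop
  | single {n e} : n ∈ I → NormalForm I n e (uel n e)
  | cons {n e m e' x} : n ∈ I → NormalForm I m e' x → ¬ (m = n ∧ e' = !e) →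
      NormalForm I n e (uel n e * x)

lemma NormalForm.mem {I : Set ℕ} {n e x} (h : NormalForm I n e x) : x ∈ sub I := by
  induction h with
  | single h => exact uel_mem h _
  | cons h _ _ ih => exact mul_mem (uel_mem h _) ih

lemma NormalForm.index_mem {I : Set ℕ} {n e x} (h : NormalForm I n e x) : n ∈ I := by
  cases h <;> assumption

lemma NormalForm.mul {I : Set ℕ} {n m e e' x} (hn : n ∈ I) (h : NormalForm I m e' x) :
    uel n e * x = 1 ∨ ∃ k d, NormalForm I k d (uel n e * x) := by
  by_cases hc : m = n ∧ e' = !e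
  · obtain ⟨rfl, rfl⟩ := hc
    have h1 : uel m e * uel m (!e) = 1 := by rw [← uel_inv, mul_inv_cancel]
    cases h with
    | single => exact Or.inl h1
    | cons h2 h3 =>
      rw [← mul_assoc, h1, one_mul]
      exact Or.inr ⟨_, _, h3⟩
  · exact Or.inr ⟨_, _, .cons hn h hc⟩

lemma exists_normalForm {I : Set ℕ} {x} (hx : x ∈ sub I) :
    x = 1 ∨ ∃ n e, NormalForm I n e x := by
  have step : ∀ n ∈ I, ∀ e y, (y = 1 ∨ ∃ n e, NormalForm I n e y) →
      (uel n e * y = 1 ∨ ∃ k d, NormalForm I k d (uel n e * y)) := by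
    rintro n hn e y (rfl | ⟨m, e', h⟩)
    · rw [mul_one]; exact Or.inr ⟨_, _, .single hn⟩
    · exact h.mul hn
  induction hx using Subgroup.closure_induction_left with
  | one => exact Or.inl rfl
  | mul_left x hx y hy ih =>
    obtain ⟨n, hn, rfl⟩ := hx
    exact step n hn _ _ ih
  | inv_mul_cancel x hx y hy ih =>
    obtain ⟨n, hn, rfl⟩ := hx
    rw [uel_inv]
    exact step n hn _ _ ih

/-- The word `l` reads a long part of the word `(n, e)`, between positions `a` and `a + d`,
from position `t` on; the vertex of `sub I` at which that word starts is `v`. -/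
structure Segment (I : Set ℕ) (l : List ((Bool × Bool) × Bool)) (v : FreeGroup (Bool × Bool))
    (n : ℕ) (e : Bool) (a d t : ℕ) : Prop where
  mem : v ∈ sub I
  index_mem : n ∈ I
  le_length : t + d ≤ l.length
  start_le : a ≤ t
  start_lt : a < 3 * scale n
  end_le : a + d ≤ wlen n
  lt_end : wlen n < a + d + 3 * scale n
  read : ∀ s < d, l[t + s]? = some (ltr n e (a + s))
  vertex : FreeGroup.mk (l.take t) = v * FreeGroup.mk ((wd n e).take a)

lemma Segment.long {I l v n e a d t} (h : Segment I l v n e a d t) : 58 * scale n ≤ d := by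
  have := h.start_lt
  have := h.lt_end
  have := wlen_add n
  omega

lemma Segment.read_take {I l v n e a d t} (h : Segment I l v n e a d t) {s : ℕ} (hs : s ≤ d) :
    FreeGroup.mk (l.take (t + s)) = v * FreeGroup.mk ((wd n e).take (a + s)) := by
  rw [mk_take_add, mk_take_add, h.vertex, mul_assoc]
  congr 3
  apply List.ext_getElem?
  intro i
  rw [List.getElem?_take, List.getElem?_take]
  split_ifs with hi
  · rw [List.getElem?_drop, List.getElem?_drop, h.read i (by omega),
      wd_getElem? (by have := h.end_le; omega)]
  · rfl

lemma NormalForm.spec {I : Set ℕ} {n e x} (h : NormalForm I n e x) :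
    (∀ i, i + 1 < 61 * scale n → x.toWord[i]? = some (ltr n e i)) ∧
    ∀ t < x.norm, ∃ v n' e' a d τ, Segment I x.toWord v n' e' a d τ ∧ τ ≤ t ∧ t < τ + d ∧
      ((τ = 0 ∧ a = 0 ∧ n' = n ∧ e' = e) ∨ 58 * scale n ≤ τ) := by
  induction h with
  | @single n e hn =>
    have hq := scale_ge n
    have hw := wlen_add n
    constructor
    · intro i hi
      rw [toWord_uel, wd_getElem? (by omega)]
    · intro t ht
      rw [norm_uel] at ht
      refine ⟨1, n, e, 0, wlen n, 0, ⟨one_mem _, hn, by simp [toWord_uel], le_rfl, by omega,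
        by omega, by omega, fun s hs => ?_, by simp⟩, by omega, by omega,
        Or.inl ⟨rfl, rfl, rfl, rfl⟩⟩
      rw [toWord_uel, wd_getElem? (by omega)]
  | @cons n e m e' x hn hx hne ih =>
    obtain ⟨ih1, ih2⟩ := ih
    have hq := scale_ge n
    have hw := wlen_add n
    have hq' := scale_ge m
    have hw' := wlen_add m
    obtain ⟨k, hk1, hk2, hk, hmul⟩ := toWord_inv_mul (uel n (!e)) x
    rw [uel_inv, Bool.not_not, invRev_drop, toWord_uel, invRev_wd, Bool.not_not, wd_length] at hmul
    rw [norm_uel] at hk1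
    rw [toWord_uel] at hk
    have hlet : ∀ t < k, x.toWord[t]? = some (ltr n (!e) t) := by
      intro t ht
      have := congrArg (fun l => l[t]?) hk
      simp only [List.getElem?_take, ht, if_true] at this
      rw [← this, wd_getElem? (by omega)]
    have hk3 : k < 3 * scale n ∧ k < 3 * scale m := by
      by_contra hc
      have hmin : 3 * min (scale n) (scale m) ≤ k := by omega
      have heq : ∀ t < 3 * min (scale n) (scale m), ltr n (!e) t = ltr m e' t := by
        intro t ht
        have h1 := hlet t (by omega)
        rw [ih1 t (by omega)] at h1
        exact (Option.some.inj h1).symm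
      rcases le_total (scale n) (scale m) with hle | hle
      · rw [min_eq_left hle] at heq
        have := window_unique (n := n) (m := m) (i := 0) (i' := 0) (by omega) (by omega)
          (by simpa using heq)
        exact hne ⟨this.1.symm, this.2.1.symm⟩
      · rw [min_eq_right hle] at heq
        have := window_unique (n := m) (m := n) (i := 0) (i' := 0) (by omega) (by omega)
          (by simpa using fun t ht => (heq t ht).symm)
        exact hne ⟨this.1, this.2.1⟩
    set A := wlen n - k with hA
    have hlenA : ((wd n e).take A).length = A := by simp; omega
    have get1 : ∀ i < A, (uel n e * x).toWord[i]? = some (ltr n e i) := by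
      intro i hi
      rw [hmul, List.getElem?_append_left (by omega), List.getElem?_take, if_pos hi,
        wd_getElem? (by omega)]
    have get2 : ∀ i, (uel n e * x).toWord[A + i]? = x.toWord[k + i]? := by
      intro i
      rw [hmul, List.getElem?_append_right (by omega), hlenA, List.getElem?_drop]
      congr 1; omega
    have hlen : (uel n e * x).toWord.length = A + (x.norm - k) := by
      rw [hmul, List.length_append, hlenA, List.length_drop]; rfl
    have hvert : ∀ i, FreeGroup.mk ((uel n e * x).toWord.take (A + i)) =
        uel n e * FreeGroup.mk (x.toWord.take (k + i)) := by
      intro i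
      have h1 : FreeGroup.mk ((wd n e).take A) = uel n e * FreeGroup.mk (x.toWord.take k) := by
        rw [← hk, ← inv_inv (uel n e), uel_inv, eq_inv_mul_iff_mul_eq, uel]
        have h2 : (wd n e).take A = invRev ((wd n (!e)).drop k) := by
          rw [invRev_drop, invRev_wd, Bool.not_not, wd_length]
        conv_lhs => rw [← List.take_append_drop k (wd n (!e)), mk_append, h2, ← inv_mk]
        group
      rw [hmul, List.take_append, hlenA, List.take_of_length_le (by omega), mk_append, h1,
        mk_take_add, mul_assoc]
      congr 4
      omega
    refine ⟨fun i hi => get1 i (by omega), ?_⟩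
    intro t ht
    rw [norm_eq_length, hlen] at ht
    by_cases htA : t < A
    · refine ⟨1, n, e, 0, A, 0, ⟨one_mem _, hn, by omega, le_rfl, by omega, by omega, by omega,
        fun s hs => ?_, by simp⟩, by omega, by omega, Or.inl ⟨rfl, rfl, rfl, rfl⟩⟩
      simpa using get1 s hs
    · obtain ⟨v, n', e'', a, d, τ, hs, h1, h2, h3⟩ := ih2 (t - A + k) (by omega)
      rcases h3 with ⟨rfl, rfl, rfl, rfl⟩ | h3
      · have := hs.le_length
        rw [← norm_eq_length] at this
        refine ⟨uel n e * v, n', e'', k, d - k, A, ⟨mul_mem (uel_mem hn _) hs.mem, hs.index_mem,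
          by omega, by omega, by omega, by have := hs.end_le; omega,
          by have := hs.lt_end; omega, fun s hs' => ?_, ?_⟩, by omega, by omega,
          Or.inr (by omega)⟩
        · rw [get2]
          have := hs.read (k + s) (by omega)
          simpa using this
        · have h5 := hvert 0
          have h6 := hs.read_take (s := k) (by omega)
          simp only [add_zero, zero_add] at h5 h6
          rw [h5, h6, mul_assoc]
      · have h58 := hs.le_length
        rw [← norm_eq_length] at h58
        obtain ⟨r, rfl⟩ := Nat.exists_eq_add_of_le (show k ≤ τ by omega)
        refine ⟨uel n e * v, n', e'', a, d, A + r, ⟨mul_mem (uel_mem hn _) hs.mem, hs.index_mem,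
          by omega, by have := hs.start_le; omega, hs.start_lt, hs.end_le, hs.lt_end,
          fun s hs' => ?_, ?_⟩, by omega, by omega, Or.inr (by omega)⟩
        · rw [add_assoc, get2, ← add_assoc, hs.read s hs']
        · rw [hvert, hs.vertex, mul_assoc]

/-- Every position of a reduced word representing an element of `sub I` lies in a segment. -/
lemma exists_segment {I : Set ℕ} {x} (hx : x ∈ sub I) {t : ℕ} (ht : t < x.norm) :
    ∃ v n e a d τ, Segment I x.toWord v n e a d τ ∧ τ ≤ t ∧ t < τ + d := by
  rcases exists_normalForm hx with rfl | ⟨n, e, h⟩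
  · simp at ht
  · obtain ⟨v, n', e', a, d, τ, h1, h2, h3, -⟩ := h.spec.2 t ht
    exact ⟨v, n', e', a, d, τ, h1, h2, h3⟩

end GSC

namespace GSC
open FreeGroup

lemma mem_sub_of_norm_le {J : Set ℕ} {M : ℕ} {c} (hc : c ∈ sub J) (hM : c.norm ≤ M) :
    c ∈ sub {n ∈ J | 58 * scale n ≤ M} := by
  induction hk : c.norm using Nat.strong_induction_on generalizing c with
  | _ k ih =>
    subst hk
    by_cases h0 : c.norm = 0
    · rw [FreeGroup.norm_eq_zero] at h0; rw [h0]; exact one_mem _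
    obtain ⟨v, n, e, a, d, τ, hs, h1, -⟩ := exists_segment hc (t := 0) (by omega)
    obtain rfl : τ = 0 := by omega
    obtain rfl : a = 0 := by have := hs.start_le; omega
    have hv : v = 1 := by simpa using hs.vertex.symm
    subst hv
    have hq := scale_ge n
    have hw := wlen_add n
    have hlong := hs.long
    have hlt := hs.lt_end
    have hle := hs.le_length
    rw [← norm_eq_length] at hle
    have hn : n ∈ {n ∈ J | 58 * scale n ≤ M} := ⟨hs.index_mem, by omega⟩
    have hrd := hs.read_take le_rfl
    simp only [zero_add, one_mul] at hrd
    set x := (uel n e)⁻¹ * c with hx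
    have hx' : x = (FreeGroup.mk ((wd n e).drop d))⁻¹ * FreeGroup.mk (c.toWord.drop d) := by
      have e1 : c = FreeGroup.mk (c.toWord.take d) * FreeGroup.mk (c.toWord.drop d) := by
        rw [← mk_append, List.take_append_drop, mk_toWord]
      have e2 : uel n e = FreeGroup.mk ((wd n e).take d) * FreeGroup.mk ((wd n e).drop d) := by
        rw [← mk_append, List.take_append_drop, uel]
      rw [hrd] at e1
      generalize FreeGroup.mk ((wd n e).take d) = y1 at *
      generalize FreeGroup.mk ((wd n e).drop d) = y2 at *
      generalize FreeGroup.mk (c.toWord.drop d) = y3 at *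
      rw [hx, e2]
      nth_rewrite 1 [e1]
      group
    have hnorm : x.norm < c.norm := by
      have h2 := norm_mul_le (FreeGroup.mk ((wd n e).drop d))⁻¹ (FreeGroup.mk (c.toWord.drop d))
      rw [← hx', norm_inv_eq] at h2
      have h3 : (FreeGroup.mk ((wd n e).drop d)).norm ≤ wlen n - d :=
        norm_mk_le.trans (by simp)
      have h4 : (FreeGroup.mk (c.toWord.drop d)).norm ≤ c.norm - d :=
        norm_mk_le.trans (by simp [norm_eq_length])
      omega
    have h5 := ih _ hnorm (c := x) (mul_mem (inv_mem (uel_mem hs.index_mem e)) hc) (by omega) rfl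
    have h6 : c = uel n e * x := by rw [hx]; group
    rw [h6]
    exact mul_mem (uel_mem hn e) h5

lemma uel_notMem {I : Set ℕ} {n : ℕ} (hn : n ∉ I) : uel n true ∉ sub I := by
  intro h
  have hw := wlen_add n
  have hq := scale_ge n
  obtain ⟨v, m, e, a, d, τ, hs, h1, -⟩ := exists_segment h (t := 0) (by rw [norm_uel]; omega)
  obtain rfl : τ = 0 := by omega
  obtain rfl : a = 0 := by have := hs.start_le; omega
  have hlong := hs.long
  have hle := hs.le_length
  have hread := hs.read
  rw [toWord_uel, wd_length] at hle
  rw [toWord_uel] at hread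
  have := hs.end_le
  have := window_unique (n := m) (m := n) (i := 0) (i' := 0) (e := e) (e' := true) (by omega)
    (by omega) (fun t ht => by
      have := hread t (by omega)
      rw [zero_add, wd_getElem? (by omega)] at this
      simpa using this.symm)
  exact hn (this.1 ▸ hs.index_mem)

/-- The words of `c` and `c'` read the same letters along a path of length `L`. -/
structure Fellow (I : Set ℕ) (c c' h : FreeGroup (Bool × Bool)) (p p' L : ℕ) : Prop where
  mem : c ∈ sub I
  mem' : c' ∈ sub I
  notMem : h ∉ sub I
  le : p + L ≤ c.norm
  le' : p' + L ≤ c'.norm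
  read : ∀ t < L, c.toWord[p + t]? = c'.toWord[p' + t]?
  vertex : FreeGroup.mk (c.toWord.take p) = h * FreeGroup.mk (c'.toWord.take p')

namespace Fellow

variable {I : Set ℕ} {c c' h : FreeGroup (Bool × Bool)} {p p' L : ℕ}

lemma symm (F : Fellow I c c' h p p' L) : Fellow I c' c h⁻¹ p' p L :=
  ⟨F.mem', F.mem, fun hc => F.notMem (by simpa using hc), F.le', F.le,
    fun t ht => (F.read t ht).symm, by rw [F.vertex]; group⟩

lemma read_take (F : Fellow I c c' h p p' L) {t : ℕ} (ht : t ≤ L) :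
    FreeGroup.mk (c.toWord.take (p + t)) = h * FreeGroup.mk (c'.toWord.take (p' + t)) := by
  rw [mk_take_add, mk_take_add, F.vertex, mul_assoc]
  congr 3
  apply List.ext_getElem?
  intro i
  rw [List.getElem?_take, List.getElem?_take]
  split_ifs with hi
  · rw [List.getElem?_drop, List.getElem?_drop, F.read i (by omega)]
  · rfl

variable {v v' : FreeGroup (Bool × Bool)} {n n' : ℕ} {e e' : Bool} {a a' d d' τ τ' : ℕ}

lemma same_start (F : Fellow I c c' h p p' L) (S : Segment I c.toWord v n e a d τ)
    (S' : Segment I c'.toWord v' n' e' a' d' τ') {r r' s : ℕ} (hs : s ≤ L) (hr : τ + r = p + s)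
    (hr' : τ' + r' = p' + s) (hrd : r ≤ d) (hrd' : r' ≤ d')
    (heq : (wd n e).take (a + r) = (wd n' e').take (a' + r')) : False := by
  have h1 := F.read_take hs
  rw [← hr, ← hr', S.read_take hrd, S'.read_take hrd', heq, ← mul_assoc] at h1
  have h2 : v * v'⁻¹ = h := by rw [mul_right_cancel h1]; group
  exact F.notMem (h2 ▸ mul_mem S.mem (inv_mem S'.mem))

lemma letters (F : Fellow I c c' h p p' L) (S : Segment I c.toWord v n e a d τ)
    (S' : Segment I c'.toWord v' n' e' a' d' τ') {r r' s W : ℕ} (hs : s + W ≤ L)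
    (hr : τ + r = p + s) (hr' : τ' + r' = p' + s) (hrd : r + W ≤ d) (hrd' : r' + W ≤ d') :
    ∀ t < W, ltr n e (a + r + t) = ltr n' e' (a' + r' + t) := by
  intro t ht
  have h1 := S.read (r + t) (by omega)
  have h2 := S'.read (r' + t) (by omega)
  rw [← add_assoc, hr, add_assoc, F.read _ (by omega), ← add_assoc, ← hr', add_assoc, h2] at h1
  rw [add_assoc, add_assoc]
  exact (Option.some.inj h1).symm

lemma no_overlap (F : Fellow I c c' h p p' L) (S : Segment I c.toWord v n e a d τ)
    (S' : Segment I c'.toWord v' n' e' a' d' τ') {r r' s W : ℕ} (hs : s + W ≤ L)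
    (hr : τ + r = p + s) (hr' : τ' + r' = p' + s) (hrd : r + W ≤ d) (hrd' : r' + W ≤ d')
    (hW : 3 * scale n ≤ W ∨ 3 * scale n' ≤ W) : False := by
  have hl := F.letters S S' hs hr hr' hrd hrd'
  have h1 := S.end_le
  have h2 := S'.end_le
  have key : n = n' ∧ e = e' ∧ a + r = a' + r' := by
    rcases hW with hW | hW
    · exact window_unique (by omega) (by omega) (fun t ht => hl t (by omega))
    · have := window_unique (n := n') (m := n) (e := e') (e' := e) (i := a' + r') (i' := a + r)
        (by omega) (by omega) (fun t ht => (hl t (by omega)).symm)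
      exact ⟨this.1.symm, this.2.1.symm, this.2.2.symm⟩
  obtain ⟨rfl, rfl, h3⟩ := key
  exact F.same_start S S' (by omega) hr hr' (by omega) (by omega) (by rw [h3])

lemma no_full_segment (F : Fellow I c c' h p p' L) (S : Segment I c.toWord v n e a d τ)
    (h1 : p ≤ τ) (h2 : τ + d ≤ p + L) : False := by
  have hd := S.long
  have hq := scale_ge n
  obtain ⟨x, rfl⟩ := Nat.exists_eq_add_of_le h1
  have hle := F.le'
  obtain ⟨v', n', e', a', d', τ', S', h3, h4⟩ :=
    exists_segment F.mem' (t := p' + x + d / 2) (by omega)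
  have hd' := S'.long
  by_cases h5 : τ' ≤ p' + x
  · exact F.no_overlap S S' (s := x) (W := d / 2) (r := 0) (r' := p' + x - τ') (by omega)
      (by omega) (by omega) (by omega) (by omega) (by omega)
  by_cases h6 : p' + x + d ≤ τ' + d'
  · exact F.no_overlap S S' (s := x + d / 2) (W := d - d / 2) (r := d / 2)
      (r' := p' + x + d / 2 - τ') (by omega) (by omega) (by omega) (by omega) (by omega) (by omega)
  · exact F.no_overlap S S' (s := τ' - p') (W := d') (r := τ' - p' - x)
      (r' := 0) (by omega) (by omega) (by omega) (by omega) (by omega) (by omega)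

lemma exists_cover (F : Fellow I c c' h p p' L) {t : ℕ} (ht : t < L) :
    ∃ v n e a d τ, Segment I c.toWord v n e a d τ ∧ τ ≤ p + t ∧ p + t < τ + d ∧
      (τ ≤ p ∨ p + L ≤ τ + d) := by
  have hle := F.le
  obtain ⟨v, n, e, a, d, τ, S, h1, h2⟩ := exists_segment F.mem (t := p + t) (by omega)
  refine ⟨v, n, e, a, d, τ, S, h1, h2, ?_⟩
  by_contra hc
  exact F.no_full_segment S (by omega) (by omega)

lemma no_window (F : Fellow I c c' h p p' L) (S : Segment I c.toWord v n e a d τ)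
    (S' : Segment I c'.toWord v' n' e' a' d' τ') {H s W : ℕ} (hp : p ≤ H) (hp' : p' ≤ H)
    (hs : s + W ≤ L) (h1 : τ ≤ p + s) (h1' : τ' ≤ p' + s) (h2 : p + s + W ≤ τ + d)
    (h2' : p' + s + W ≤ τ' + d') (hW : 6 * (H + s + 1) ≤ W) : False := by
  obtain ⟨r, hr⟩ := Nat.exists_eq_add_of_le h1
  obtain ⟨r', hr'⟩ := Nat.exists_eq_add_of_le h1'
  have hl := F.letters S S' hs hr.symm hr'.symm (by omega) (by omega)
  have hpar : ∀ t < W, par (a + r + t + 1) = par (a' + r' + t + 1) := fun t ht =>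
    congrArg (fun l => l.1.1) (hl t ht)
  have hx : a + r ≤ H + s := by have := S.start_le; omega
  have hx' : a' + r' ≤ H + s := by have := S'.start_le; omega
  have hxx : a + r = a' + r' := by
    rcases lt_trichotomy (a + r) (a' + r') with hlt | heq | hlt
    · exfalso
      apply par_not_periodic (p := a + r + 1) (l := a' + r' - (a + r)) (by omega) (by omega)
      intro t ht
      rw [show a + r + 1 + t = a + r + t + 1 by omega, hpar t (by omega)]
      congr 1; omega
    · exact heq
    · exfalso
      apply par_not_periodic (p := a' + r' + 1) (l := a + r - (a' + r')) (by omega) (by omega)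
      intro t ht
      rw [show a' + r' + 1 + t = a' + r' + t + 1 by omega, ← hpar t (by omega)]
      congr 1; omega
  have he : e = e' := congrArg Prod.snd (hl 0 (by omega))
  subst he
  by_cases hW' : 3 * scale n ≤ W ∨ 3 * scale n' ≤ W
  · exact F.no_overlap S S' hs hr.symm hr'.symm (by omega) (by omega) hW'
  · refine F.same_start S S' (by omega) hr.symm hr'.symm (by omega) (by omega) ?_
    have e1 := S.end_le
    have e2 := S'.end_le
    push Not at hW'
    rw [← hxx]
    apply List.ext_getElem?
    intro i
    rw [List.getElem?_take, List.getElem?_take]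
    split_ifs with hi
    · rw [wd_getElem? (by omega), wd_getElem? (by omega),
        ltr_small (n := n) (m := n') (by omega) (by omega)]
    · rfl

lemma length_lt (F : Fellow I c c' h p p' L) {H : ℕ} (hp : p ≤ H) (hp' : p' ≤ H) :
    L < 1000 * (H + 1) := by
  by_contra hL
  have F' := F.symm
  obtain ⟨v, n, e, a, d, τ, S, h1, h2, h3⟩ := F.exists_cover (t := 70 * (H + 1)) (by omega)
  obtain ⟨v', n', e', a', d', τ', S', h1', h2', h3'⟩ :=
    F'.exists_cover (t := 70 * (H + 1)) (by omega)
  obtain ⟨w, m, f, b, l, σ, T, g1, g2, g3⟩ := F.exists_cover (t := 7 * (H + 1)) (by omega)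
  obtain ⟨w', m', f', b', l', σ', T', g1', g2', g3'⟩ :=
    F'.exists_cover (t := 7 * (H + 1)) (by omega)
  rcases h3 with h3 | h3 <;> rcases h3' with h3' | h3'
  · exact F.no_window S S' (s := 0) (W := 70 * (H + 1)) hp hp' (by omega) (by omega) (by omega)
      (by omega) (by omega) (by omega)
  · rcases g3' with g3' | g3'
    · exact F.no_window S T' (s := 0) (W := 7 * (H + 1)) hp hp' (by omega) (by omega) (by omega)
        (by omega) (by omega) (by omega)
    · exact F.no_window S T' (s := 7 * (H + 1)) (W := 63 * (H + 1)) hp hp' (by omega) (by omega)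
        (by omega) (by omega) (by omega) (by omega)
  · rcases g3 with g3 | g3
    · exact F.no_window T S' (s := 0) (W := 7 * (H + 1)) hp hp' (by omega) (by omega) (by omega)
        (by omega) (by omega) (by omega)
    · exact F.no_window T S' (s := 7 * (H + 1)) (W := 63 * (H + 1)) hp hp' (by omega) (by omega)
        (by omega) (by omega) (by omega) (by omega)
  · exact F.no_window S S' (s := 70 * (H + 1)) (W := 930 * (H + 1)) hp hp' (by omega) (by omega)
      (by omega) (by omega) (by omega) (by omega)

end Fellow

/-- Distinct cosets of `sub I` have bounded overlap. -/
lemma norm_add_norm_le {I : Set ℕ} {h} (hh : h ∉ sub I) : ∃ K, ∀ c ∈ sub I, ∀ c' ∈ sub I,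
    c.norm + (h * c').norm ≤ (c⁻¹ * (h * c')).norm + K := by
  refine ⟨2 * (1001 * (h.norm + 1)), fun c hc c' hc' => ?_⟩
  obtain ⟨k, hk1, hk2, hk, hmul⟩ := toWord_inv_mul c (h * c')
  have hnorm : (c⁻¹ * (h * c')).norm = (c.norm - k) + ((h * c').norm - k) := by
    rw [norm_eq_length, hmul]
    simp [norm_eq_length]
  rw [hnorm]
  suffices k ≤ 1001 * (h.norm + 1) by omega
  by_contra hlt
  obtain ⟨b, hb1, hb2, hb, hmul'⟩ := toWord_inv_mul h⁻¹ c'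
  rw [inv_inv] at hmul'
  rw [norm_inv_eq] at hb1
  set A := h.norm - b with hA
  have hlenA : (invRev (h⁻¹.toWord.drop b)).length = A := by
    simp [← norm_eq_length, hA]
  have hlen : (h * c').norm = A + (c'.norm - b) := by
    rw [norm_eq_length, hmul', List.length_append, hlenA, List.length_drop, norm_eq_length]
  have htake : FreeGroup.mk ((h * c').toWord.take A) = h * FreeGroup.mk (c'.toWord.take b) := by
    rw [hmul', List.take_append, hlenA, List.take_of_length_le hlenA.le, Nat.sub_self,
      List.take_zero, List.append_nil, ← hb, ← inv_mk]
    have e1 : h⁻¹ = FreeGroup.mk (h⁻¹.toWord.take b) * FreeGroup.mk (h⁻¹.toWord.drop b) := by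
      rw [← mk_append, List.take_append_drop, mk_toWord]
    generalize FreeGroup.mk (h⁻¹.toWord.take b) = y1 at *
    generalize FreeGroup.mk (h⁻¹.toWord.drop b) = y2 at *
    rw [← inv_inv h, e1]
    group
  have F : Fellow I c c' h A b (k - A) := by
    refine ⟨hc, hc', hh, by omega, by omega, fun t ht => ?_, ?_⟩
    · have h1 := congrArg (fun l => l[A + t]?) hk
      simp only [List.getElem?_take, show A + t < k by omega, if_true] at h1
      rw [h1, hmul', List.getElem?_append_right (by omega), hlenA, List.getElem?_drop]
      congr 1; omega
    · rw [← htake]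
      have h1 := congrArg (fun l => l.take A) hk
      simp only [List.take_take] at h1
      rw [min_eq_left (by omega)] at h1
      rw [h1]
  have := F.length_lt (H := h.norm) (by omega) (by omega)
  omega

end GSC

namespace GSC
open FreeGroup

lemma finite_norm_le {α : Type} [DecidableEq α] [Finite α] (n : ℕ) :
    {x : FreeGroup α | x.norm ≤ n}.Finite := by
  refine Set.Finite.of_finite_image (f := FreeGroup.toWord) ?_ toWord_injective.injOn
  exact (List.finite_length_le (α × Bool) n).subset (by rintro _ ⟨x, hx, rfl⟩; exact hx)

lemma exists_pow_norm_gt {α : Type} [DecidableEq α] [Finite α] {z : FreeGroup α} (hz : z ≠ 1)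
    (n : ℕ) : ∃ m : ℕ, n < (z ^ m).norm := by
  by_contra hc
  push Not at hc
  exact Set.infinite_range_of_injective
    (injective_pow_iff_not_isOfFinOrder.2 (not_isOfFinOrder_of_isMulTorsionFree hz))
    ((finite_norm_le n).subset (by rintro _ ⟨m, rfl⟩; exact hc m))

/-- `sub I` is malnormal. -/
lemma sub_malnormal {I : Set ℕ} {e z} (he : e ∉ sub I) (hz : z ∈ sub I)
    (h : e * z * e⁻¹ ∈ sub I) : z = 1 := by
  by_contra h1
  obtain ⟨K, hK⟩ := norm_add_norm_le he
  obtain ⟨m, hm⟩ := exists_pow_norm_gt (z := e * z * e⁻¹) (by simpa using h1) (e.norm + K)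
  have h2 := hK _ (pow_mem h m) _ (pow_mem hz m)
  rw [conj_pow, show (e * z ^ m * e⁻¹)⁻¹ * (e * z ^ m) = e by group] at h2
  rw [conj_pow] at hm
  omega

section Ray

variable {α : Type} [DecidableEq α]

/-- Elements whose word starts with the same letter as that of `g`. -/
def ray (g : FreeGroup α) : Set (FreeGroup α) := {x | x.toWord.head? = g.toWord.head?}

variable {g x : FreeGroup α}

lemma toWord_ne_nil (h1 : g ≠ 1) : g.toWord ≠ [] := by simpa using h1

lemma norm_pos (h1 : g ≠ 1) : 0 < g.norm := by
  rw [Nat.pos_iff_ne_zero]; simpa using h1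

lemma toWord_mul_of_mem_ray (hg : IsCyclicallyReduced g.toWord) (hx : x ∈ ray g) :
    (g * x).toWord = g.toWord ++ x.toWord := by
  rw [toWord_mul, IsReduced.reduce_eq]
  refine List.isChain_append.2 ⟨isReduced_toWord, isReduced_toWord, fun a ha b hb => ?_⟩
  rw [show x.toWord.head? = g.toWord.head? from hx] at hb
  exact hg.2 a ha b hb

lemma pow_mul_spec (hg : IsCyclicallyReduced g.toWord) (h1 : g ≠ 1) (hx : x ∈ ray g) (n : ℕ) :
    (g ^ n * x).toWord = (List.replicate n g.toWord).flatten ++ x.toWord ∧ g ^ n * x ∈ ray g := by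
  induction n with
  | zero => simpa using hx
  | succ n ih =>
    have h2 := toWord_mul_of_mem_ray hg ih.2
    rw [pow_succ', mul_assoc]
    refine ⟨by rw [h2, ih.1, List.replicate_succ, List.flatten_cons, List.append_assoc], ?_⟩
    change List.head? _ = _
    rw [h2, List.head?_append_of_ne_nil _ (toWord_ne_nil h1)]

lemma pow_mul_mem_ray (hg : IsCyclicallyReduced g.toWord) (h1 : g ≠ 1) (hx : x ∈ ray g) (n : ℕ) :
    g ^ n * x ∈ ray g := (pow_mul_spec hg h1 hx n).2

lemma mem_ray_self : g ∈ ray g := rfl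

lemma norm_pow_mul (hg : IsCyclicallyReduced g.toWord) (h1 : g ≠ 1) (hx : x ∈ ray g) (n : ℕ) :
    (g ^ n * x).norm = n * g.norm + x.norm := by
  rw [norm_eq_length, (pow_mul_spec hg h1 hx n).1]
  simp [norm_eq_length]

lemma norm_inv_mul_of_ray {y} (hx : x ∉ ray g) (hy : y ∈ ray g) :
    (x⁻¹ * y).toWord = invRev x.toWord ++ y.toWord := by
  obtain ⟨k, hk1, hk2, hk, h⟩ := toWord_inv_mul x y
  rcases Nat.eq_zero_or_pos k with rfl | hk0
  · simpa using h
  · exfalso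
    apply hx
    have h2 := congrArg List.head? hk
    rw [List.head?_take, List.head?_take, if_neg hk0.ne', if_neg hk0.ne'] at h2
    exact h2.trans hy

lemma norm_add_norm_of_ray {y} (hx : x ∉ ray g) (hy : y ∈ ray g) :
    x.norm + y.norm = (x⁻¹ * y).norm := by
  rw [norm_eq_length (x := x⁻¹ * y), norm_inv_mul_of_ray hx hy]
  simp [norm_eq_length]

lemma exists_pow_mul_mem_ray (hg : IsCyclicallyReduced g.toWord) (h1 : g ≠ 1) (x : FreeGroup α) :
    ∃ n : ℕ, g ^ n * x ∈ ray g := by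
  by_contra hc
  push Not at hc
  have h2 : ∀ n : ℕ, g ^ (n + 1) ∈ ray g := fun n => by
    rw [pow_succ]; exact pow_mul_mem_ray hg h1 mem_ray_self n
  have h3 := norm_add_norm_of_ray (hc (x.norm + 1)) (h2 x.norm)
  have h4 := norm_pow_mul hg h1 mem_ray_self x.norm
  rw [← pow_succ] at h4
  have h5 : (g ^ (x.norm + 1) * x)⁻¹ * g ^ (x.norm + 1) = x⁻¹ := by group
  rw [h5, norm_inv_eq] at h3
  have h8 := norm_pos h1
  have h9 : x.norm ≤ x.norm * g.norm := Nat.le_mul_of_pos_right _ h8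
  omega

lemma exists_pow_inv_mul_notMem_ray (hg : IsCyclicallyReduced g.toWord) (h1 : g ≠ 1)
    (x : FreeGroup α) : ∃ n : ℕ, (g ^ n)⁻¹ * x ∉ ray g := by
  refine ⟨x.norm + 1, fun h => ?_⟩
  have h2 := norm_pow_mul hg h1 h (x.norm + 1)
  rw [mul_inv_cancel_left] at h2
  have := Nat.le_mul_of_pos_right (x.norm + 1) (norm_pos h1)
  omega

lemma flatten_replicate_periodic {β : Type*} (L M : List β) (n i : ℕ)
    (hi : i + L.length < n * L.length) :
    ((List.replicate n L).flatten ++ M)[i]? =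
      ((List.replicate n L).flatten ++ M)[i + L.length]? := by
  induction n generalizing i with
  | zero => omega
  | succ n ih =>
    rw [List.replicate_succ, List.flatten_cons, List.append_assoc,
      List.getElem?_append_right (l₁ := L) (i := i + L.length) (by omega), Nat.add_sub_cancel]
    rw [Nat.succ_mul] at hi
    by_cases h : i < L.length
    · rw [List.getElem?_append_left h]
      cases n with
      | zero => omega
      | succ n =>
        rw [List.replicate_succ, List.flatten_cons, List.append_assoc, List.getElem?_append_left h]
    · rw [List.getElem?_append_right (by omega), ih _ (by omega)]
      congr 1; omega

end Ray

lemma mk_take_flatten_replicate {α : Type} (L M : List (α × Bool)) {n a b : ℕ} (ha : a < n)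
    (hb : b ≤ L.length) :
    FreeGroup.mk (((List.replicate n L).flatten ++ M).take (a * L.length + b)) =
      FreeGroup.mk L ^ a * FreeGroup.mk (L.take b) := by
  induction a generalizing n with
  | zero =>
    obtain ⟨n, rfl⟩ := Nat.exists_eq_succ_of_ne_zero ha.ne'
    rw [List.replicate_succ, List.flatten_cons, List.append_assoc, zero_mul, zero_add, pow_zero,
      one_mul, List.take_append_of_le_length hb]
  | succ a ih =>
    obtain ⟨n, rfl⟩ := Nat.exists_eq_succ_of_ne_zero (show n ≠ 0 by omega)
    rw [List.replicate_succ, List.flatten_cons, List.append_assoc, pow_succ', mul_assoc,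
      ← ih (n := n) (by omega), List.take_append, List.take_of_length_le, mk_append]
    · congr 4
      rw [Nat.succ_mul]; omega
    · rw [Nat.succ_mul]; omega


/-- `V` is a half-space translated into itself by `g`, such that geodesics from outside `V` to
`g ^ N • V` pass close to the identity. -/
structure Axis {G : Type*} [Group G] (ν : G → ℕ) (g : G) (V : Set G) (N K : ℕ) : Prop where
  mul_mem : ∀ x ∈ V, g * x ∈ V
  absorb : ∀ x, ∃ n : ℕ, g ^ n * x ∈ V
  escape : ∀ x, ∃ n : ℕ, (g ^ n)⁻¹ * x ∉ V
  norm_add : ∀ x x', x ∉ V → (g ^ N)⁻¹ * x' ∈ V → ν x + ν x' ≤ ν (x⁻¹ * x') + K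

/-- An axis in the free group together with control on how it meets cosets of `sub I`. -/
structure FreeAxis (I : Set ℕ) (g : FreeGroup (Bool × Bool)) (V : Set (FreeGroup (Bool × Bool)))
    (N K : ℕ) (E : Prop) : Prop extends Axis FreeGroup.norm g V N K where
  mem_of_cond : E → g ∈ sub I
  cond : ∀ x x', x⁻¹ * x' ∈ sub I → x ∉ V → (g ^ N)⁻¹ * x' ∈ V → E ∧ x ∈ sub I

lemma pow_mul_mem_of_mul_mem {G : Type*} [Group G] {g : G} {V : Set G} (h : ∀ x ∈ V, g * x ∈ V)
    (n : ℕ) {x : G} (hx : x ∈ V) : g ^ n * x ∈ V := by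
  induction n with
  | zero => simpa
  | succ n ih => rw [pow_succ', mul_assoc]; exact h _ ih

lemma spread (I : Set ℕ) {g : FreeGroup (Bool × Bool)} (hg : IsCyclicallyReduced g.toWord)
    (h1 : g ≠ 1) : ∃ N : ℕ, ∀ x x', x⁻¹ * x' ∈ sub I → x ∉ ray g → (g ^ N)⁻¹ * x' ∈ ray g →
      ∃ (s k : ℕ) (d : FreeGroup (Bool × Bool)), 1 ≤ k ∧ x⁻¹ * g ^ s * d ∈ sub I ∧
        d⁻¹ * g ^ k * d ∈ sub I := by
  set ℓ := g.norm with hℓ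
  have hℓ0 : 0 < ℓ := norm_pos h1
  set B := finite_norm_le (α := Bool × Bool) (2 * ℓ)
  set M := B.toFinset.card + 1 with hM
  refine ⟨6 * M + 12, fun x x' hc hx hx' => ?_⟩
  set N := 6 * M + 12 with hN
  set y := (g ^ N)⁻¹ * x' with hy
  have hx'y : x' = g ^ N * y := by rw [hy]; group
  set c := x⁻¹ * x' with hcdef
  have hw : c.toWord = invRev x.toWord ++ ((List.replicate N g.toWord).flatten ++ y.toWord) := by
    rw [hcdef, hx'y, norm_inv_mul_of_ray hx (pow_mul_mem_ray hg h1 hx' N),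
      (pow_mul_spec hg h1 hx' N).1]
  set p := x.norm with hp
  have hplen : (invRev x.toWord).length = p := by simp [hp, norm_eq_length]
  have hglen : g.toWord.length = ℓ := rfl
  have hclen : p + N * ℓ ≤ c.norm := by
    rw [norm_eq_length, hw]; simp [hglen, hp, norm_eq_length]
  have hper : ∀ i, i + ℓ < N * ℓ → c.toWord[p + i]? = c.toWord[p + i + ℓ]? := by
    intro i hi
    have hj : ∀ j, c.toWord[p + j]? = ((List.replicate N g.toWord).flatten ++ y.toWord)[j]? := by
      intro j
      rw [hw, ← hplen, List.getElem?_append_right (by omega), Nat.add_sub_cancel_left]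
    rw [add_assoc, hj, hj]
    exact flatten_replicate_periodic _ _ _ _ hi
  have hshort : ∀ {v n e a d τ s}, Segment I c.toWord v n e a d τ → p ≤ s → τ ≤ s →
      s + 5 * ℓ ≤ τ + d → s + 5 * ℓ ≤ p + N * ℓ → False := by
    intro v n e a d τ s S h2 h3 h4 h5
    obtain ⟨r, rfl⟩ := Nat.exists_eq_add_of_le h3
    refine par_not_periodic (p := a + r + 1) (l := ℓ) (by omega) (by omega) fun t ht => ?_
    have h6 := S.read (r + t) (by omega)
    have h7 := S.read (r + t + ℓ) (by omega)
    have h8 := hper (τ + r + t - p) (by omega)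
    rw [show p + (τ + r + t - p) = τ + (r + t) by omega, h6,
      show τ + (r + t) + ℓ = τ + (r + t + ℓ) by omega, h7] at h8
    have h9 := congrArg (fun l => l.1.1) (Option.some.inj h8)
    change par (a + (r + t) + 1) = par (a + (r + t + ℓ) + 1) at h9
    rw [show a + r + 1 + t = a + (r + t) + 1 by omega, h9]
    congr 1; omega
  have hNl : N * ℓ = 6 * (M * ℓ) + 12 * ℓ := by rw [hN]; ring
  have hstep : ∀ k : Fin M, ∃ (a : ℕ) (δ : FreeGroup (Bool × Bool)),
      a ≤ 6 * (k + 1) ∧ 6 * (k : ℕ) + 1 ≤ a ∧ δ.norm ≤ 2 * ℓ ∧ x⁻¹ * g ^ a * δ ∈ sub I := by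
    intro k
    have hk : ((k : ℕ) + 1) * ℓ ≤ M * ℓ := Nat.mul_le_mul_right _ k.2
    rw [Nat.succ_mul] at hk
    obtain ⟨v, n, e, i, d, τ, S, h2, h3⟩ :=
      exists_segment hc (t := p + 6 * (k * ℓ + ℓ)) (by omega)
    have h4 : p ≤ τ := by
      by_contra h
      exact hshort (s := p) S le_rfl (by omega) (by omega) (by omega)
    have h5 : τ + d ≤ p + N * ℓ := by
      by_contra h
      exact hshort (s := p + 6 * (k * ℓ + ℓ)) S (by omega) (by omega) (by omega) (by omega)
    have h6 : d < 5 * ℓ := by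
      by_contra h
      exact hshort (s := τ) S h4 le_rfl (by omega) (by omega)
    have hlong := S.long
    have hi := S.start_lt
    obtain ⟨z, rfl⟩ := Nat.exists_eq_add_of_le h4
    have hdiv := Nat.div_add_mod z ℓ
    have hmod := Nat.mod_lt z hℓ0
    have hz1 : z / ℓ ≤ 6 * (k + 1) := by
      rw [← Nat.mul_div_cancel (6 * ((k : ℕ) + 1)) hℓ0]
      apply Nat.div_le_div_right
      rw [mul_assoc, add_one_mul]; omega
    have hz2 : 6 * (k : ℕ) + 1 ≤ z / ℓ := by
      rw [Nat.le_div_iff_mul_le hℓ0, add_one_mul, mul_assoc]; omega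
    refine ⟨z / ℓ, FreeGroup.mk (g.toWord.take (z % ℓ)) * (FreeGroup.mk ((wd n e).take i))⁻¹,
      hz1, hz2, ?_, ?_⟩
    · have h7 := norm_mul_le (FreeGroup.mk (g.toWord.take (z % ℓ)))
        (FreeGroup.mk ((wd n e).take i))⁻¹
      rw [norm_inv_eq] at h7
      have h8 := norm_mk_take_le g.toWord (z % ℓ)
      have h9 := norm_mk_take_le (wd n e) i
      omega
    · have h7 := S.vertex
      rw [mk_take_add, hw, ← hplen, List.take_left, List.drop_left, ← inv_mk, mk_toWord,
        ← hdiv, mul_comm ℓ, ← hglen, mk_take_flatten_replicate, mk_toWord, hglen] at h7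
      · rw [show x⁻¹ * g ^ (z / ℓ) * (FreeGroup.mk (g.toWord.take (z % ℓ)) *
            (FreeGroup.mk ((wd n e).take i))⁻¹) = x⁻¹ * (g ^ (z / ℓ) *
            FreeGroup.mk (g.toWord.take (z % ℓ))) * (FreeGroup.mk ((wd n e).take i))⁻¹ by group, h7,
          mul_inv_cancel_right]
        exact S.mem
      · rw [hglen]; omega
      · rw [hglen]; exact hmod.le
  choose a δ ha1 ha2 hδ hmem using hstep
  obtain ⟨k, k', hne, heq⟩ := Fintype.exists_ne_map_eq_of_card_lt
    (fun k : Fin M => (⟨δ k, B.mem_toFinset.2 (hδ k)⟩ : B.toFinset)) (by simp [hM])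
  have heq' : δ k = δ k' := congrArg Subtype.val heq
  wlog hlt : k < k' generalizing k k'
  · exact this k' k hne.symm heq.symm heq'.symm (lt_of_le_of_ne (not_lt.1 hlt) hne.symm)
  have hlt' : (k : ℕ) < k' := hlt
  have h2 := ha1 k
  have h3 := ha2 k'
  refine ⟨a k, a k' - a k, δ k, by omega, hmem k, ?_⟩
  have h4 := mul_mem (inv_mem (hmem k)) (hmem k')
  rw [← heq', ← Nat.sub_add_cancel (show a k ≤ a k' by omega), pow_add] at h4
  convert h4 using 1
  rw [← pow_add, add_comm, pow_add]
  group

lemma exists_conj_isCyclicallyReduced {α : Type} [DecidableEq α] (g : FreeGroup α) :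
    ∃ p r : FreeGroup α, IsCyclicallyReduced r.toWord ∧ r = p * g * p⁻¹ := by
  have h := reduceCyclically.isCyclicallyReduced (isReduced_toWord (x := g))
  refine ⟨(FreeGroup.mk (reduceCyclically.conjugator g.toWord))⁻¹,
    FreeGroup.mk (reduceCyclically g.toWord), ?_, ?_⟩
  · rwa [toWord_mk_of_isReduced h.isReduced]
  · have h2 := congrArg FreeGroup.mk (reduceCyclically.conj_conjugator_reduceCyclically g.toWord)
    rw [mk_append, mk_append, ← inv_mk, mk_toWord] at h2
    rw [inv_inv, mul_assoc, eq_inv_mul_iff_mul_eq, ← mul_inv_eq_iff_eq_mul]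
    exact h2

lemma axis_ray {α : Type} [DecidableEq α] {g : FreeGroup α} (hg : IsCyclicallyReduced g.toWord)
    (h1 : g ≠ 1) (N : ℕ) : Axis FreeGroup.norm g (ray g) N 0 where
  mul_mem x hx := by simpa using pow_mul_mem_ray hg h1 hx 1
  absorb := exists_pow_mul_mem_ray hg h1
  escape := exists_pow_inv_mul_notMem_ray hg h1
  norm_add x x' hx hx' := by
    have := pow_mul_mem_ray hg h1 hx' N
    rw [mul_inv_cancel_left] at this
    exact (norm_add_norm_of_ray hx this).le

theorem exists_freeAxis (I : Set ℕ) {g : FreeGroup (Bool × Bool)} (hg : g ≠ 1) :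
    ∃ p m V N K E, 1 ≤ m ∧ FreeAxis I (p * g ^ m * p⁻¹) V N K E := by
  obtain ⟨p, r, hr, hrp⟩ := exists_conj_isCyclicallyReduced g
  have hr1 : r ≠ 1 := by rw [hrp]; simpa using hg
  obtain ⟨N, hN⟩ := spread I hr hr1
  by_cases hc : ∃ k : ℕ, 1 ≤ k ∧ ∃ d, d⁻¹ * r ^ k * d ∈ sub I
  · obtain ⟨k, hk, d, hd⟩ := hc
    have e1 : ∀ n, (d⁻¹ * r ^ k * d) ^ n = d⁻¹ * r ^ (k * n) * d := fun n => by
      have h := conj_pow (a := d⁻¹) (b := r ^ k) (i := n)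
      rwa [inv_inv, ← pow_mul] at h
    have e2 : d⁻¹ * p * g ^ k * (d⁻¹ * p)⁻¹ = d⁻¹ * r ^ k * d := by
      rw [hrp, conj_pow]; group
    have hNk : N ≤ k * N := Nat.le_mul_of_pos_left N hk
    have hmono : ∀ n m, n ≤ m → ∀ x, (r ^ m)⁻¹ * x ∈ ray r → (r ^ n)⁻¹ * x ∈ ray r := by
      intro n m hnm x hx
      have h := pow_mul_mem_ray hr hr1 hx (m - n)
      rw [← mul_assoc] at h
      convert h using 2
      obtain ⟨t, rfl⟩ := Nat.exists_eq_add_of_le hnm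
      rw [Nat.add_sub_cancel_left, add_comm, pow_add]
      group
    have hA := axis_ray hr hr1 N
    refine ⟨d⁻¹ * p, k, {x | d * x ∈ ray r}, N, 2 * d.norm, True, hk, ?_⟩
    rw [e2]
    refine ⟨⟨fun x hx => ?_, fun x => ?_, fun x => ?_, fun x x' hx hx' => ?_⟩, fun _ => hd,
      fun x x' h hx hx' => ⟨trivial, ?_⟩⟩
    · change d * (d⁻¹ * r ^ k * d * x) ∈ ray r
      rw [show d * (d⁻¹ * r ^ k * d * x) = r ^ k * (d * x) by group]
      exact pow_mul_mem_ray hr hr1 hx k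
    · obtain ⟨n, hn⟩ := hA.absorb (d * x)
      refine ⟨n, ?_⟩
      change d * (_ * x) ∈ ray r
      rw [e1, show d * (d⁻¹ * r ^ (k * n) * d * x) = r ^ (k * n) * (d * x) by group]
      have h := pow_mul_mem_ray hr hr1 hn (k * n - n)
      rwa [← mul_assoc, ← pow_add, Nat.sub_add_cancel (Nat.le_mul_of_pos_left n hk)] at h
    · obtain ⟨n, hn⟩ := hA.escape (d * x)
      refine ⟨n, fun h => hn ?_⟩
      change d * (_ * x) ∈ ray r at h
      rw [e1, show d * ((d⁻¹ * r ^ (k * n) * d)⁻¹ * x) = (r ^ (k * n))⁻¹ * (d * x) by group] at h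
      exact hmono _ _ (Nat.le_mul_of_pos_left n hk) _ h
    · change d * (_ * x') ∈ ray r at hx'
      rw [e1,
        show d * ((d⁻¹ * r ^ (k * N) * d)⁻¹ * x') = (r ^ (k * N))⁻¹ * (d * x') by group] at hx'
      have h := hA.norm_add (d * x) (d * x') hx (hmono _ _ hNk _ hx')
      rw [show (d * x)⁻¹ * (d * x') = x⁻¹ * x' by group] at h
      have h2 := norm_mul_le d⁻¹ (d * x)
      have h3 := norm_mul_le d⁻¹ (d * x')
      rw [inv_mul_cancel_left, norm_inv_eq] at h2 h3
      omega
    · change d * (_ * x') ∈ ray r at hx'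
      rw [e1,
        show d * ((d⁻¹ * r ^ (k * N) * d)⁻¹ * x') = (r ^ (k * N))⁻¹ * (d * x') by group] at hx'
      obtain ⟨s, l, b, hl, h2, h3⟩ := hN (d * x) (d * x')
        (by rwa [show (d * x)⁻¹ * (d * x') = x⁻¹ * x' by group]) hx (hmono _ _ hNk _ hx')
      have h4 : b⁻¹ * r ^ (l * k) * b ∈ sub I := by
        have h := pow_mem h3 k
        have h' := conj_pow (a := b⁻¹) (b := r ^ l) (i := k)
        rw [inv_inv, ← pow_mul] at h'
        rwa [h'] at h
      have h5 : d⁻¹ * r ^ s * b ∈ sub I := by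
        by_contra h6
        have h7 := sub_malnormal h6 h4 (by
          have h8 := pow_mem hd l
          rw [e1] at h8
          convert h8 using 1
          rw [show d⁻¹ * r ^ s * b * (b⁻¹ * r ^ (l * k) * b) * (d⁻¹ * r ^ s * b)⁻¹ =
            d⁻¹ * (r ^ s * r ^ (l * k) * (r ^ s)⁻¹) * d by group, ← pow_add, add_comm, pow_add,
            mul_inv_cancel_right, mul_comm])
        have h8 : r ^ (l * k) = 1 := by
          rw [← mul_left_inj b, ← mul_right_inj b⁻¹, ← mul_assoc, h7]; group
        have h9 := not_isOfFinOrder_of_isMulTorsionFree hr1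
        exact h9 (isOfFinOrder_iff_pow_eq_one.2 ⟨l * k, Nat.mul_pos hl hk, h8⟩)
      have h6 := mul_mem h5 (inv_mem h2)
      convert h6 using 1
      group
  · push Not at hc
    refine ⟨p, 1, ray r, N, 0, False, le_rfl, ?_⟩
    rw [pow_one, ← hrp]
    refine ⟨axis_ray hr hr1 N, False.elim, fun x x' h hx hx' => ?_⟩
    obtain ⟨s, k, d, hk, -, h2⟩ := hN x x' h hx hx'
    exact (hc k hk d h2).elim

end GSC

namespace GSC
set_option linter.unusedSectionVars false

/-- The factor group of the doubles. -/
abbrev Factor := FreeGroup (Bool × Bool)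

section Double

variable {G : Type*} [Group G]

/-- Alternating products of `n` syllables in a double of the factor along `sub I`, starting on side
`i` and ending on side `k`. -/
inductive Alt (I : Set ℕ) (j : Bool → Factor →* G) : ℕ → Bool → Bool → G → Prop
  | single (i : Bool) (s : Factor) (hs : s ∉ sub I) : Alt I j 1 i i (j i s)
  | cons (n : ℕ) (i k : Bool) (s : Factor) (y : G) (hs : s ∉ sub I) (hy : Alt I j n (!i) k y) :
      Alt I j (n + 1) i k (j i s * y)

/-- Alternating products starting on side `i`. -/
def half (I : Set ℕ) (j : Bool → Factor →* G) (i : Bool) : Set G :=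
  {x | ∃ n k, Alt I j n i k x}

/-- The image of the amalgamated subgroup. -/
def base (I : Set ℕ) (j : Bool → Factor →* G) : Set G := {x | ∃ c ∈ sub I, x = j true c}

/-- `G` is the double of the factor along `sub I`, with folding map `ρ` and length function `ν`. -/
structure Double (I : Set ℕ) (j : Bool → Factor →* G) (ρ : G →* Factor) (ν : G → ℕ) : Prop where
  fold : ∀ a f, ρ (j a f) = f
  amalgam : ∀ c ∈ sub I, j true c = j false c
  reduced : ∀ i, ∀ x ∈ half I j i, x ∉ base I j
  length_inv : ∀ x, ν x⁻¹ = ν x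
  length_mul_le : ∀ x y, ν (x * y) ≤ ν x + ν y
  length_factor : ∀ a f, ν (j a f) = f.norm
  length_fold : ∀ x, (ρ x).norm ≤ ν x
  split : ∀ x, x ≠ 1 → ∃ a f, ν x = ν (j a f) + ν ((j a f)⁻¹ * x) ∧ 0 < ν (j a f)

namespace Double

variable {I : Set ℕ} {j : Bool → Factor →* G} {ρ : G →* Factor} {ν : G → ℕ}
variable (D : Double I j ρ ν)
include D

lemma side_eq {c : Factor} (hc : c ∈ sub I) (a b : Bool) : j a c = j b c := by
  cases a <;> cases b <;> simp [D.amalgam c hc]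

lemma length_one : ν 1 = 0 := by
  have := D.length_factor true 1
  simpa using this

lemma eq_one_of_length {x : G} (h : ν x = 0) : x = 1 := by
  by_contra hx
  obtain ⟨a, f, h1, h2⟩ := D.split x hx
  omega

lemma length_pos {x : G} (h : x ≠ 1) : 0 < ν x :=
  Nat.pos_of_ne_zero fun h0 => h (D.eq_one_of_length h0)

lemma mem_base {c : Factor} (hc : c ∈ sub I) (a : Bool) : j a c ∈ base I j :=
  ⟨c, hc, D.side_eq hc _ _⟩

lemma one_mem_base : (1 : G) ∈ base I j := by
  simpa using D.mem_base (one_mem _) true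

lemma single_mem_half {s : Factor} (hs : s ∉ sub I) (i : Bool) : j i s ∈ half I j i :=
  ⟨_, _, .single i s hs⟩

lemma cons_mem_half {s : Factor} (hs : s ∉ sub I) {i k : Bool} (hk : k = !i) {y : G}
    (hy : y ∈ half I j k) : j i s * y ∈ half I j i := by
  subst hk
  obtain ⟨n, k, h⟩ := hy
  exact ⟨_, _, .cons n i k s y hs h⟩

lemma mul_mem_half {s : Factor} (hs : s ∉ sub I) {i k : Bool} (hk : k = !i) {y : G}
    (hy : y ∈ half I j k ∪ base I j) : j i s * y ∈ half I j i := by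
  rcases hy with hy | ⟨c, hc, rfl⟩
  · exact D.cons_mem_half hs hk hy
  · rw [D.side_eq hc true i, ← map_mul]
    exact D.single_mem_half (fun h => hs (by simpa using mul_mem h (inv_mem hc))) i

lemma factor_mem (s : Factor) (i : Bool) : j i s ∈ half I j i ∪ base I j := by
  by_cases hs : s ∈ sub I
  · exact Or.inr (D.mem_base hs i)
  · exact Or.inl (D.single_mem_half hs i)

lemma half_cases {i : Bool} {x : G} (hx : x ∈ half I j i) :
    ∃ s ∉ sub I, x = j i s ∨ ∃ y ∈ half I j (!i), x = j i s * y := by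
  obtain ⟨n, k, h⟩ := hx
  cases h with
  | single i s hs => exact ⟨s, hs, Or.inl rfl⟩
  | cons n i k s y hs hy => exact ⟨s, hs, Or.inr ⟨y, ⟨_, _, hy⟩, rfl⟩⟩

lemma half_disjoint {i k : Bool} (hk : k = !i) {x : G} (hx : x ∈ half I j i)
    (hx' : x ∈ half I j k) : False := by
  obtain ⟨n, l, h⟩ := hx
  subst hk
  induction h with
  | single i s hs =>
    have h1 := D.cons_mem_half (s := s⁻¹) (i := i) (by simpa using hs) rfl hx'
    rw [← map_mul, inv_mul_cancel, map_one] at h1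
    exact D.reduced _ _ h1 D.one_mem_base
  | cons n i k s y hs hy ih =>
    have h1 := D.cons_mem_half (s := s⁻¹) (i := i) (by simpa using hs) rfl hx'
    rw [← mul_assoc, ← map_mul, inv_mul_cancel, map_one, one_mul] at h1
    rw [Bool.not_not] at ih
    exact ih h1

lemma base_mul_half {c : Factor} (hc : c ∈ sub I) {i : Bool} (a : Bool) {x : G}
    (hx : x ∈ half I j i) : j a c * x ∈ half I j i := by
  rw [D.side_eq hc a i]
  obtain ⟨s, hs, rfl | ⟨y, hy, rfl⟩⟩ := D.half_cases hx
  · rw [← map_mul]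
    exact D.single_mem_half (fun h => hs (by simpa using mul_mem (inv_mem hc) h)) i
  · rw [← mul_assoc, ← map_mul]
    exact D.cons_mem_half (fun h => hs (by simpa using mul_mem (inv_mem hc) h)) rfl hy

lemma cover (x : G) : x ∈ base I j ∨ ∃ i, x ∈ half I j i := by
  induction hn : ν x using Nat.strong_induction_on generalizing x with
  | _ n ih =>
    by_cases hx : x = 1
    · exact Or.inl (hx ▸ D.one_mem_base)
    obtain ⟨a, f, h1, h2⟩ := D.split x hx
    have h3 := ih _ (by omega) ((j a f)⁻¹ * x) rfl
    have h4 : x = j a f * ((j a f)⁻¹ * x) := by group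
    generalize (j a f)⁻¹ * x = y at h3 h4
    subst h4
    by_cases hf : f ∈ sub I
    · rcases h3 with ⟨c, hc, rfl⟩ | ⟨i, h3⟩
      · rw [D.side_eq hf a true, ← map_mul]
        exact Or.inl (D.mem_base (mul_mem hf hc) _)
      · exact Or.inr ⟨i, D.base_mul_half hf a h3⟩
    rcases h3 with h3 | ⟨i, h3⟩
    · exact Or.inr ⟨a, D.mul_mem_half hf rfl (Or.inr h3)⟩
    rcases Bool.eq_or_eq_not i a with rfl | rfl
    · obtain ⟨s, hs, rfl | ⟨y, hy, rfl⟩⟩ := D.half_cases h3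
      · rw [← map_mul]
        rcases D.factor_mem (f * s) i with h | h
        · exact Or.inr ⟨_, h⟩
        · exact Or.inl h
      · rw [← mul_assoc, ← map_mul]
        by_cases hfs : f * s ∈ sub I
        · exact Or.inr ⟨_, D.base_mul_half hfs i hy⟩
        · exact Or.inr ⟨_, D.cons_mem_half hfs rfl hy⟩
    · exact Or.inr ⟨a, D.cons_mem_half hf rfl h3⟩

lemma mem_of_notMem_half {i k : Bool} (hk : k = !i) {x : G} (hx : x ∉ half I j i) :
    x ∈ half I j k ∪ base I j := by
  rcases D.cover x with h | ⟨l, h⟩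
  · exact Or.inr h
  · rcases Bool.eq_or_eq_not l i with rfl | rfl
    · exact (hx h).elim
    · exact Or.inl (hk ▸ h)

lemma half_mul {i : Bool} {x : G} (hx : x ∈ half I j i) (a : Bool) (f : Factor) :
    x * j a f ∈ half I j i ∪ base I j := by
  obtain ⟨n, k, h⟩ := hx
  induction h with
  | single i s hs =>
    rcases Bool.eq_or_eq_not a i with rfl | rfl
    · rw [← map_mul]; exact D.factor_mem _ _
    · exact Or.inl (D.mul_mem_half hs rfl (D.factor_mem f (!i)))
  | cons n i k s y hs hy ih =>
    rw [mul_assoc]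
    exact Or.inl (D.mul_mem_half hs rfl ih)

/-- Geodesics between opposite halves meet the base. -/
lemma crossing {i k : Bool} (hk : k = !i) {x x' : G} (hx : x ∈ half I j i ∪ base I j)
    (hx' : x' ∈ half I j k ∪ base I j) :
    ∃ c ∈ base I j, ν (x⁻¹ * c) + ν (c⁻¹ * x') = ν (x⁻¹ * x') := by
  induction hn : ν (x⁻¹ * x') using Nat.strong_induction_on generalizing x with
  | _ n ih =>
    rcases hx with hx | hx
    · have hne : x⁻¹ * x' ≠ 1 := by
        intro h
        obtain rfl : x = x' := inv_mul_eq_one.1 h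
        rcases hx' with h | h
        · exact D.half_disjoint hk hx h
        · exact D.reduced _ _ hx h
      obtain ⟨a, f, h1, h2⟩ := D.split _ hne
      rw [← mul_assoc, ← mul_inv_rev] at h1
      obtain ⟨c, hc, h3⟩ := ih _ (by omega) (D.half_mul hx a f) rfl
      refine ⟨c, hc, ?_⟩
      have h4 := D.length_mul_le (j a f) ((x * j a f)⁻¹ * c)
      have h5 := D.length_mul_le (x⁻¹ * c) (c⁻¹ * x')
      rw [show j a f * ((x * j a f)⁻¹ * c) = x⁻¹ * c by group] at h4
      rw [show x⁻¹ * c * (c⁻¹ * x') = x⁻¹ * x' by group] at h5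
      omega
    · exact ⟨x, hx, by rw [inv_mul_cancel, D.length_one, zero_add, hn]⟩

end Double
end Double
end GSC

namespace GSC
set_option linter.unusedSectionVars false

section Double

variable {G : Type*} [Group G]

namespace Double

variable {I : Set ℕ} {j : Bool → Factor →* G} {ρ : G →* Factor} {ν : G → ℕ}
variable (D : Double I j ρ ν)
include D

lemma alt_mul {n : ℕ} {i k l : Bool} (hl : l = !k) {x y : G} (hx : Alt I j n i k x)
    (hy : y ∈ half I j l ∪ base I j) : x * y ∈ half I j i := by
  induction hx with
  | single i s hs => exact D.mul_mem_half hs hl hy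
  | cons n i k s z hs hz ih =>
    rw [mul_assoc]
    exact D.cons_mem_half hs rfl (ih hl)

lemma alt_snoc {n : ℕ} {i k : Bool} {x : G} (hx : Alt I j n i k x) {l : Bool} (hl : l = !k)
    {s : Factor} (hs : s ∉ sub I) : Alt I j (n + 1) i l (x * j l s) := by
  induction hx with
  | single i t ht => exact .cons 1 i l t _ ht (hl ▸ .single l s hs)
  | cons n i k t z ht hz ih =>
    rw [mul_assoc]
    exact .cons _ _ _ _ _ ht (ih hl)

lemma alt_inv {n : ℕ} {i k : Bool} {x : G} (hx : Alt I j n i k x) : Alt I j n k i x⁻¹ := by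
  induction hx with
  | single i s hs => rw [← map_inv]; exact .single i _ (by simpa using hs)
  | cons n i k s z hs hz ih =>
    rw [mul_inv_rev, ← map_inv]
    exact D.alt_snoc ih (by simp) (by simpa using hs)

lemma alt_merge {n : ℕ} {i k : Bool} {x : G} (hx : Alt I j n i k x) (s : Factor) :
    Alt I j n i k (x * j k s) ∨ (n = 1 ∧ i = k ∧ x * j k s ∈ base I j) ∨
      ∃ m, n = m + 1 ∧ Alt I j m i (!k) (x * j k s) := by
  induction hx with
  | single i t ht =>
    rw [← map_mul]
    by_cases h : t * s ∈ sub I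
    · exact Or.inr (Or.inl ⟨rfl, rfl, D.mem_base h _⟩)
    · exact Or.inl (.single _ _ h)
  | cons n i k t z ht hz ih =>
    rw [mul_assoc]
    rcases ih with h | ⟨rfl, rfl, c, hc, h⟩ | ⟨m, rfl, h⟩
    · exact Or.inl (.cons _ _ _ _ _ ht h)
    · refine Or.inr (Or.inr ⟨1, rfl, ?_⟩)
      rw [h, D.side_eq hc true i, ← map_mul, Bool.not_not]
      exact .single _ _ fun h' => ht (by simpa using mul_mem h' (inv_mem hc))
    · exact Or.inr (Or.inr ⟨m + 1, rfl, .cons _ _ _ _ _ ht h⟩)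

lemma alt_conj {n : ℕ} {i k : Bool} {x : G} (hx : Alt I j n i k x) :
    (∃ p a f, p * x * p⁻¹ = j a f) ∨ ∃ p m l, Alt I j m l (!l) (p * x * p⁻¹) := by
  induction n using Nat.strong_induction_on generalizing i k x with
  | _ n ih =>
    rcases Bool.eq_or_eq_not k i with rfl | rfl
    · cases hx with
      | single i s hs => exact Or.inl ⟨1, _, _, by simp; rfl⟩
      | cons n i k s y hs hy =>
        have e : (j k s)⁻¹ * (j k s * y) * (j k s)⁻¹⁻¹ = y * j k s := by group
        rcases D.alt_merge hy s with h | ⟨-, h, -⟩ | ⟨m, rfl, h⟩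
        · refine Or.inr ⟨(j k s)⁻¹, n, !k, ?_⟩
          rw [e, Bool.not_not]
          exact h
        · simp at h
        · rw [← e] at h
          rcases ih m (by omega) h with ⟨p, a, f, h⟩ | ⟨p, m, l, h⟩
          · exact Or.inl ⟨p * (j k s)⁻¹, a, f, by rw [← h]; group⟩
          · refine Or.inr ⟨p * (j k s)⁻¹, m, l, ?_⟩
            convert h using 1
            group
    · exact Or.inr ⟨1, n, i, by simpa using hx⟩

lemma conj_cases (x : G) :
    (∃ p a f, p * x * p⁻¹ = j a f) ∨ ∃ p m l, Alt I j m l (!l) (p * x * p⁻¹) := by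
  rcases D.cover x with ⟨c, -, rfl⟩ | ⟨i, n, k, h⟩
  · exact Or.inl ⟨1, true, c, by simp⟩
  · exact D.alt_conj h

lemma axis_conj {g p : G} {V : Set G} {N K : ℕ} (h : Axis ν (p * g * p⁻¹) V N K) :
    Axis ν g {x | p * x ∈ V} N (K + 2 * ν p) := by
  have e : ∀ (n : ℕ) x, (p * g * p⁻¹) ^ n * (p * x) = p * (g ^ n * x) := fun n x => by
    rw [conj_pow]; group
  have e' : ∀ (n : ℕ) x, ((p * g * p⁻¹) ^ n)⁻¹ * (p * x) = p * ((g ^ n)⁻¹ * x) := fun n x => by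
    rw [conj_pow]; group
  refine ⟨fun x hx => ?_, fun x => ?_, fun x => ?_, fun x x' hx hx' => ?_⟩
  · have h1 := h.mul_mem _ hx
    rw [← pow_one (p * g * p⁻¹), e, pow_one] at h1
    exact h1
  · obtain ⟨n, hn⟩ := h.absorb (p * x)
    rw [e] at hn
    exact ⟨n, hn⟩
  · obtain ⟨n, hn⟩ := h.escape (p * x)
    rw [e'] at hn
    exact ⟨n, hn⟩
  · have h1 := h.norm_add _ (p * x') hx (by rw [e']; exact hx')
    rw [show (p * x)⁻¹ * (p * x') = x⁻¹ * x' by group] at h1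
    have h2 := D.length_mul_le p⁻¹ (p * x)
    have h3 := D.length_mul_le p⁻¹ (p * x')
    rw [inv_mul_cancel_left, D.length_inv] at h2 h3
    omega

/-- Two successive crossings. -/
lemma crossing_two {i : Bool} {s : Factor} (hs : s ∉ sub I) {x x' : G}
    (hx : x ∈ half I j (!i) ∪ base I j) (hx' : (j i s)⁻¹ * x' ∈ half I j (!i)) :
    ∃ c ∈ sub I, ∃ c' ∈ sub I, ν (x⁻¹ * j i c) + ν ((j i c)⁻¹ * j i (s * c')) +
      ν ((j i (s * c'))⁻¹ * x') = ν (x⁻¹ * x') := by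
  have h1 : x' ∈ half I j i := by
    have h := D.cons_mem_half hs rfl hx'
    rwa [mul_inv_cancel_left] at h
  obtain ⟨_, ⟨c, hc, rfl⟩, h2⟩ := D.crossing (by simp) hx (Or.inl h1)
  rw [D.side_eq hc true i] at h2
  obtain ⟨_, ⟨c', hc', rfl⟩, h3⟩ := D.crossing (x := (j i s)⁻¹ * j i c) rfl
    (by rw [← map_inv, ← map_mul]; exact D.factor_mem _ _) (Or.inl hx')
  rw [D.side_eq hc' true i] at h3
  refine ⟨c, hc, c', hc', ?_⟩
  rw [show ((j i s)⁻¹ * j i c)⁻¹ * j i c' = (j i c)⁻¹ * j i (s * c') by rw [map_mul]; group,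
    show (j i c')⁻¹ * ((j i s)⁻¹ * x') = (j i (s * c'))⁻¹ * x' by rw [map_mul]; group,
    show ((j i s)⁻¹ * j i c)⁻¹ * ((j i s)⁻¹ * x') = (j i c)⁻¹ * x' by group] at h3
  omega

lemma axis_of_alt {n : ℕ} {i : Bool} {g : G} (hg : Alt I j n i (!i) g) :
    ∃ K, Axis ν g (half I j i) 1 K := by
  generalize hk : (!i) = k at hg
  cases hg with
  | single i s hs => simp at hk
  | cons n i k s g' hs hg' =>
    subst hk
    have hg1 : ∀ y ∈ half I j i ∪ base I j, g' * y ∈ half I j (!i) := fun y hy =>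
      D.alt_mul (by simp) hg' hy
    have hg2 : ∀ y ∈ half I j i ∪ base I j, g'⁻¹ * y ∈ half I j (!i) := fun y hy =>
      D.alt_mul (by simp) (D.alt_inv hg') hy
    set g := j i s * g' with hgdef
    have hmul : ∀ x ∈ half I j i, g * x ∈ half I j i := fun x hx => by
      rw [hgdef, mul_assoc]
      exact D.cons_mem_half hs rfl (hg1 x (Or.inl hx))
    have hdist : ∀ (n : ℕ) x x', x ∈ half I j (!i) ∪ base I j → (g ^ n)⁻¹ * x' ∈ half I j i →
        n ≤ ν (x⁻¹ * x') := by
      intro n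
      induction n with
      | zero => simp
      | succ n ih =>
        intro x x' hx hx'
        have h1 : g⁻¹ * x' ∈ half I j i := by
          have h := pow_mul_mem_of_mul_mem hmul n hx'
          rw [pow_succ'] at h
          convert h using 1
          group
        obtain ⟨c, hc, c', hc', h2⟩ := D.crossing_two hs (x' := x') hx (by
          have h := hg1 _ (Or.inl h1)
          convert h using 1
          rw [hgdef]; group)
        have h3 := ih (g'⁻¹ * j i c') (g⁻¹ * x')
          (Or.inl (hg2 _ (Or.inr (D.mem_base hc' i)))) (by
            convert hx' using 1
            rw [pow_succ']; group)
        rw [show (g'⁻¹ * j i c')⁻¹ * (g⁻¹ * x') = (j i (s * c'))⁻¹ * x' by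
          rw [hgdef, map_mul]; group] at h3
        have h4 : 0 < ν ((j i c)⁻¹ * j i (s * c')) := by
          refine D.length_pos fun h => hs ?_
          rw [← map_inv, ← map_mul] at h
          have h5 := congrArg ρ h
          rw [D.fold, map_one, inv_mul_eq_one] at h5
          have h6 : s = c * c'⁻¹ := by rw [h5]; group
          exact h6 ▸ mul_mem hc (inv_mem hc')
        omega
    obtain ⟨K, hK⟩ := norm_add_norm_le hs
    refine ⟨K, hmul, fun x => ?_, fun x => ?_, fun x x' hx hx' => ?_⟩
    · by_contra hc
      push Not at hc
      have h0 := D.single_mem_half hs i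
      have h := hdist (ν (x⁻¹ * j i s) + 1) (g ^ (ν (x⁻¹ * j i s) + 1) * x)
        (g ^ (ν (x⁻¹ * j i s) + 1) * j i s) (D.mem_of_notMem_half rfl (hc _))
        (by rwa [inv_mul_cancel_left])
      rw [mul_inv_rev, mul_assoc, inv_mul_cancel_left] at h
      omega
    · refine ⟨ν x + 1, fun h => ?_⟩
      have h1 := hdist (ν x + 1) 1 x (Or.inr D.one_mem_base) h
      rw [inv_one, one_mul] at h1
      omega
    · rw [pow_one] at hx'
      obtain ⟨c, hc, c', hc', h2⟩ := D.crossing_two hs (x' := x') (D.mem_of_notMem_half rfl hx) (by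
          have h := hg1 _ (Or.inl hx')
          convert h using 1
          rw [hgdef]; group)
      have h3 := hK c hc c' hc'
      rw [← D.length_factor i c, ← D.length_factor i (s * c'), ← D.length_factor i (_ * _),
        show j i (c⁻¹ * (s * c')) = (j i c)⁻¹ * j i (s * c') by rw [map_mul (j i) c⁻¹, map_inv]]
        at h3
      have h4 := D.length_mul_le (x⁻¹ * j i c) (j i c)⁻¹
      have h5 := D.length_mul_le (j i (s * c')) ((j i (s * c'))⁻¹ * x')
      rw [mul_inv_cancel_right, D.length_inv, D.length_inv] at h4
      rw [mul_inv_cancel_left] at h5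
      omega

end Double
end Double
end GSC

namespace GSC
set_option linter.unusedSectionVars false

section Double

variable {G : Type*} [Group G]

/-- `j a f` is a closest point to `x` among the factors on sides satisfying `Sd`. -/
def Near (j : Bool → Factor →* G) (ν : G → ℕ) (Sd : Bool → Prop) (a : Bool) (f : Factor) (x : G) :
    Prop :=
  Sd a ∧ ∀ b h, Sd b → ν ((j a f)⁻¹ * x) ≤ ν ((j b h)⁻¹ * x)

lemma exists_near {j : Bool → Factor →* G} (ν : G → ℕ) {Sd : Bool → Prop} {i : Bool} (hi : Sd i)
    (x : G) : ∃ a f, Near j ν Sd a f x := by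
  have hne : {n | ∃ a f, Sd a ∧ ν ((j a f)⁻¹ * x) = n}.Nonempty := ⟨_, i, 1, hi, rfl⟩
  obtain ⟨a, f, h1, h2⟩ := Nat.sInf_mem hne
  exact ⟨a, f, h1, fun b h hb => h2 ▸ Nat.sInf_le ⟨b, h, hb, rfl⟩⟩

lemma Near.mul {j : Bool → Factor →* G} {ν : G → ℕ} {Sd : Bool → Prop} {a : Bool} {f : Factor}
    {x : G} (h : Near j ν Sd a f x) {u : Factor} {i : Bool} (hu : ∀ b, Sd b → j i u = j b u) :
    Near j ν Sd a (u * f) (j i u * x) := by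
  refine ⟨h.1, fun b k hb => ?_⟩
  have h1 := h.2 b (u⁻¹ * k) hb
  have h2 : (j a (u * f))⁻¹ * (j i u * x) = (j a f)⁻¹ * x := by
    rw [hu a h.1, map_mul]; group
  have h3 : (j b k)⁻¹ * (j i u * x) = (j b (u⁻¹ * k))⁻¹ * x := by
    rw [hu b hb, map_mul, map_inv]; group
  rwa [h2, h3]

namespace Double

variable {I : Set ℕ} {j : Bool → Factor →* G} {ρ : G →* Factor} {ν : G → ℕ}
variable (D : Double I j ρ ν)
include D

lemma near_mem {Sd : Bool → Prop} {a : Bool} {f : Factor} {x : G} (h : Near j ν Sd a f x) :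
    (j a f)⁻¹ * x = 1 ∨ (j a f)⁻¹ * x ∈ half I j (!a) := by
  have key : ∀ s, ν ((j a f)⁻¹ * x) ≤ ν ((j a s)⁻¹ * ((j a f)⁻¹ * x)) := fun s => by
    have h1 := h.2 a (f * s) h.1
    rwa [map_mul, mul_inv_rev, mul_assoc] at h1
  generalize (j a f)⁻¹ * x = z at key
  rcases D.cover z with ⟨c, hc, rfl⟩ | ⟨i, hz⟩
  · left
    have h1 := key c
    rw [D.side_eq hc true a, inv_mul_cancel, D.length_one] at h1
    rw [D.side_eq hc true a]
    exact D.eq_one_of_length (by omega)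
  · rcases Bool.eq_or_eq_not i a with rfl | rfl
    · refine Or.inl (by_contra fun h1 => ?_)
      obtain ⟨b, s, h2, h3⟩ := D.split z h1
      by_cases hb : j b s = j i s
      · have := key s
        rw [← hb] at this
        omega
      · have hs : s ∉ sub I := fun hs => hb (D.side_eq hs _ _)
        have hb' : b = !i := by
          rcases Bool.eq_or_eq_not b i with rfl | h
          · exact (hb rfl).elim
          · exact h
        obtain ⟨_, ⟨c, hc, rfl⟩, h4⟩ := D.crossing (by rw [hb', Bool.not_not])
          (Or.inl (D.single_mem_half hs b)) (Or.inl hz)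
        have := key c
        rw [D.side_eq hc true i] at h4
        omega
    · exact Or.inr hz

lemma near_eq_one {Sd : Bool → Prop} {a : Bool} {f : Factor} {x : G} (h : Near j ν Sd a f x)
    (hSd : ∀ b, Sd b) (hf : f ∈ sub I) : (j a f)⁻¹ * x = 1 := by
  rcases D.near_mem h with h1 | h1
  · exact h1
  have h' : Near j ν Sd (!a) f x := ⟨hSd _, fun b k hb => by
    rw [D.side_eq hf (!a) a]; exact h.2 b k hb⟩
  have h2 := D.near_mem h'
  rw [D.side_eq hf (!a) a, Bool.not_not] at h2
  rcases h2 with h2 | h2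
  · exact h2
  · exact (D.half_disjoint (by simp) h1 h2).elim

lemma near_norm_le {Sd : Bool → Prop} {i a : Bool} (hi : Sd i) {f : Factor} {x : G}
    (h : Near j ν Sd a f x) : f.norm ≤ 2 * ν x := by
  have h1 := h.2 i 1 hi
  rw [map_one, inv_one, one_mul] at h1
  have h2 := D.length_mul_le x ((j a f)⁻¹ * x)⁻¹
  rw [D.length_inv, mul_inv_rev, inv_inv, mul_inv_cancel_left, D.length_factor] at h2
  omega

/-- Axes of elements of the factors. -/
theorem axis_of_freeAxis {g : Factor} {V : Set Factor} {N K : ℕ} {E : Prop}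
    (A : FreeAxis I g V N K E) (i : Bool) : ∃ V' N' K', Axis ν (j i g) V' N' K' := by
  set Sd : Bool → Prop := fun a => a = i ∨ E with hSd
  have hi : Sd i := Or.inl rfl
  have hE : ∀ a b, Sd a → Sd b → b = !a → E := by
    rintro a b (rfl | h) (rfl | h') hab
    · simp at hab
    all_goals assumption
  have hpow : ∀ n : ℕ, ∀ b, Sd b → j i (g ^ n) = j b (g ^ n) := by
    rintro n b (rfl | h)
    · rfl
    · exact D.side_eq (pow_mem (A.mem_of_cond h) n) _ _
  have hmono : ∀ (m n : ℕ) (f : Factor), m ≤ n → (g ^ n)⁻¹ * f ∈ V → (g ^ m)⁻¹ * f ∈ V := by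
    intro m n f hmn hf
    have h := pow_mul_mem_of_mul_mem A.mul_mem (n - m) hf
    convert h using 1
    obtain ⟨k, rfl⟩ := Nat.exists_eq_add_of_le hmn
    rw [Nat.add_sub_cancel_left, add_comm, pow_add]
    group
  have hmono0 : ∀ (n : ℕ) (f : Factor), (g ^ n)⁻¹ * f ∈ V → f ∈ V := fun n f hf => by
    simpa using hmono 0 n f (Nat.zero_le _) hf
  refine ⟨{x | ∃ a f, Near j ν Sd a f x ∧ f ∈ V}, 3 * N, K + 2 * (g ^ N).norm, ?_, ?_, ?_, ?_⟩
  · rintro x ⟨a, f, h, hf⟩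
    have h1 := h.mul (hpow 1)
    rw [pow_one] at h1
    exact ⟨a, g * f, h1, A.mul_mem _ hf⟩
  · intro x
    obtain ⟨a, f, h⟩ := exists_near (j := j) ν hi x
    obtain ⟨n, hn⟩ := A.absorb f
    have h1 := h.mul (hpow n)
    rw [map_pow] at h1
    exact ⟨n, a, _, h1, hn⟩
  · intro x
    choose n hn using A.escape
    obtain ⟨B, hB⟩ := ((finite_norm_le (α := Bool × Bool) (2 * ν x)).image n).bddAbove
    refine ⟨B, ?_⟩
    rintro ⟨a, f, h, hf⟩
    have h1 := h.mul (hpow B)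
    rw [map_pow, mul_inv_cancel_left] at h1
    refine hn (g ^ B * f) (hmono _ B _ (hB ⟨_, D.near_norm_le hi h1, rfl⟩) ?_)
    rwa [inv_mul_cancel_left]
  · rintro x x' hx ⟨a', f', h', hf'⟩
    obtain ⟨a, f, h⟩ := exists_near (j := j) ν hi x
    have hf : f ∉ V := fun hf => hx ⟨a, f, h, hf⟩
    replace h' := h'.mul (hpow (3 * N))
    rw [map_pow, mul_inv_cancel_left] at h'
    rw [← inv_mul_cancel_left (g ^ (3 * N)) f'] at hf'
    generalize g ^ (3 * N) * f' = f' at h' hf'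
    have hz := D.near_mem h
    have hz' := D.near_mem h'
    have special : ∀ {b k y}, Near j ν Sd b k y → E ∧ k ∈ sub I → (j b k)⁻¹ * y = 1 :=
      fun hy he => D.near_eq_one hy (fun b => Or.inr he.1) he.2
    obtain ⟨c, hc, hcV, h1⟩ : ∃ c ∈ sub I, (g ^ N)⁻¹ * (f * c) ∉ V ∧
        ν (x⁻¹ * j a (f * c)) + ν ((j a (f * c))⁻¹ * x') = ν (x⁻¹ * x') := by
      by_cases hz1 : (j a f)⁻¹ * x = 1
      · refine ⟨1, one_mem _, fun hV => hf (hmono0 N f (by simpa using hV)), ?_⟩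
        rw [mul_one, inv_mul_eq_one.1 hz1, inv_mul_cancel, D.length_one, zero_add]
      have hns : ¬ (E ∧ f ∈ sub I) := fun he => hz1 (special h he)
      have hx' : (j a f)⁻¹ * x' ∈ half I j a ∪ base I j := by
        have e : x' = j a' f' * ((j a' f')⁻¹ * x') := by group
        rw [e, ← map_inv]
        generalize hz0' : (j a' f')⁻¹ * x' = z' at hz'
        rcases Bool.eq_or_eq_not a' a with rfl | haa
        · rw [← mul_assoc, ← map_mul]
          rcases hz' with rfl | hz'
          · rw [mul_one]; exact D.factor_mem _ _
          · refine Or.inl (D.cons_mem_half (fun hff => hns (A.cond f f' hff hf ?_)) rfl hz')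
            exact hmono _ _ _ (by omega) hf'
        · have he := hE a a' h.1 h'.1 haa
          have hfs : f⁻¹ ∉ sub I := fun hfs => hns ⟨he, by simpa using hfs⟩
          by_cases hfs' : f' ∈ sub I
          · rw [← hz0', special h' ⟨he, hfs'⟩, mul_one, D.side_eq hfs' a' a, ← map_mul]
            exact D.factor_mem _ _
          · refine Or.inl (D.cons_mem_half hfs haa (D.mul_mem_half hfs' rfl ?_))
            rcases hz' with rfl | hz'
            · exact Or.inr D.one_mem_base
            · exact Or.inl hz'
      obtain ⟨_, ⟨c, hc, rfl⟩, h1⟩ :=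
        D.crossing (by rw [Bool.not_not]) (Or.inl (hz.resolve_left hz1)) hx'
      rw [D.side_eq hc true a] at h1
      refine ⟨c, hc, fun hV => hns (A.cond f (f * c) (by simpa using hc) hf hV), ?_⟩
      rw [map_mul]
      simpa only [mul_inv_rev, inv_inv, mul_assoc, mul_inv_cancel_left] using h1
    obtain ⟨c', hc', hcV', h2⟩ : ∃ c' ∈ sub I, (g ^ (2 * N))⁻¹ * (f' * c') ∈ V ∧
        ν ((j a (f * c))⁻¹ * j a' (f' * c')) + ν ((j a' (f' * c'))⁻¹ * x') =
          ν ((j a (f * c))⁻¹ * x') := by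
      by_cases hz1 : (j a' f')⁻¹ * x' = 1
      · refine ⟨1, one_mem _, hmono _ (3 * N) _ (by omega) (by simpa using hf'), ?_⟩
        rw [mul_one, inv_mul_eq_one.1 hz1, inv_mul_cancel, D.length_one, add_zero]
      have hns : ¬ (E ∧ f' ∈ sub I) := fun he => hz1 (special h' he)
      have hx : (j a' f')⁻¹ * j a (f * c) ∈ half I j a' ∪ base I j := by
        rw [← map_inv]
        rcases Bool.eq_or_eq_not a a' with rfl | haa
        · rw [← map_mul]
          exact D.factor_mem _ _
        · have he := hE a' a h'.1 h.1 haa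
          exact Or.inl (D.mul_mem_half (fun hfs => hns ⟨he, by simpa using hfs⟩) haa
            (D.factor_mem _ _))
      obtain ⟨_, ⟨c', hc', rfl⟩, h2⟩ := D.crossing rfl hx (Or.inl (hz'.resolve_left hz1))
      rw [D.side_eq hc' true a'] at h2
      refine ⟨c', hc', by_contra fun hV => hns ?_, ?_⟩
      · obtain ⟨he, h3⟩ := A.cond ((g ^ (2 * N))⁻¹ * (f' * c')) ((g ^ (2 * N))⁻¹ * f')
          (by rw [show ((g ^ (2 * N))⁻¹ * (f' * c'))⁻¹ * ((g ^ (2 * N))⁻¹ * f') = c'⁻¹ by group]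
              exact inv_mem hc') hV (by
            convert hf' using 1
            rw [show 3 * N = 2 * N + N by ring, pow_add]
            group)
        have hg := pow_mem (A.mem_of_cond he) (2 * N)
        refine ⟨he, ?_⟩
        have h4 := mul_mem (mul_mem hg h3) (inv_mem hc')
        rwa [mul_inv_cancel_left, mul_inv_cancel_right] at h4
      · rw [map_mul (j a')]
        simpa only [mul_inv_rev, inv_inv, mul_assoc, mul_inv_cancel_left] using h2
    have h3 := A.norm_add ((g ^ N)⁻¹ * (f * c)) ((g ^ N)⁻¹ * (f' * c')) hcV (by
      convert hcV' using 1
      rw [two_mul, pow_add]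
      group)
    rw [show ((g ^ N)⁻¹ * (f * c))⁻¹ * ((g ^ N)⁻¹ * (f' * c')) = (f * c)⁻¹ * (f' * c') by group]
      at h3
    have h4 := FreeGroup.norm_mul_le (g ^ N) ((g ^ N)⁻¹ * (f * c))
    have h5 := FreeGroup.norm_mul_le (g ^ N) ((g ^ N)⁻¹ * (f' * c'))
    rw [mul_inv_cancel_left] at h4 h5
    have h6 := D.length_fold ((j a (f * c))⁻¹ * j a' (f' * c'))
    rw [map_mul, map_inv, D.fold, D.fold] at h6
    have h7 := D.length_mul_le (x⁻¹ * j a (f * c)) (j a (f * c))⁻¹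
    have h8 := D.length_mul_le (j a' (f' * c')) ((j a' (f' * c'))⁻¹ * x')
    rw [mul_inv_cancel_right, D.length_inv, D.length_inv, D.length_factor] at h7
    rw [mul_inv_cancel_left, D.length_factor] at h8
    omega

/-- Every nontrivial element has a power with an axis. -/
theorem exists_axis {x : G} (hx : x ≠ 1) : ∃ m V N K, 1 ≤ m ∧ Axis ν (x ^ m) V N K := by
  rcases D.conj_cases x with ⟨p, a, f, h⟩ | ⟨p, m, l, h⟩
  · have hf : f ≠ 1 := by
      rintro rfl
      rw [map_one] at h
      exact hx (by simpa using h)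
    obtain ⟨q, m, V, N, K, E, hm, A⟩ := exists_freeAxis I hf
    obtain ⟨V', N', K', A'⟩ := D.axis_of_freeAxis A a
    refine ⟨m, _, N', _, hm, D.axis_conj (p := j a q * p) (V := V') (K := K') ?_⟩
    convert A' using 1
    rw [map_mul, map_mul, map_inv, map_pow, ← h, conj_pow]
    group
  · obtain ⟨K, h⟩ := D.axis_of_alt h
    refine ⟨1, {y | p * y ∈ half I j l}, 1, K + 2 * ν p, le_rfl, ?_⟩
    rw [pow_one]
    exact D.axis_conj h

end Double
end Double
end GSC

namespace GSC

section Contraction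

variable {G : Type*} [Group G]

lemma Axis.exists_height {ν : G → ℕ} {g : G} {V : Set G} {N K : ℕ} (A : Axis ν g V N K) :
    ∃ h : G → ℤ, ∀ x (n : ℤ), (g ^ n)⁻¹ * x ∈ V ↔ n ≤ h x := by
  have hmono : ∀ x (m n : ℤ), m ≤ n → (g ^ n)⁻¹ * x ∈ V → (g ^ m)⁻¹ * x ∈ V := by
    intro x m n hmn hx
    obtain ⟨k, rfl⟩ := Int.le.dest hmn
    have h := pow_mul_mem_of_mul_mem A.mul_mem k hx
    rwa [zpow_add, mul_inv_rev, zpow_natCast, mul_assoc, mul_inv_cancel_left] at h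
  have hex : ∀ x, ∃ k : ℤ, ∀ n : ℤ, (g ^ n)⁻¹ * x ∈ V ↔ n ≤ k := by
    intro x
    obtain ⟨a, ha⟩ := A.absorb x
    obtain ⟨b, hb⟩ := A.escape x
    obtain ⟨k, hk, hk'⟩ := Int.exists_greatest_of_bdd (P := fun n : ℤ => (g ^ n)⁻¹ * x ∈ V)
      ⟨b, fun z hz => by
        by_contra h
        exact hb (by simpa using hmono x b z (by omega) hz)⟩ ⟨-a, by simpa using ha⟩
    exact ⟨k, fun n => ⟨hk' n, fun h => hmono x n k h hk⟩⟩
  choose h hh using hex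
  exact ⟨h, hh⟩

lemma admissible_const (C : ℕ) : Admissible (fun r => r) (fun _ => (C : ℝ)) :=
  ⟨monotone_id, monotone_const, Filter.eventually_ge_atTop 0,
    Filter.Eventually.of_forall fun _ => Nat.cast_nonneg C, fun _ => le_rfl, fun M => ⟨M, le_rfl⟩,
    tendsto_const_nhds.div_atTop Filter.tendsto_id⟩

/-- Cyclic subgroups with an axis are strongly contracting. -/
theorem stronglyContracting_zpowers (S : Set G)
    (length_inv : ∀ x, wordLength S x⁻¹ = wordLength S x)
    (finite_ball : ∀ n, {x | wordLength S x ≤ n}.Finite)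
    {g : G} {m N K : ℕ} {V : Set G} (hm : 1 ≤ m) (A : Axis (wordLength S) (g ^ m) V N K) :
    StronglyContracting S (Subgroup.zpowers g : Set G) := by
  obtain ⟨h, hh⟩ := A.exists_height
  set a := g ^ m with ha
  have hmul : ∀ (k : ℤ) x, h (a ^ k * x) = h x + k := fun k x => by
    have key : ∀ n : ℤ, n ≤ h (a ^ k * x) ↔ n ≤ h x + k := fun n => by
      rw [← hh, ← sub_le_iff_le_add, ← hh, ← mul_assoc, ← zpow_neg, ← zpow_neg, ← zpow_add, neg_sub,
        add_comm, sub_eq_add_neg]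
    exact le_antisymm ((key _).1 le_rfl) ((key _).2 le_rfl)
  have hadd : ∀ x x' (n : ℤ), h x < n → n + N ≤ h x' →
      wordLength S ((a ^ n)⁻¹ * x) + wordLength S ((a ^ n)⁻¹ * x') ≤
        wordLength S (x⁻¹ * x') + K := fun x x' n h1 h2 => by
    have h3 := A.norm_add ((a ^ n)⁻¹ * x) ((a ^ n)⁻¹ * x')
      (fun hV => absurd ((hh _ _).1 hV) (not_le.2 h1)) (by
        have h4 := (hh _ _).2 h2
        rwa [zpow_add, mul_inv_rev, zpow_natCast, mul_assoc] at h4)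
    rwa [show ((a ^ n)⁻¹ * x)⁻¹ * ((a ^ n)⁻¹ * x') = x⁻¹ * x' by group] at h3
  obtain ⟨B, hB⟩ : ∃ B : ℕ, ∀ x, wordLength S x ≤ K → |h x| ≤ B := by
    obtain ⟨B, hB⟩ := ((finite_ball K).image fun x => |h x|).bddAbove
    exact ⟨B.toNat, fun x hx => (hB ⟨x, hx, rfl⟩).trans (Int.self_le_toNat B)⟩
  obtain ⟨B', hB'⟩ : ∃ B' : ℕ, ∀ r : ℤ, 0 ≤ r → r < m → |h (g ^ r)| ≤ B' := by
    obtain ⟨B, hB⟩ := ((Set.finite_Ico (0 : ℤ) m).image fun r => |h (g ^ r)|).bddAbove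
    exact ⟨B.toNat, fun r h1 h2 => (hB ⟨r, ⟨h1, h2⟩, rfl⟩).trans (Int.self_le_toNat B)⟩
  have key : ∀ x z, (∀ n : ℤ, wordLength S (x⁻¹ * z) ≤ wordLength S (x⁻¹ * a ^ n)) →
      |h z - h x| ≤ B + N + 1 := by
    intro x z hz
    have symm : ∀ n : ℤ, wordLength S (x⁻¹ * a ^ n) = wordLength S ((a ^ n)⁻¹ * x) := fun n => by
      rw [← length_inv, mul_inv_rev, inv_inv]
    have hbound : ∀ n : ℤ, wordLength S ((a ^ n)⁻¹ * z) ≤ K → |h z - n| ≤ B := fun n hn => by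
      have h1 := hB _ hn
      rwa [← zpow_neg, hmul, ← sub_eq_add_neg] at h1
    by_contra hc
    rcases le_total (h x) (h z) with hle | hle
    · rw [abs_of_nonneg (by omega)] at hc
      have h1 := hadd x z (h x + 1) (by omega) (by omega)
      have h2 := hz (h x + 1)
      rw [symm] at h2
      have h3 := abs_le.1 (hbound (h x + 1) (by omega))
      omega
    · rw [abs_of_nonpos (by omega)] at hc
      have h1 := hadd z x (h x - N) (by omega) (by omega)
      have h2 := hz (h x - N)
      rw [symm] at h2
      rw [← length_inv (z⁻¹ * x), mul_inv_rev, inv_inv] at h1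
      have h3 := abs_le.1 (hbound (h x - N) (by omega))
      omega
  obtain ⟨C, hC⟩ : ∃ C : ℕ, ∀ e : ℤ, |e| ≤ m * (4 * (B + N + 1) + 2 * B' + 1) →
      wordLength S (g ^ e) ≤ C := by
    obtain ⟨C, hC⟩ := ((Set.finite_Icc (-(m * (4 * (B + N + 1) + 2 * B' + 1)) : ℤ)
      (m * (4 * (B + N + 1) + 2 * B' + 1))).image fun r => wordLength S (g ^ r)).bddAbove
    exact ⟨C, fun e he => hC ⟨e, abs_le.1 he, rfl⟩⟩
  refine ⟨C, admissible_const C, fun x _ x' _ hxx' y hy y' hy' => ?_⟩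
  have hdist : ∀ (z : G) (n : ℤ), setDist S z (Subgroup.zpowers g : Set G) ≤ wdist S z (a ^ n) :=
    fun z n => csInf_le ⟨0, by rintro _ ⟨w, -, rfl⟩; exact Nat.cast_nonneg _⟩
      ⟨_, Subgroup.zpow_mem _ (Subgroup.pow_mem _ (Subgroup.mem_zpowers g) m) n, rfl⟩
  have hx' : |h x' - h x| ≤ B + N + 1 := key x x' fun n =>
    Nat.cast_le.1 (hxx'.trans (hdist x n))
  have hproj : ∀ z, z ∈ proj S (Subgroup.zpowers g : Set G) x ∪
      proj S (Subgroup.zpowers g : Set G) x' →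
      |h z - h x| ≤ 2 * (B + N + 1) ∧ ∃ k : ℤ, g ^ k = z := by
    rintro z (hz | hz)
    · have h1 := abs_le.1 (key x z fun n => Nat.cast_le.1 (hz.2.le.trans (hdist x n)))
      exact ⟨abs_le.2 (by omega), Subgroup.mem_zpowers_iff.1 hz.1⟩
    · have h1 := abs_le.1 (key x' z fun n => Nat.cast_le.1 (hz.2.le.trans (hdist x' n)))
      have h2 := abs_le.1 hx'
      exact ⟨abs_le.2 (by omega), Subgroup.mem_zpowers_iff.1 hz.1⟩
  have hm0 : (0 : ℤ) < m := by exact_mod_cast hm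
  have hheight : ∀ k : ℤ, |h (g ^ k) - k / m| ≤ B' := fun k => by
    have h1 : g ^ k = a ^ (k / m) * g ^ (k % m) := by
      rw [ha, ← zpow_natCast, ← zpow_mul, ← zpow_add, Int.mul_ediv_add_emod]
    rw [h1, hmul, add_sub_cancel_right]
    exact hB' _ (Int.emod_nonneg _ hm0.ne') (Int.emod_lt_of_pos _ hm0)
  obtain ⟨h1, k, rfl⟩ := hproj y hy
  obtain ⟨h2, k', rfl⟩ := hproj y' hy'
  have h3 := abs_le.1 (hheight k)
  have h4 := abs_le.1 (hheight k')
  have h5 := abs_le.1 h1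
  have h6 := abs_le.1 h2
  change ((wordLength S ((g ^ k)⁻¹ * g ^ k') : ℕ) : ℝ) ≤ C
  rw [← zpow_neg, ← zpow_add]
  refine Nat.cast_le.2 (hC _ ?_)
  have h7 := Int.mul_ediv_add_emod k m
  have h8 := Int.mul_ediv_add_emod k' m
  have h9 := Int.emod_nonneg k hm0.ne'
  have h10 := Int.emod_nonneg k' hm0.ne'
  have h11 := Int.emod_lt_of_pos k hm0
  have h12 := Int.emod_lt_of_pos k' hm0
  rw [abs_le]
  constructor
  · have h13 : (m : ℤ) * (-(4 * (B + N + 1) + 2 * B')) ≤ m * (k' / m - k / m) :=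
      mul_le_mul_of_nonneg_left (by omega) hm0.le
    linarith
  · have h13 : (m : ℤ) * (k' / m - k / m) ≤ m * (4 * (B + N + 1) + 2 * B') :=
      mul_le_mul_of_nonneg_left (by omega) hm0.le
    linarith

end Contraction
end GSC

namespace GSC

section WordLength

variable {S : Type} (P : C6Presentation S)

lemma wordVal_eq_mk (w : Word S) : wordVal w = FreeGroup.mk w := by
  have h := FreeGroup.lift_of_apply (FreeGroup.mk w)
  rw [FreeGroup.lift_mk] at h
  rw [← h, wordVal]
  congr 1
  refine List.map_congr_left fun a _ => ?_
  cases a.2 <;> simp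

/-- The projection from the free group. -/
abbrev C6Presentation.val : FreeGroup S →* P.Grp := PresentedGroup.mk _

variable [DecidableEq S]

lemma exists_list_prod (w : FreeGroup S) : ∃ l : List P.Grp, l.length = w.norm ∧
    (∀ x ∈ l, x ∈ P.gens ∨ x⁻¹ ∈ P.gens) ∧ l.prod = P.val w := by
  refine ⟨w.toWord.map fun a => cond a.2 (P.val (FreeGroup.of a.1))
    (P.val (FreeGroup.of a.1))⁻¹, by simp [FreeGroup.norm], ?_, ?_⟩
  · intro x hx
    obtain ⟨⟨a, b⟩, -, rfl⟩ := List.mem_map.1 hx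
    cases b
    · exact Or.inr ⟨a, by simp; rfl⟩
    · exact Or.inl ⟨a, rfl⟩
  · conv_rhs => rw [← FreeGroup.mk_toWord (x := w)]
    rw [← FreeGroup.lift_mk (f := fun a => P.val (FreeGroup.of a))]
    exact (FreeGroup.lift_unique P.val fun _ => rfl).symm

lemma wordLength_mk_le (w : FreeGroup S) : wordLength P.gens (P.val w) ≤ w.norm :=
  Nat.sInf_le (exists_list_prod P w)

lemma exists_norm_eq_wordLength (x : P.Grp) :
    ∃ w, P.val w = x ∧ w.norm = wordLength P.gens x := by
  have hlist : ∀ l : List P.Grp, (∀ x ∈ l, x ∈ P.gens ∨ x⁻¹ ∈ P.gens) →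
      ∃ w, P.val w = l.prod ∧ w.norm ≤ l.length := by
    intro l
    induction l with
    | nil => exact fun _ => ⟨1, by simp⟩
    | cons y l ih =>
      intro hl
      obtain ⟨w, h1, h2⟩ := ih fun x hx => hl x (List.mem_cons_of_mem _ hx)
      have h3 : ∃ v, P.val v = y ∧ v.norm = 1 := by
        rcases hl y List.mem_cons_self with ⟨a, ha⟩ | ⟨a, ha⟩
        · exact ⟨FreeGroup.of a, ha, FreeGroup.norm_of a⟩
        · refine ⟨(FreeGroup.of a)⁻¹, ?_, by simp⟩
          rw [map_inv, inv_eq_iff_eq_inv]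
          exact ha
      obtain ⟨v, h3, h4⟩ := h3
      refine ⟨v * w, by rw [map_mul, h1, h3, List.prod_cons], ?_⟩
      have := FreeGroup.norm_mul_le v w
      rw [List.length_cons]
      omega
  obtain ⟨v, rfl⟩ := PresentedGroup.mk_surjective _ x
  have hne : {n : ℕ | ∃ l : List P.Grp, l.length = n ∧ (∀ x ∈ l, x ∈ P.gens ∨ x⁻¹ ∈ P.gens) ∧
      l.prod = P.val v}.Nonempty := ⟨_, exists_list_prod P v⟩
  obtain ⟨l, h1, h2, h3⟩ := Nat.sInf_mem hne
  obtain ⟨w, h4, h5⟩ := hlist l h2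
  rw [h3] at h4
  refine ⟨w, h4, le_antisymm (h5.trans h1.le) ?_⟩
  rw [← h4]
  exact wordLength_mk_le P w

lemma wordLength_inv (x : P.Grp) : wordLength P.gens x⁻¹ = wordLength P.gens x := by
  have h : ∀ x : P.Grp, wordLength P.gens x⁻¹ ≤ wordLength P.gens x := fun x => by
    obtain ⟨w, rfl, hw⟩ := exists_norm_eq_wordLength P x
    rw [← hw, ← map_inv, ← FreeGroup.norm_inv_eq]
    exact wordLength_mk_le P _
  exact le_antisymm (h x) (by simpa using h x⁻¹)

lemma wordLength_mul_le (x y : P.Grp) :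
    wordLength P.gens (x * y) ≤ wordLength P.gens x + wordLength P.gens y := by
  obtain ⟨v, rfl, hv⟩ := exists_norm_eq_wordLength P x
  obtain ⟨w, rfl, hw⟩ := exists_norm_eq_wordLength P y
  rw [← hv, ← hw, ← map_mul]
  exact (wordLength_mk_le P _).trans (FreeGroup.norm_mul_le v w)

lemma finite_wordLength_le [Finite S] (n : ℕ) : {x : P.Grp | wordLength P.gens x ≤ n}.Finite := by
  refine ((finite_norm_le n).image P.val).subset fun x hx => ?_
  obtain ⟨w, rfl, hw⟩ := exists_norm_eq_wordLength P x
  exact ⟨w, hw.trans_le hx, rfl⟩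

end WordLength

end GSC

namespace GSC

lemma norm_map_le {α β : Type} [DecidableEq α] [DecidableEq β] (f : α → β) (x : FreeGroup α) :
    (FreeGroup.map f x).norm ≤ x.norm := by
  conv_lhs => rw [← FreeGroup.mk_toWord (x := x), FreeGroup.map.mk]
  exact FreeGroup.norm_mk_le.trans (by simp [FreeGroup.norm])

/-- The embedding of the factor with a given colour. -/
def col (i : Bool) : Factor →* FreeGroup ((Bool × Bool) × Bool) := FreeGroup.map fun a => (a, i)

lemma mk_relator (n : ℕ) (d : Bool) :
    FreeGroup.mk (relator n d 0) = col d (uel n true) * (col (!d) (uel n true))⁻¹ := by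
  rw [← map_inv, uel_inv, Bool.not_true, col, col, uel, uel, FreeGroup.map.mk, FreeGroup.map.mk,
    FreeGroup.mul_mk]
  congr 1
  have h0 := wlen_pos n
  apply List.ext_getElem
  · simp [wd_length, two_mul]
  · intro k h1 h2
    rw [relator_getElem, List.getElem_append]
    rw [relator_length] at h1
    simp only [List.length_map, wd_length, List.getElem_map, wd_getElem, cyc, zero_add,
      Nat.mod_eq_of_lt h1]
    split_ifs <;> rfl

lemma hom_rotate {S K : Type*} [Group K] (φ : FreeGroup S →* K) {l : List (S × Bool)}
    (h : φ (FreeGroup.mk l) = 1) {k : ℕ} (hk : k ≤ l.length) :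
    φ (FreeGroup.mk (l.rotate k)) = 1 := by
  rw [List.rotate_eq_drop_append_take hk, ← FreeGroup.mul_mk, map_mul]
  rw [← List.take_append_drop k l, ← FreeGroup.mul_mk, map_mul] at h
  rw [mul_eq_one_iff_eq_inv.1 h, mul_inv_cancel]

lemma hom_relator {K : Type*} [Group K] (φ : FreeGroup ((Bool × Bool) × Bool) →* K) {n : ℕ}
    (h : φ (col true (uel n true)) = φ (col false (uel n true))) (d : Bool) {s : ℕ}
    (hs : s < 2 * wlen n) : φ (FreeGroup.mk (relator n d s)) = 1 := by
  rw [← zero_add s, ← relator_rotate]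
  refine hom_rotate φ ?_ (by simpa using hs.le)
  rw [mk_relator, map_mul, map_inv, mul_inv_eq_one]
  cases d
  · exact h.symm
  · exact h

/-- Homomorphisms out of the presented groups. -/
noncomputable def descend (I : Set ℕ) {K : Type*} [Group K]
    (φ : FreeGroup ((Bool × Bool) × Bool) →* K)
    (h : ∀ n ∈ I, φ (col true (uel n true)) = φ (col false (uel n true))) : (pres I).Grp →* K :=
  PresentedGroup.toGroup (f := fun a => φ (FreeGroup.of a)) (by
    rintro _ ⟨_, ⟨n, hn, d, s, hs, rfl⟩, rfl⟩
    rw [wordVal_eq_mk, ← FreeGroup.lift_unique φ fun _ => rfl]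
    exact hom_relator φ (h n hn) d hs)

lemma descend_val (I : Set ℕ) {K : Type*} [Group K]
    (φ : FreeGroup ((Bool × Bool) × Bool) →* K)
    (h : ∀ n ∈ I, φ (col true (uel n true)) = φ (col false (uel n true)))
    (w : FreeGroup ((Bool × Bool) × Bool)) : descend I φ h ((pres I).val w) = φ w :=
  (FreeGroup.lift_unique φ fun _ => rfl).symm

/-- The factors of the presented groups. -/
noncomputable def side (I : Set ℕ) (i : Bool) : Factor →* (pres I).Grp := (pres I).val.comp (col i)

/-- The folding map on the free group. -/
def foldFree : FreeGroup ((Bool × Bool) × Bool) →* Factor := FreeGroup.map Prod.fst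

lemma foldFree_col (i : Bool) (f : Factor) : foldFree (col i f) = f := by
  rw [foldFree, col, FreeGroup.map.comp]
  exact FreeGroup.map.id f

/-- The folding map on the presented groups. -/
noncomputable def fold (I : Set ℕ) : (pres I).Grp →* Factor :=
  descend I foldFree fun n _ => by rw [foldFree_col, foldFree_col]

lemma side_uel {I : Set ℕ} {n : ℕ} (hn : n ∈ I) :
    side I true (uel n true) = side I false (uel n true) := by
  have h : (pres I).val (FreeGroup.mk (relator n true 0)) = 1 := by
    refine PresentedGroup.one_of_mem ⟨relator n true 0, ⟨n, hn, true, 0, ?_, rfl⟩, wordVal_eq_mk _⟩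
    have := wlen_pos n
    omega
  rwa [mk_relator, map_mul, map_inv, mul_inv_eq_one] at h

lemma side_amalgam {I : Set ℕ} {c : Factor} (hc : c ∈ sub I) : side I true c = side I false c := by
  induction hc using Subgroup.closure_induction with
  | mem x hx => obtain ⟨n, hn, rfl⟩ := hx; exact side_uel hn
  | one => simp
  | mul x y _ _ hx hy => rw [map_mul, map_mul, hx, hy]
  | inv x _ hx => rw [map_inv, map_inv, hx]

/-- The amalgamated product. -/
abbrev Amalgam (I : Set ℕ) := Monoid.PushoutI fun _ : Bool => (sub I).subtype

/-- The map from the free group to the amalgamated product. -/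
noncomputable def toAmalgamFree (I : Set ℕ) : FreeGroup ((Bool × Bool) × Bool) →* Amalgam I :=
  FreeGroup.lift fun a => Monoid.PushoutI.of a.2 (FreeGroup.of a.1)

lemma toAmalgamFree_col (I : Set ℕ) (i : Bool) (f : Factor) :
    toAmalgamFree I (col i f) = Monoid.PushoutI.of i f := by
  have h : (toAmalgamFree I).comp (col i) =
      Monoid.PushoutI.of (φ := fun _ : Bool => (sub I).subtype) i :=
    FreeGroup.ext_hom _ _ fun a => by
      rw [MonoidHom.comp_apply, col, FreeGroup.map.of, toAmalgamFree, FreeGroup.lift_apply_of]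
  exact DFunLike.congr_fun h f

lemma of_eq_base {I : Set ℕ} {c : Factor} (hc : c ∈ sub I) (i : Bool) :
    (Monoid.PushoutI.of i c : Amalgam I) =
      Monoid.PushoutI.base (fun _ : Bool => (sub I).subtype) ⟨c, hc⟩ :=
  Monoid.PushoutI.of_apply_eq_base (fun _ : Bool => (sub I).subtype) i ⟨c, hc⟩

/-- The map to the amalgamated product. -/
noncomputable def toAmalgam (I : Set ℕ) : (pres I).Grp →* Amalgam I :=
  descend I (toAmalgamFree I) fun n hn => by
    rw [toAmalgamFree_col, toAmalgamFree_col, of_eq_base (uel_mem hn true),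
      of_eq_base (uel_mem hn true)]

lemma toAmalgam_side (I : Set ℕ) (i : Bool) (f : Factor) :
    toAmalgam I (side I i f) = Monoid.PushoutI.of i f :=
  (descend_val _ _ _ _).trans (toAmalgamFree_col I i f)

lemma exists_reduced_word {I : Set ℕ} {n : ℕ} {i k : Bool} {x : (pres I).Grp}
    (h : Alt I (side I) n i k x) : ∃ w : Monoid.CoprodI.Word fun _ : Bool => Factor,
      Monoid.PushoutI.Reduced (fun _ : Bool => (sub I).subtype) w ∧ w.fstIdx = some i ∧
        Monoid.PushoutI.ofCoprodI w.prod = toAmalgam I x := by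
  have hne : ∀ s : Factor, s ∉ sub I → s ≠ 1 := by
    rintro _ hs rfl
    exact hs (one_mem _)
  induction h with
  | single i s hs =>
    refine ⟨.cons (i := i) s .empty (by simp [Monoid.CoprodI.Word.fstIdx]) (hne s hs), ?_,
      Monoid.CoprodI.Word.fstIdx_cons _ _ _ _, ?_⟩
    · intro g hg
      simp only [Monoid.CoprodI.Word.cons, Monoid.CoprodI.Word.empty, List.mem_singleton] at hg
      subst hg
      simpa using hs
    · rw [Monoid.CoprodI.Word.prod_cons, toAmalgam_side, Monoid.CoprodI.Word.prod_empty, mul_one,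
        Monoid.PushoutI.ofCoprodI_of]
  | cons n i k s y hs hy ih =>
    obtain ⟨w, h1, h2, h3⟩ := ih
    refine ⟨.cons (i := i) s w (by rw [h2]; simp) (hne s hs), ?_,
      Monoid.CoprodI.Word.fstIdx_cons _ _ _ _, ?_⟩
    · intro g hg
      simp only [Monoid.CoprodI.Word.cons, List.mem_cons] at hg
      rcases hg with rfl | hg
      · simpa using hs
      · exact h1 g hg
    · rw [Monoid.CoprodI.Word.prod_cons, map_mul, map_mul, toAmalgam_side, h3,
        Monoid.PushoutI.ofCoprodI_of]

lemma half_disjoint_base {I : Set ℕ} {i : Bool} {x : (pres I).Grp} (hx : x ∈ half I (side I) i) :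
    x ∉ base I (side I) := by
  rintro ⟨c, hc, rfl⟩
  obtain ⟨n, k, h⟩ := hx
  obtain ⟨w, h1, h2, h3⟩ := exists_reduced_word h
  rw [toAmalgam_side, of_eq_base hc] at h3
  have h4 := h1.eq_empty_of_mem_range (fun _ => Subtype.val_injective) ⟨_, h3.symm⟩
  rw [h4] at h2
  simp [Monoid.CoprodI.Word.fstIdx] at h2

lemma fold_side (I : Set ℕ) (i : Bool) (f : Factor) : fold I (side I i f) = f :=
  (descend_val _ _ _ _).trans (foldFree_col i f)

lemma norm_fold_le (I : Set ℕ) (x : (pres I).Grp) :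
    (fold I x).norm ≤ wordLength (pres I).gens x := by
  obtain ⟨w, rfl, hw⟩ := exists_norm_eq_wordLength (pres I) x
  rw [← hw, fold, descend_val]
  exact norm_map_le _ _

lemma wordLength_side (I : Set ℕ) (i : Bool) (f : Factor) :
    wordLength (pres I).gens (side I i f) = f.norm := by
  refine le_antisymm ((wordLength_mk_le _ _).trans (norm_map_le _ _)) ?_
  conv_lhs => rw [← fold_side I i f]
  exact norm_fold_le I _

lemma wordLength_one {S : Type} [DecidableEq S] (P : C6Presentation S) :
    wordLength P.gens 1 = 0 := by
  have h := wordLength_mk_le P 1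
  rw [map_one, FreeGroup.norm_one] at h
  omega

/-- The presented groups are doubles of the factor. -/
theorem double_pres (I : Set ℕ) :
    Double I (side I) (fold I) (wordLength (pres I).gens) where
  fold := fold_side I
  amalgam _ hc := side_amalgam hc
  reduced _ _ hx := half_disjoint_base hx
  length_inv := wordLength_inv _
  length_mul_le := wordLength_mul_le _
  length_factor := wordLength_side I
  length_fold := norm_fold_le I
  split x hx := by
    obtain ⟨w, rfl, hw⟩ := exists_norm_eq_wordLength (pres I) x
    rcases hL : w.toWord with _ | ⟨⟨⟨a, i⟩, b⟩, L⟩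
    · rw [FreeGroup.toWord_eq_nil_iff] at hL
      exact (hx (by rw [hL, map_one])).elim
    have h1 : w = col i (FreeGroup.mk [(a, b)]) * FreeGroup.mk L := by
      rw [col, FreeGroup.map.mk, FreeGroup.mul_mk]
      conv_lhs => rw [← FreeGroup.mk_toWord (x := w), hL]
      rfl
    have h2 : (pres I).val w =
        side I i (FreeGroup.mk [(a, b)]) * (pres I).val (FreeGroup.mk L) := by
      rw [h1, map_mul]; rfl
    have h3 : (FreeGroup.mk [(a, b)] : Factor).norm = 1 := by
      rw [FreeGroup.norm, FreeGroup.toWord_mk, FreeGroup.reduce_singleton]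
      rfl
    refine ⟨i, FreeGroup.mk [(a, b)], ?_, by rw [wordLength_side, h3]; exact one_pos⟩
    refine le_antisymm ?_ ?_
    · conv_lhs => rw [h2]
      rw [h2, inv_mul_cancel_left]
      exact wordLength_mul_le _ _ _
    · rw [← hw, h2, inv_mul_cancel_left, wordLength_side, h3, FreeGroup.norm, hL, List.length_cons,
        add_comm]
      exact Nat.add_le_add_right ((wordLength_mk_le _ _).trans FreeGroup.norm_mk_le) 1

theorem exists_axis_pres {I : Set ℕ} {x : (pres I).Grp} (hx : x ≠ 1) :
    ∃ m V N K, 1 ≤ m ∧ Axis (wordLength (pres I).gens) (x ^ m) V N K :=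
  (double_pres I).exists_axis hx

theorem eq_one_of_isOfFinOrder {I : Set ℕ} {x : (pres I).Grp} (h : IsOfFinOrder x) : x = 1 := by
  by_contra hx
  obtain ⟨n, hn, h1⟩ := isOfFinOrder_iff_pow_eq_one.1 h
  obtain ⟨m, V, N, K, -, A⟩ := exists_axis_pres hx
  obtain ⟨h, hh⟩ := A.exists_height
  have h2 : ∀ k : ℤ, ((x ^ m) ^ ((n : ℤ) * k))⁻¹ * 1 = 1 := fun k => by
    rw [zpow_mul, zpow_natCast, ← pow_mul, mul_comm m, pow_mul, h1, one_pow, one_zpow, inv_one,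
      one_mul]
  have h4 := fun k => hh 1 ((n : ℤ) * k)
  simp only [h2] at h4
  have h5 : ((1 : (pres I).Grp) ∈ V) := by
    refine (h4 (-|h 1|)).2 ?_
    have := neg_abs_le (h 1)
    nlinarith [abs_nonneg (h 1)]
  have h6 := (h4 (|h 1| + 1)).1 h5
  have := le_abs_self (h 1)
  nlinarith [abs_nonneg (h 1)]

theorem stronglyContracting_pres {I : Set ℕ} {x : (pres I).Grp} (hx : x ≠ 1) :
    StronglyContracting (pres I).gens (Subgroup.zpowers x : Set (pres I).Grp) := by
  obtain ⟨m, V, N, K, hm, A⟩ := exists_axis_pres hx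
  exact stronglyContracting_zpowers _ (wordLength_inv _) (finite_wordLength_le _) hm A

end GSC

namespace GSC

section Syllables

variable (I : Set ℕ)

/-- The element represented by a list of syllables. -/
noncomputable def sylProd (L : List (Bool × Factor)) : (pres I).Grp :=
  (L.map fun a => side I a.1 a.2).prod

/-- The total length of a list of syllables. -/
def sylNorm (L : List (Bool × Factor)) : ℕ := (L.map fun a => a.2.norm).sum

variable {I}

lemma sylProd_cons (i : Bool) (s : Factor) (L : List (Bool × Factor)) :
    sylProd I ((i, s) :: L) = side I i s * sylProd I L := rfl

lemma sylNorm_cons (i : Bool) (s : Factor) (L : List (Bool × Factor)) :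
    sylNorm ((i, s) :: L) = s.norm + sylNorm L := rfl

lemma side_eq_of_mem {s : Factor} (hs : s ∈ sub I) (i k : Bool) : side I i s = side I k s :=
  (double_pres I).side_eq hs i k

lemma mem_sub_inter_Iio {n : ℕ} {s : Factor} (hs : s ∈ sub I) (hn : s.norm < 58 * scale n) :
    s ∈ sub (I ∩ Set.Iio n) := by
  refine sub_mono ?_ (mem_sub_of_norm_le hs le_rfl)
  rintro m ⟨hm, h⟩
  refine ⟨hm, Set.mem_Iio.2 (not_le.1 fun hmn => ?_)⟩
  have := scale_mono hmn
  omega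

lemma exists_shorter {n : ℕ} (L : List (Bool × Factor)) (i : Bool) (s : Factor)
    (hL : sylNorm ((i, s) :: L) < 58 * scale n) :
    (∃ L', L'.length < L.length + 1 ∧ sylNorm L' ≤ sylNorm ((i, s) :: L) ∧
      sylProd I L' = sylProd I ((i, s) :: L) ∧
      sylProd (I ∩ Set.Iio n) L' = sylProd (I ∩ Set.Iio n) ((i, s) :: L)) ∨
    (s ∉ sub I ∧ sylProd I ((i, s) :: L) ∈ half I (side I) i) ∨ (L = [] ∧ s ∈ sub I) := by
  induction L generalizing i s with
  | nil =>
    by_cases hs : s ∈ sub I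
    · exact Or.inr (Or.inr ⟨rfl, hs⟩)
    · refine Or.inr (Or.inl ⟨hs, ?_⟩)
      rw [sylProd_cons, sylProd, List.map_nil, List.prod_nil, mul_one]
      exact (double_pres I).single_mem_half hs i
  | cons a L ih =>
    obtain ⟨k, t⟩ := a
    rw [sylNorm_cons, sylNorm_cons] at hL
    have hmerge : ∀ l, (∀ J, J = I ∨ J = I ∩ Set.Iio n → side J i s = side J l s) →
        (∀ J, J = I ∨ J = I ∩ Set.Iio n → side J k t = side J l t) →
        ∃ L', L'.length < ((k, t) :: L).length + 1 ∧
          sylNorm L' ≤ sylNorm ((i, s) :: (k, t) :: L) ∧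
          sylProd I L' = sylProd I ((i, s) :: (k, t) :: L) ∧
          sylProd (I ∩ Set.Iio n) L' = sylProd (I ∩ Set.Iio n) ((i, s) :: (k, t) :: L) := by
      intro l h1 h2
      have h3 : ∀ J, J = I ∨ J = I ∩ Set.Iio n →
          sylProd J ((l, s * t) :: L) = sylProd J ((i, s) :: (k, t) :: L) := fun J hJ => by
        rw [sylProd_cons, sylProd_cons, sylProd_cons, map_mul, h1 J hJ, h2 J hJ, mul_assoc]
      refine ⟨(l, s * t) :: L, by simp, ?_, h3 _ (Or.inl rfl), h3 _ (Or.inr rfl)⟩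
      have := FreeGroup.norm_mul_le s t
      simp only [sylNorm_cons]
      omega
    have hflip : ∀ {u : Factor}, u ∈ sub I → u.norm < 58 * scale n → ∀ (i l : Bool) (J),
        J = I ∨ J = I ∩ Set.Iio n → side J i u = side J l u := by
      rintro u hu hn i l J (rfl | rfl)
      · exact side_eq_of_mem hu i l
      · exact side_eq_of_mem (mem_sub_inter_Iio hu hn) i l
    by_cases hki : k = i
    · exact Or.inl (hmerge i (fun _ _ => rfl) fun _ _ => by rw [hki])
    by_cases hs : s ∈ sub I
    · exact Or.inl (hmerge k (hflip hs (by omega) i k) fun _ _ => rfl)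
    rcases ih k t (by rw [sylNorm_cons]; omega) with ⟨L', h1, h2, h3, h4⟩ | ⟨-, h⟩ | ⟨-, ht⟩
    · refine Or.inl ⟨(i, s) :: L', by simpa using h1, ?_, ?_, ?_⟩
      · rw [sylNorm_cons, sylNorm_cons i]; omega
      · rw [sylProd_cons, h3, sylProd_cons i]
      · rw [sylProd_cons, h4, sylProd_cons i]
    · refine Or.inr (Or.inl ⟨hs, ?_⟩)
      rw [sylProd_cons]
      exact (double_pres I).cons_mem_half hs (Bool.eq_not.2 hki) h
    · exact Or.inl (hmerge i (fun _ _ => rfl) (hflip ht (by omega) k i))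

lemma sylProd_eq_one {n : ℕ} {L : List (Bool × Factor)} (hL : sylNorm L < 58 * scale n)
    (h : sylProd I L = 1) : sylProd (I ∩ Set.Iio n) L = 1 := by
  induction hk : L.length using Nat.strong_induction_on generalizing L with
  | _ k ih =>
    rcases L with _ | ⟨⟨i, s⟩, L⟩
    · rfl
    rcases exists_shorter (I := I) L i s hL with ⟨L', h1, h2, h3, h4⟩ | ⟨-, h1⟩ | ⟨rfl, -⟩
    · rw [← h4]
      exact ih _ (hk ▸ h1) (h2.trans_lt hL) (h3.trans h) rfl
    · exact (half_disjoint_base h1 (h ▸ (double_pres I).one_mem_base)).elim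
    · rw [sylProd_cons, sylProd, List.map_nil, List.prod_nil, mul_one] at h
      have h1 := fold_side I i s
      rw [h, map_one] at h1
      rw [← h1, sylProd_cons, map_one, one_mul]
      rfl

/-- Short relations only involve short relators. -/
theorem val_inter_Iio_eq_one {n : ℕ} {w : FreeGroup ((Bool × Bool) × Bool)}
    (hw : w.norm < 58 * scale n) (h : (pres I).val w = 1) :
    (pres (I ∩ Set.Iio n)).val w = 1 := by
  have hsyl : ∀ J, (pres J).val w =
      sylProd J (w.toWord.map fun a => (a.1.2, FreeGroup.mk [(a.1.1, a.2)])) := by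
    intro J
    conv_lhs => rw [← FreeGroup.mk_toWord (x := w)]
    induction w.toWord with
    | nil => exact map_one _
    | cons a L ih =>
      rw [List.map_cons, sylProd_cons, ← ih, side, MonoidHom.comp_apply, ← map_mul, col,
        FreeGroup.map.mk, FreeGroup.mul_mk]
      rfl
  rw [hsyl] at h ⊢
  refine sylProd_eq_one ?_ h
  refine lt_of_le_of_lt ?_ hw
  rw [FreeGroup.norm]
  generalize w.toWord = L
  induction L with
  | nil => exact le_rfl
  | cons a L ih =>
    have : (FreeGroup.mk [(a.1.1, a.2)] : Factor).norm ≤ 1 := FreeGroup.norm_mk_le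
    rw [List.map_cons, sylNorm_cons, List.length_cons]
    omega

end Syllables

end GSC

namespace GSC

section Transport

variable {S : Type} {P : C6Presentation S} {H : Type*} [Group H]

/-- The transport along a generator of the covering of `P.Grp` with fibre `H` given by `c`. -/
def transportGen (c : P.Grp → P.Grp → H) (a : S) : Equiv.Perm (P.Grp × H) where
  toFun x := (x.1 * (P.val (.of a))⁻¹, x.2 * c x.1 (x.1 * (P.val (.of a))⁻¹))
  invFun x := (x.1 * P.val (.of a), x.2 * (c (x.1 * P.val (.of a)) x.1)⁻¹)
  left_inv x := by simp
  right_inv x := by simp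

/-- The transport of the covering of `P.Grp` with fibre `H` given by `c`. -/
def transport (c : P.Grp → P.Grp → H) : FreeGroup S →* Equiv.Perm (P.Grp × H) :=
  FreeGroup.lift (transportGen c)

variable [DecidableEq S]

lemma transport_apply {c : P.Grp → P.Grp → H} {D : ℕ} (h1 : ∀ p, c p p = 1)
    (hc : ∀ p q r, wordLength P.gens (p⁻¹ * q) ≤ D → wordLength P.gens (q⁻¹ * r) ≤ D →
      wordLength P.gens (p⁻¹ * r) ≤ D → c p q * c q r = c p r)
    {w : FreeGroup S} (hw : w.norm ≤ D) (p : P.Grp) (η : H) :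
    transport c w (p, η) = (p * (P.val w)⁻¹, η * c p (p * (P.val w)⁻¹)) := by
  rw [← FreeGroup.mk_toWord (x := w)]
  have hlen : w.toWord.length ≤ D := hw
  generalize w.toWord = L at hlen
  have hdist : ∀ (q : P.Grp) (v : FreeGroup S), v.norm ≤ D →
      wordLength P.gens (q⁻¹ * (q * (P.val v)⁻¹)) ≤ D := fun q v hv => by
    rw [inv_mul_cancel_left, wordLength_inv]
    exact (wordLength_mk_le P v).trans hv
  induction L with
  | nil =>
    rw [show (FreeGroup.mk [] : FreeGroup S) = 1 from rfl, map_one, map_one, inv_one, mul_one, h1,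
      mul_one]
    rfl
  | cons a L ih =>
    rw [List.length_cons] at hlen
    have hL : (FreeGroup.mk L).norm ≤ D := FreeGroup.norm_mk_le.trans (by omega)
    have haL : (FreeGroup.mk (a :: L)).norm ≤ D := FreeGroup.norm_mk_le.trans hlen
    have ha : (FreeGroup.mk [a]).norm ≤ D := FreeGroup.norm_mk_le.trans (by simp; omega)
    have hmul : (FreeGroup.mk (a :: L) : FreeGroup S) = .mk [a] * .mk L := by
      rw [FreeGroup.mul_mk]; rfl
    have hstep : ∀ q θ, transport c (.mk [a]) (q, θ) =
        (q * (P.val (.mk [a]))⁻¹, θ * c q (q * (P.val (.mk [a]))⁻¹)) := by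
      intro q θ
      obtain ⟨a, b⟩ := a
      cases b
      · have h2 : (FreeGroup.mk [(a, false)] : FreeGroup S) = (.of a)⁻¹ := rfl
        rw [h2] at ha ⊢
        rw [map_inv, map_inv, inv_inv]
        have h3 := hc q (q * P.val (.of a)) q
          (by simpa using hdist q _ ha)
          (by simpa [wordLength_inv] using hdist q _ ha) (by simp [wordLength_one])
        rw [h1] at h3
        rw [eq_inv_of_mul_eq_one_left h3]
        rfl
      · rfl
    rw [hmul, map_mul, Equiv.Perm.mul_apply, ih (by omega), hstep, ← hmul, mul_assoc p,
      ← mul_inv_rev, ← map_mul, ← hmul, mul_assoc η, hc]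
    · exact hdist _ _ hL
    · have h3 := hdist (p * (P.val (.mk L))⁻¹) _ ha
      rwa [mul_assoc p, ← mul_inv_rev, ← map_mul, ← hmul] at h3
    · exact hdist _ _ haL

end Transport

/-- The image in the group with fewer relators of a shortest representative. -/
noncomputable def trunc (I : Set ℕ) (n : ℕ) (x : (pres I).Grp) : (pres (I ∩ Set.Iio n)).Grp :=
  (pres (I ∩ Set.Iio n)).val (exists_norm_eq_wordLength (pres I) x).choose

lemma val_eq_of_norm_lt {I : Set ℕ} {n : ℕ} {v w : FreeGroup ((Bool × Bool) × Bool)}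
    (h : (pres I).val v = (pres I).val w) (hn : v.norm + w.norm < 58 * scale n) :
    (pres (I ∩ Set.Iio n)).val v = (pres (I ∩ Set.Iio n)).val w := by
  rw [← mul_inv_eq_one, ← map_inv, ← map_mul] at h ⊢
  refine val_inter_Iio_eq_one ?_ h
  have := FreeGroup.norm_mul_le v w⁻¹
  rw [FreeGroup.norm_inv_eq] at this
  omega

lemma trunc_val {I : Set ℕ} {n : ℕ} {w : FreeGroup ((Bool × Bool) × Bool)}
    (hw : w.norm < 29 * scale n) : trunc I n ((pres I).val w) = (pres (I ∩ Set.Iio n)).val w := by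
  have h := (exists_norm_eq_wordLength (pres I) ((pres I).val w)).choose_spec
  refine val_eq_of_norm_lt h.1 ?_
  have := wordLength_mk_le (pres I) w
  have h2 := h.2
  omega

lemma trunc_mul {I : Set ℕ} {n : ℕ} {x y : (pres I).Grp}
    (hx : wordLength (pres I).gens x ≤ 19 * scale n)
    (hy : wordLength (pres I).gens y ≤ 19 * scale n)
    (hxy : wordLength (pres I).gens (x * y) ≤ 19 * scale n) :
    trunc I n x * trunc I n y = trunc I n (x * y) := by
  have h1 := (exists_norm_eq_wordLength (pres I) x).choose_spec
  have h2 := (exists_norm_eq_wordLength (pres I) y).choose_spec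
  have h3 := (exists_norm_eq_wordLength (pres I) (x * y)).choose_spec
  rw [trunc, trunc, trunc, ← map_mul]
  refine val_eq_of_norm_lt (by rw [map_mul, h1.1, h2.1, h3.1]) ?_
  have h4 := FreeGroup.norm_mul_le (exists_norm_eq_wordLength (pres I) x).choose
    (exists_norm_eq_wordLength (pres I) y).choose
  have := scale_ge n
  have h5 := h1.2
  have h6 := h2.2
  have h7 := h3.2
  omega

lemma trunc_one (I : Set ℕ) (n : ℕ) : trunc I n 1 = 1 := by
  have h := scale_ge n
  rw [← map_one (pres I).val, trunc_val (by simp; omega), map_one]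

/-- The transport of a covering with small holonomy along a short relation is trivial. -/
lemma transport_eq_one {J : Set ℕ} {H : Type*} [Group H]
    {c : (pres J).Grp → (pres J).Grp → H} {D n : ℕ} (h1 : ∀ p, c p p = 1)
    (hc : ∀ p q r, wordLength (pres J).gens (p⁻¹ * q) ≤ D →
      wordLength (pres J).gens (q⁻¹ * r) ≤ D →
      wordLength (pres J).gens (p⁻¹ * r) ≤ D → c p q * c q r = c p r)
    (hn : n ∉ J) (hD : ∀ m < n, wlen m ≤ D) {w : FreeGroup ((Bool × Bool) × Bool)}
    (hw : w.norm < 58 * scale (n + 1)) (h : (pres J).val w = 1) : transport c w = 1 := by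
  have hrel : ∀ m ∈ J ∩ Set.Iio (n + 1),
      transport c (col true (uel m true)) = transport c (col false (uel m true)) := by
    rintro m ⟨hm, hmn⟩
    have hmn : m < n := lt_of_le_of_ne (Nat.lt_succ_iff.1 hmn) (by rintro rfl; exact hn hm)
    have hle : ∀ i, (col i (uel m true)).norm ≤ D := fun i =>
      (norm_map_le _ _).trans ((norm_uel m true).le.trans (hD m hmn))
    ext1 ⟨p, η⟩
    rw [transport_apply h1 hc (hle _), transport_apply h1 hc (hle _),
      show (pres J).val (col true (uel m true)) = (pres J).val (col false (uel m true)) from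
        side_uel hm]
  have h2 := val_inter_Iio_eq_one hw h
  rw [← descend_val _ _ hrel, h2, map_one]

section QuasiIsometry

variable {I J : Set ℕ} {f : (pres I).Grp → (pres J).Grp} {g : (pres J).Grp → (pres I).Grp}
  {L A n D : ℕ}

/-- The holonomy. -/
noncomputable def holonomy (I : Set ℕ) (n : ℕ) (x y : (pres I).Grp) :
    (pres (I ∩ Set.Iio n)).Grp := trunc I n (x⁻¹ * y)

/-- The holonomy, pulled back along a map. -/
noncomputable def pullback (I : Set ℕ) (n : ℕ) {K : Type*} (g : K → (pres I).Grp) (p q : K) :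
    (pres (I ∩ Set.Iio n)).Grp := holonomy I n (g p) (g q)

lemma holonomy_self (x : (pres I).Grp) : holonomy I n x x = 1 := by
  rw [holonomy, inv_mul_cancel, trunc_one]

lemma holonomy_mul {x y z : (pres I).Grp}
    (h1 : wordLength (pres I).gens (x⁻¹ * y) ≤ 19 * scale n)
    (h2 : wordLength (pres I).gens (y⁻¹ * z) ≤ 19 * scale n)
    (h3 : wordLength (pres I).gens (x⁻¹ * z) ≤ 19 * scale n) :
    holonomy I n x y * holonomy I n y z = holonomy I n x z := by
  have h : x⁻¹ * y * (y⁻¹ * z) = x⁻¹ * z := by group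
  rw [holonomy, holonomy, trunc_mul h1 h2 (by rwa [h]), h, holonomy]

lemma wordLength_inv_mul_comm {S : Type} [DecidableEq S] (P : C6Presentation S) (x y : P.Grp) :
    wordLength P.gens (x⁻¹ * y) = wordLength P.gens (y⁻¹ * x) := by
  rw [← wordLength_inv, mul_inv_rev, inv_inv]

lemma wordLength_triangle {S : Type} [DecidableEq S] (P : C6Presentation S) (x y z : P.Grp) :
    wordLength P.gens (x⁻¹ * z) ≤ wordLength P.gens (x⁻¹ * y) + wordLength P.gens (y⁻¹ * z) := by
  have h := wordLength_mul_le P (x⁻¹ * y) (y⁻¹ * z)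
  rwa [show x⁻¹ * y * (y⁻¹ * z) = x⁻¹ * z by group] at h

variable
  (hf : ∀ x y, wordLength (pres J).gens ((f x)⁻¹ * f y) ≤
    L * wordLength (pres I).gens (x⁻¹ * y) + A)
  (hf' : ∀ x y, wordLength (pres I).gens (x⁻¹ * y) ≤
    L * (wordLength (pres J).gens ((f x)⁻¹ * f y) + A))
  (hg : ∀ p, wordLength (pres J).gens ((f (g p))⁻¹ * p) ≤ A)

include hf' hg

lemma wordLength_inverse_le (p q : (pres J).Grp) :
    wordLength (pres I).gens ((g p)⁻¹ * g q) ≤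
      L * (wordLength (pres J).gens (p⁻¹ * q) + 3 * A) := by
  refine (hf' _ _).trans (Nat.mul_le_mul_left _ ?_)
  have h1 := wordLength_triangle (pres J) (f (g p)) p (f (g q))
  have h2 := wordLength_triangle (pres J) p q (f (g q))
  have h3 := hg p
  have h4 := hg q
  rw [wordLength_inv_mul_comm] at h4
  omega

lemma wordLength_comp_le (x : (pres I).Grp) :
    wordLength (pres I).gens (x⁻¹ * g (f x)) ≤ L * (2 * A) := by
  refine (hf' _ _).trans (Nat.mul_le_mul_left _ ?_)
  have h3 := hg (f x)
  rw [wordLength_inv_mul_comm] at h3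
  omega

lemma pullback_mul (hD : L * (D + 3 * A) ≤ 19 * scale n) (p q r : (pres J).Grp)
    (h1 : wordLength (pres J).gens (p⁻¹ * q) ≤ D) (h2 : wordLength (pres J).gens (q⁻¹ * r) ≤ D)
    (h3 : wordLength (pres J).gens (p⁻¹ * r) ≤ D) :
    pullback I n g p q * pullback I n g q r = pullback I n g p r := by
  have hle : ∀ p q, wordLength (pres J).gens (p⁻¹ * q) ≤ D →
      wordLength (pres I).gens ((g p)⁻¹ * g q) ≤ 19 * scale n := fun p q h =>
    (wordLength_inverse_le hf' hg p q).trans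
      ((Nat.mul_le_mul_left _ (Nat.add_le_add_right h _)).trans hD)
  exact holonomy_mul (hle _ _ h1) (hle _ _ h2) (hle _ _ h3)

include hf

lemma pullback_image (hL : 1 ≤ L) (hLA : L + A ≤ D) (hD : L * (D + 3 * A) ≤ 19 * scale n)
    {w : FreeGroup ((Bool × Bool) × Bool)} (hw : w.norm ≤ 1) (x : (pres I).Grp) :
    pullback I n g (f x) (f (x * (pres I).val w)) = (holonomy I n x (g (f x)))⁻¹ *
      (pres (I ∩ Set.Iio n)).val w *
        holonomy I n (x * (pres I).val w) (g (f (x * (pres I).val w))) := by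
  set y := x * (pres I).val w with hy
  have hxy : x⁻¹ * y = (pres I).val w := by rw [hy, inv_mul_cancel_left]
  have hd1 : wordLength (pres I).gens (x⁻¹ * y) ≤ 1 := by
    rw [hxy]; exact (wordLength_mk_le _ _).trans hw
  have hd2 : wordLength (pres J).gens ((f x)⁻¹ * f y) ≤ L + A := (hf x y).trans (by nlinarith)
  have hx1 := wordLength_comp_le hf' hg x
  have hy1 := wordLength_comp_le hf' hg y
  have hg1 := wordLength_inverse_le hf' hg (f x) (f y)
  have hq := scale_ge n
  have hb : L * (2 * A) + L * (2 * A) + 1 ≤ 19 * scale n := by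
    have h1 : L * (L + A + 3 * A) ≤ 19 * scale n :=
      (Nat.mul_le_mul_left _ (Nat.add_le_add_right hLA _)).trans hD
    have h2 : 1 ≤ L * L := Nat.mul_pos hL hL
    linarith
  have hxg := wordLength_triangle (pres I) x y (g (f y))
  have e1 : holonomy I n x y * holonomy I n y (g (f y)) = holonomy I n x (g (f y)) :=
    holonomy_mul (by omega) (by omega) (by omega)
  have e2 : holonomy I n x (g (f x)) * holonomy I n (g (f x)) (g (f y)) =
      holonomy I n x (g (f y)) :=
    holonomy_mul (by omega) (hg1.trans ((Nat.mul_le_mul_left _ (by omega)).trans hD)) (by omega)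
  have e3 : holonomy I n x y = (pres (I ∩ Set.Iio n)).val w := by
    rw [holonomy, hxy, trunc_val (by omega)]
  rw [pullback, eq_inv_mul_of_mul_eq e2, ← e1, e3, mul_assoc]

lemma exists_transport (hL : 1 ≤ L) (hLA : L + A ≤ D) (hD : L * (D + 3 * A) ≤ 19 * scale n)
    (w : FreeGroup ((Bool × Bool) × Bool)) (x : (pres I).Grp) :
    ∃ v, v.norm ≤ (L + A) * w.norm ∧ (pres J).val v = (f x)⁻¹ * f (x * (pres I).val w) ∧
      ∀ η, transport (pullback I n g) v⁻¹ (f x, η) =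
        (f (x * (pres I).val w), η * ((holonomy I n x (g (f x)))⁻¹ *
          (pres (I ∩ Set.Iio n)).val w *
            holonomy I n (x * (pres I).val w) (g (f (x * (pres I).val w))))) := by
  rw [← FreeGroup.mk_toWord (x := w), FreeGroup.norm, FreeGroup.toWord_mk,
    FreeGroup.reduce_toWord]
  generalize w.toWord = W
  induction W generalizing x with
  | nil =>
    refine ⟨1, by simp, ?_, fun η => ?_⟩
    · rw [show (FreeGroup.mk [] : FreeGroup ((Bool × Bool) × Bool)) = 1 from rfl, map_one, map_one,
        mul_one, inv_mul_cancel]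
    · rw [show (FreeGroup.mk [] : FreeGroup ((Bool × Bool) × Bool)) = 1 from rfl]
      simp
  | cons a W ih =>
    have hmul : (FreeGroup.mk (a :: W) : FreeGroup ((Bool × Bool) × Bool)) = .mk [a] * .mk W := by
      rw [FreeGroup.mul_mk]; rfl
    have ha : (FreeGroup.mk [a]).norm ≤ 1 := FreeGroup.norm_mk_le
    have hstep := pullback_image hf hf' hg hL hLA hD ha x
    obtain ⟨v, hv1, hv2, hv3⟩ := ih (x * (pres I).val (.mk [a]))
    set y := x * (pres I).val (.mk [a]) with hy
    have hxy : x * (pres I).val (.mk (a :: W)) = y * (pres I).val (.mk W) := by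
      rw [hmul, map_mul, hy, mul_assoc]
    have hd : wordLength (pres J).gens ((f x)⁻¹ * f y) ≤ L + A := by
      have h1 := hf x y
      have h2 := (wordLength_mk_le (pres I) (.mk [a])).trans ha
      rw [hy, inv_mul_cancel_left] at h1
      nlinarith
    obtain ⟨u, hu1, hu2⟩ := exists_norm_eq_wordLength (pres J) ((f x)⁻¹ * f y)
    have hu : u⁻¹.norm ≤ D := by rw [FreeGroup.norm_inv_eq, hu2]; omega
    refine ⟨u * v, ?_, ?_, fun η => ?_⟩
    · have := FreeGroup.norm_mul_le u v
      rw [List.length_cons, mul_add, mul_one]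
      omega
    · rw [map_mul, hu1, hv2, hxy]; group
    · rw [mul_inv_rev, map_mul, Equiv.Perm.mul_apply,
        transport_apply (c := pullback I n g) (fun p => holonomy_self _)
          (pullback_mul hf' hg hD) hu, map_inv (pres J).val, inv_inv,
        hu1, mul_inv_cancel_left, hv3, hstep, hxy, hmul, map_mul]
      congr 1
      group

theorem false_of_coarse (hL : 1 ≤ L) (hLA : L + A ≤ D)
    (hD : L * (D + 3 * A) ≤ 19 * scale n) (hlen : ∀ m < n, wlen m ≤ D)
    (hsc : (L + A) * (2 * wlen n) < 58 * scale (n + 1)) (hnI : n ∈ I) (hnJ : n ∉ J) : False := by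
  obtain ⟨v, hv1, hv2, hv3⟩ := exists_transport hf hf' hg hL hLA hD
    (col true (uel n true) * (col false (uel n true))⁻¹) 1
  have hval : (pres I).val (col true (uel n true) * (col false (uel n true))⁻¹) = 1 := by
    rw [map_mul, map_inv, mul_inv_eq_one]
    exact side_uel hnI
  have hwn : (col true (uel n true) * (col false (uel n true))⁻¹).norm ≤ 2 * wlen n := by
    refine (FreeGroup.norm_mul_le _ _).trans ?_
    rw [FreeGroup.norm_inv_eq, two_mul]
    exact add_le_add ((norm_map_le _ _).trans (norm_uel n true).le)
      ((norm_map_le _ _).trans (norm_uel n true).le)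
  rw [hval, mul_one, inv_mul_cancel] at hv2
  have hv : transport (pullback I n g) v⁻¹ = 1 := by
    rw [map_inv, transport_eq_one (c := pullback I n g) (fun p => holonomy_self _)
      (pullback_mul hf' hg hD) hnJ hlen
      (lt_of_le_of_lt (hv1.trans (Nat.mul_le_mul_left _ hwn)) hsc) hv2, inv_one]
  have h1 := congrArg Prod.snd (hv3 1)
  rw [hv, hval, mul_one, Equiv.Perm.one_apply, one_mul, mul_assoc, eq_comm, inv_mul_eq_one,
    right_eq_mul, map_mul, map_inv, mul_inv_eq_one] at h1
  have hn : uel n true ∉ sub (I ∩ Set.Iio n) := uel_notMem fun h => lt_irrefl n h.2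
  have hd := double_pres (I ∩ Set.Iio n)
  refine hd.half_disjoint (i := true) rfl (hd.single_mem_half hn true) ?_
  rw [show side (I ∩ Set.Iio n) true (uel n true) = side (I ∩ Set.Iio n) false (uel n true) from h1]
  exact hd.single_mem_half hn false

end QuasiIsometry

end GSC

namespace GSC

lemma exists_nat_constants {I J : Set ℕ} (h : QIsom (pres I).gens (pres J).gens) :
    ∃ (f : (pres I).Grp → (pres J).Grp) (g : (pres J).Grp → (pres I).Grp) (L A : ℕ), 1 ≤ L ∧
      (∀ x y, wordLength (pres J).gens ((f x)⁻¹ * f y) ≤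
        L * wordLength (pres I).gens (x⁻¹ * y) + A) ∧
      (∀ x y, wordLength (pres I).gens (x⁻¹ * y) ≤
        L * (wordLength (pres J).gens ((f x)⁻¹ * f y) + A)) ∧
      ∀ p, wordLength (pres J).gens ((f (g p))⁻¹ * p) ≤ A := by
  obtain ⟨f, L, A, hL, hA, hf, hs⟩ := h
  choose g hg using hs
  have hL' := Nat.le_ceil L
  have hA' := Nat.le_ceil A
  have hL1 : (1 : ℝ) ≤ ⌈L⌉₊ := hL.trans hL'
  refine ⟨f, g, ⌈L⌉₊, ⌈A⌉₊, by exact_mod_cast hL1, fun x y => ?_, fun x y => ?_, fun p => ?_⟩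
  · have h1 := (hf x y).2
    unfold wdist at h1
    rw [← Nat.cast_le (α := ℝ)]
    push_cast
    refine h1.trans ?_
    gcongr
  · have h1 := (hf x y).1
    unfold wdist at h1
    rw [sub_le_iff_le_add, inv_mul_le_iff₀ (by linarith)] at h1
    rw [← Nat.cast_le (α := ℝ)]
    push_cast
    refine h1.trans ?_
    gcongr
  · have h1 := hg p
    unfold wdist at h1
    exact_mod_cast h1.trans hA'

theorem not_qIsom {I J : Set ℕ} (h : (I \ J).Infinite) :
    ¬ QIsom (pres I).gens (pres J).gens := by
  intro hq
  obtain ⟨f, g, L, A, hL, hf, hf', hg⟩ := exists_nat_constants hq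
  obtain ⟨n, ⟨hnI, hnJ⟩, hn⟩ := h.exists_gt (L + A + 1)
  obtain ⟨k, rfl⟩ : ∃ k, n = k + 1 := ⟨n - 1, by omega⟩
  have hk : L + A < 2 ^ k := (show L + A < k by omega).trans Nat.lt_two_pow_self
  have hw := wlen_add (k + 1)
  have hk1 : 2 * 2 ^ k ≤ 2 ^ k * 2 ^ k := Nat.mul_le_mul_right _ (by omega)
  have h1 := scale_succ k
  have h2 := scale_succ (k + 1)
  have hpos := scale_ge k
  have hpow : scale k = 2 ^ k ^ 2 * 8192 := by rw [scale, pow_add]; norm_num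
  have hAk : 2 ^ k ≤ scale k := by
    rw [hpow]
    have : 2 ^ k ≤ 2 ^ k ^ 2 := Nat.pow_le_pow_right two_pos (by nlinarith)
    omega
  have e1 : 2 ^ (2 * k + 1) = 2 * (2 ^ k * 2 ^ k) := by ring
  have e2 : 2 ^ (2 * (k + 1) + 1) = 8 * (2 ^ k * 2 ^ k) := by ring
  rw [e1] at h1
  rw [e2] at h2
  refine false_of_coarse hf hf' hg (n := k + 1) (D := 64 * scale k) hL (by omega) ?_
    (fun m hm => ?_) ?_ hnI hnJ
  · calc L * (64 * scale k + 3 * A) ≤ 2 ^ k * (67 * scale k) := Nat.mul_le_mul (by omega) (by omega)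
      _ = 67 * (2 ^ k * scale k) := by ring
      _ ≤ 19 * (2 * (2 * 2 ^ k) * scale k) := by
        have : 0 ≤ 2 ^ k * scale k := Nat.zero_le _
        linarith
      _ ≤ 19 * (2 * (2 ^ k * 2 ^ k) * scale k) := by gcongr
      _ = 19 * scale (k + 1) := by rw [h1]
  · have := wlen_add m
    have := scale_mono (Nat.lt_succ_iff.1 hm)
    omega
  · rw [h2]
    have h3 := scale_ge (k + 1)
    calc (L + A) * (2 * wlen (k + 1)) < 2 ^ k * (128 * scale (k + 1)) :=
          Nat.mul_lt_mul_of_lt_of_le hk (by omega) (by omega)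
      _ = 64 * (2 * 2 ^ k * scale (k + 1)) := by ring
      _ ≤ 64 * (2 ^ k * 2 ^ k * scale (k + 1)) := by gcongr
      _ ≤ 58 * (8 * (2 ^ k * 2 ^ k) * scale (k + 1)) := by
        have : 0 ≤ 2 ^ k * 2 ^ k * scale (k + 1) := Nat.zero_le _
        linarith

/-- The codes of the initial segments of a binary sequence. -/
def codes (x : ℕ → Bool) : Set ℕ := {n | ∃ m, n = Encodable.encode ((List.range m).map x)}

lemma infinite_codes_diff {x y : ℕ → Bool} (h : x ≠ y) : (codes x \ codes y).Infinite := by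
  obtain ⟨k, hk⟩ := Function.ne_iff.1 h
  refine Set.infinite_of_injective_forall_mem
    (f := fun m => Encodable.encode ((List.range (k + 1 + m)).map x)) (fun a b hab => ?_)
    fun m => ⟨⟨_, rfl⟩, ?_⟩
  · have h1 := congrArg List.length (Encodable.encode_injective hab)
    simpa using h1
  · rintro ⟨l, hl⟩
    have h1 := Encodable.encode_injective hl
    obtain rfl : k + 1 + m = l := by simpa using congrArg List.length h1
    exact hk (List.map_inj_left.1 h1 k (by simp; omega))

/-- There are a finite alphabet `S` and `2^{ℵ₀}` classical C'(1/6)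
presentations over `S` whose groups are torsion-free, have all nontrivial cyclic
subgroups strongly contracting, and are pairwise non-quasi-isometric. -/
theorem statement15 :
    ∃ (S : Type) (_ : Finite S) (𝓘 : Type) (Pfam : 𝓘 → C6Presentation S),
      Cardinal.mk 𝓘 = 2 ^ Cardinal.aleph0 ∧
      (∀ i : 𝓘, ∀ g : (Pfam i).Grp, IsOfFinOrder g → g = 1) ∧
      (∀ i : 𝓘, ∀ g : (Pfam i).Grp, g ≠ 1 →
        StronglyContracting (Pfam i).gens
          ((Subgroup.zpowers g : Subgroup (Pfam i).Grp) : Set (Pfam i).Grp)) ∧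
      (∀ i j : 𝓘, i ≠ j → ¬ QIsom (Pfam i).gens (Pfam j).gens) := by
  refine ⟨(Bool × Bool) × Bool, inferInstance, ℕ → Bool, fun x => pres (codes x), by simp,
    fun _ _ => eq_one_of_isOfFinOrder, fun _ _ => stronglyContracting_pres,
    fun _ _ h => not_qIsom (infinite_codes_diff h)⟩

end GSC
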